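/- For every integer t ≥ 2, the following identity of formal power series in x over ℤ holds: (∏_{i≥1} (1-x^{2i})^{t+1}/(1-x^i))^{2t-1} = Σ_{λ ∈ SC_{(2t)}} δ_λ x^{|λ|} ∏_{h ∈ H(λ)} (1 - 2t/(h ε_h)), where the sum ranges over self-conjugate 2t-cores; moreover the same identity holds with the sum extended over all self-conjugate partitions, since the product ∏_{h ∈ H(λ)} (1 - 2t/(h ε_h)) vanishes for every self-conjugate partition λ that is not a 2t-core. -/

import Mathlib

/-!
Statement 19 (equation (56) and its extension): for every integer `t ≥ 2`,
(∏_{i≥1} (1-x^{2i})^{t+1}/(1-x^i))^{2t-1}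
  = Σ_{λ ∈ SC_{(2t)}} δ_λ x^{|λ|} ∏_{h ∈ H(λ)} (1 - 2t/(h ε_h)),
the sum ranging over self-conjugate 2t-cores; moreover the same identity holds
with the sum extended over all self-conjugate partitions, since
∏_{h ∈ H(λ)} (1 - 2t/(h ε_h)) vanishes for every self-conjugate partition that
is not a 2t-core. (Formal power series with rational coefficients.)
-/

noncomputable section

open PowerSeries

/-- Product (pi) topology on formal power series. -/
instance {R : Type*} [TopologicalSpace R] : TopologicalSpace (PowerSeries R) :=
  inferInstanceAs (TopologicalSpace ((Unit →₀ ℕ) → R))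

/-- The hook length of the box `c = (i, j)` (0-indexed) of a Young diagram. -/
def hookLen (μ : YoungDiagram) (c : ℕ × ℕ) : ℕ :=
  μ.rowLen c.1 + μ.colLen c.2 - c.1 - c.2 - 1

/-- The Durfee length: the number of diagonal cells. -/
def durfee (μ : YoungDiagram) : ℕ :=
  (μ.cells.filter fun c => c.1 = c.2).card

/-- `ε` of a box: `-1` if strictly above the principal diagonal, `1` otherwise. -/
def epsQ (c : ℕ × ℕ) : ℚ := if c.2 < c.1 then (-1 : ℚ) else 1




namespace NOC

/-! ### Congruence of power series up to a given order -/

section Cong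

variable {K : Type*} [CommRing K]

/-- `a` and `b` agree modulo `X ^ N`. -/
def Cg (N : ℕ) (a b : PowerSeries K) : Prop := X ^ N ∣ a - b

theorem Cg.refl (N : ℕ) (a : PowerSeries K) : Cg N a a := by simp [Cg]

theorem Cg.of_eq {N : ℕ} {a b : PowerSeries K} (h : a = b) : Cg N a b := h ▸ Cg.refl N a

theorem Cg.symm {N : ℕ} {a b : PowerSeries K} (h : Cg N a b) : Cg N b a := by
  unfold Cg at *
  rw [← neg_sub]; exact (dvd_neg).2 h

theorem Cg.trans {N : ℕ} {a b c : PowerSeries K} (h : Cg N a b) (h' : Cg N b c) : Cg N a c := by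
  unfold Cg at *
  have := dvd_add h h'
  simpa using this

theorem Cg.add {N : ℕ} {a b c d : PowerSeries K} (h : Cg N a b) (h' : Cg N c d) :
    Cg N (a + c) (b + d) := by
  unfold Cg at *
  have := dvd_add h h'
  convert this using 1; ring

theorem Cg.mul {N : ℕ} {a b c d : PowerSeries K} (h : Cg N a b) (h' : Cg N c d) :
    Cg N (a * c) (b * d) := by
  unfold Cg at *
  have := dvd_add (h.mul_right c) (h'.mul_left b)
  convert this using 1; ring

theorem Cg.mono {M N : ℕ} (hMN : M ≤ N) {a b : PowerSeries K} (h : Cg N a b) : Cg M a b :=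
  (pow_dvd_pow X hMN).trans h

theorem Cg.sum {ι : Type*} {N : ℕ} (s : Finset ι) {f g : ι → PowerSeries K}
    (h : ∀ i ∈ s, Cg N (f i) (g i)) : Cg N (∑ i ∈ s, f i) (∑ i ∈ s, g i) := by
  unfold Cg at *
  rw [← Finset.sum_sub_distrib]
  exact Finset.dvd_sum h

theorem Cg.prod {ι : Type*} {N : ℕ} (s : Finset ι) {f g : ι → PowerSeries K}
    (h : ∀ i ∈ s, Cg N (f i) (g i)) : Cg N (∏ i ∈ s, f i) (∏ i ∈ s, g i) := by
  classical
  induction s using Finset.induction_on with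
  | empty => simpa using Cg.refl N 1
  | insert i s hi ih =>
    rw [Finset.prod_insert hi, Finset.prod_insert hi]
    exact (h i (Finset.mem_insert_self _ _)).mul
      (ih fun j hj => h j (Finset.mem_insert_of_mem hj))

theorem Cg.pow {N : ℕ} {a b : PowerSeries K} (h : Cg N a b) (n : ℕ) : Cg N (a ^ n) (b ^ n) := by
  have := Cg.prod (Finset.range n) (f := fun _ => a) (g := fun _ => b) (N := N) (fun _ _ => h)
  simpa using this

theorem Cg.coeff_eq {N : ℕ} {a b : PowerSeries K} (h : Cg N a b) {n : ℕ} (hn : n < N) :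
    coeff n a = coeff n b := by
  have := X_pow_dvd_iff.1 h n hn
  rwa [map_sub, sub_eq_zero] at this

theorem cg_iff {N : ℕ} {a b : PowerSeries K} :
    Cg N a b ↔ ∀ n < N, coeff n a = coeff n b := by
  refine ⟨fun h n hn => h.coeff_eq hn, fun h => X_pow_dvd_iff.2 fun m hm => ?_⟩
  rw [map_sub, h m hm, sub_self]

theorem eq_of_cg {a b : PowerSeries K} (h : ∀ N, Cg N a b) : a = b := by
  ext n
  exact (h (n + 1)).coeff_eq (Nat.lt_succ_self n)

theorem Cg.map {K' : Type*} [CommRing K'] (f : K →+* K') {N : ℕ} {a b : PowerSeries K}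
    (h : Cg N a b) : Cg N (PowerSeries.map f a) (PowerSeries.map f b) := by
  rw [cg_iff] at *
  intro n hn
  simp [h n hn]

/-- The partial products of `f` converge coefficientwise to `P`. -/
def HasIProd (f : ℕ → PowerSeries K) (P : PowerSeries K) : Prop :=
  ∀ M, ∃ N0, ∀ N, N0 ≤ N → Cg M (∏ i ∈ Finset.range N, f i) P

/-- The symmetric partial sums of `w` converge coefficientwise to `S`. -/
def HasISum (w : ℤ → PowerSeries K) (S : PowerSeries K) : Prop :=
  ∀ M, ∃ L0 : ℕ, ∀ L : ℕ, L0 ≤ L → Cg M (∑ k ∈ Finset.Icc (-(L : ℤ)) L, w k) S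

theorem HasIProd.unique {f : ℕ → PowerSeries K} {P Q : PowerSeries K} (h : HasIProd f P)
    (h' : HasIProd f Q) : P = Q := by
  apply eq_of_cg
  intro M
  obtain ⟨N1, h1⟩ := h M
  obtain ⟨N2, h2⟩ := h' M
  exact (h1 (max N1 N2) (le_max_left _ _)).symm.trans (h2 _ (le_max_right _ _))

theorem HasIProd.mul {f g : ℕ → PowerSeries K} {P Q : PowerSeries K} (h : HasIProd f P)
    (h' : HasIProd g Q) : HasIProd (fun n => f n * g n) (P * Q) := by
  intro M
  obtain ⟨N1, h1⟩ := h M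
  obtain ⟨N2, h2⟩ := h' M
  refine ⟨max N1 N2, fun N hN => ?_⟩
  rw [Finset.prod_mul_distrib]
  exact (h1 N (le_trans (le_max_left _ _) hN)).mul (h2 N (le_trans (le_max_right _ _) hN))

theorem HasIProd.one : HasIProd (fun _ => (1 : PowerSeries K)) 1 := by
  intro M
  exact ⟨0, fun N _ => by simpa using Cg.refl M 1⟩

theorem HasIProd.prod {ι : Type*} (s : Finset ι) {f : ι → ℕ → PowerSeries K}
    {P : ι → PowerSeries K} (h : ∀ i ∈ s, HasIProd (f i) (P i)) :
    HasIProd (fun n => ∏ i ∈ s, f i n) (∏ i ∈ s, P i) := by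
  classical
  induction s using Finset.induction_on with
  | empty => simpa using HasIProd.one
  | insert i s hi ih =>
    simp only [Finset.prod_insert hi]
    exact (h i (Finset.mem_insert_self _ _)).mul
      (ih fun j hj => h j (Finset.mem_insert_of_mem hj))

theorem HasIProd.pow {f : ℕ → PowerSeries K} {P : PowerSeries K} (h : HasIProd f P) (m : ℕ) :
    HasIProd (fun n => f n ^ m) (P ^ m) := by
  have := HasIProd.prod (Finset.range m) (f := fun _ => f) (P := fun _ => P) (fun _ _ => h)
  simpa using this

theorem HasIProd.map {K' : Type*} [CommRing K'] (φ : K →+* K') {f : ℕ → PowerSeries K}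
    {P : PowerSeries K} (h : HasIProd f P) :
    HasIProd (fun n => PowerSeries.map φ (f n)) (PowerSeries.map φ P) := by
  intro M
  obtain ⟨N1, h1⟩ := h M
  refine ⟨N1, fun N hN => ?_⟩
  rw [← map_prod]
  exact (h1 N hN).map φ

theorem HasIProd.of_succ {f : ℕ → PowerSeries K} {P : PowerSeries K}
    (h : HasIProd (fun n => f (n + 1)) P) : HasIProd f (f 0 * P) := by
  intro M
  obtain ⟨N1, h1⟩ := h M
  refine ⟨N1 + 1, fun N hN => ?_⟩
  obtain ⟨n, rfl⟩ : ∃ n, N = n + 1 := ⟨N - 1, by omega⟩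
  rw [Finset.prod_range_succ', mul_comm]
  exact (Cg.refl _ _).mul (h1 n (by omega))

theorem HasIProd.group {f : ℕ → PowerSeries K} {P : PowerSeries K} (d : ℕ) (hd : 0 < d)
    (h : HasIProd f P) : HasIProd (fun n => ∏ j ∈ Finset.range d, f (d * n + j)) P := by
  intro M
  obtain ⟨N1, h1⟩ := h M
  refine ⟨N1, fun N hN => ?_⟩
  have key : ∀ N, ∏ n ∈ Finset.range N, ∏ j ∈ Finset.range d, f (d * n + j)
      = ∏ i ∈ Finset.range (d * N), f i := by
    intro N
    induction N with
    | zero => simp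
    | succ N ih => rw [Finset.prod_range_succ, ih, Nat.mul_succ, Finset.prod_range_add]
  rw [key]
  exact h1 _ (le_trans hN (Nat.le_mul_of_pos_left N hd))

/-- Existence of an infinite product. -/
theorem exists_hasIProd (f : ℕ → PowerSeries K) (hf : ∀ i, Cg (i + 1) (f i) 1) :
    ∃ P, HasIProd f P := by
  have key : ∀ M N, M ≤ N → Cg M (∏ i ∈ Finset.range N, f i) (∏ i ∈ Finset.range M, f i) := by
    intro M N hMN
    induction N, hMN using Nat.le_induction with
    | base => exact Cg.refl _ _
    | succ N hN ih =>
      rw [Finset.prod_range_succ]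
      simpa using ih.mul ((hf N).mono (by omega))
  refine ⟨PowerSeries.mk fun n => coeff n (∏ i ∈ Finset.range (n + 1), f i), fun M => ⟨M, ?_⟩⟩
  intro N hN
  rw [cg_iff]
  intro n hn
  rw [coeff_mk]
  exact (key (n + 1) N (by omega)).coeff_eq (Nat.lt_succ_self n)

theorem HasIProd.constantCoeff_eq {f : ℕ → PowerSeries K} {P : PowerSeries K} (h : HasIProd f P)
    (hf : ∀ i, constantCoeff (f i) = 1) : constantCoeff P = 1 := by
  obtain ⟨N, h1⟩ := h 1
  have := (h1 N le_rfl).coeff_eq (n := 0) (by omega)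
  rw [coeff_zero_eq_constantCoeff_apply, coeff_zero_eq_constantCoeff_apply, map_prod] at this
  rw [← this]
  exact Finset.prod_eq_one fun i _ => hf i

end Cong

/-! ### The Jacobi triple product -/

section JTP

variable {K : Type*} [CommRing K]

/-- The finite product `(q; q)_m`. -/
def poch (q : PowerSeries K) (m : ℕ) : PowerSeries K := ∏ i ∈ Finset.range m, (1 - q ^ (i + 1))

theorem poch_succ (q : PowerSeries K) (m : ℕ) :
    poch q (m + 1) = poch q m * (1 - q ^ (m + 1)) := Finset.prod_range_succ _ _

theorem isUnit_poch (q : PowerSeries K) (hq : X ∣ q) (m : ℕ) : IsUnit (poch q m) := by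
  rw [PowerSeries.isUnit_iff_constantCoeff]
  have h0 : constantCoeff q = 0 := X_dvd_iff.1 hq
  simp [poch, map_prod, h0]

/-- Gaussian binomials `[a + b choose a]`. -/
def gb (q : PowerSeries K) (a b : ℕ) : PowerSeries K :=
  poch q (a + b) * Ring.inverse (poch q a) * Ring.inverse (poch q b)

theorem gb_mul (q : PowerSeries K) (hq : X ∣ q) (a b : ℕ) :
    gb q a b * poch q a * poch q b = poch q (a + b) := by
  have ha := Ring.inverse_mul_cancel _ (isUnit_poch q hq a)
  have hb := Ring.inverse_mul_cancel _ (isUnit_poch q hq b)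
  unfold gb
  linear_combination (poch q (a + b) * (Ring.inverse (poch q b) * poch q b)) * ha
    + poch q (a + b) * hb

theorem gb_comm (q : PowerSeries K) (a b : ℕ) : gb q a b = gb q b a := by
  unfold gb; rw [add_comm a b]; ring

theorem gb_zero_left (q : PowerSeries K) (hq : X ∣ q) (b : ℕ) : gb q 0 b = 1 := by
  have h := gb_mul q hq 0 b
  have h0 : poch q 0 = 1 := by simp [poch]
  rw [h0, mul_one, zero_add] at h
  exact (isUnit_poch q hq b).mul_right_cancel (by rw [h, one_mul])

theorem gb_zero_right (q : PowerSeries K) (hq : X ∣ q) (b : ℕ) : gb q b 0 = 1 := by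
  rw [gb_comm, gb_zero_left q hq]

theorem gb_pascal (q : PowerSeries K) (hq : X ∣ q) (a b : ℕ) :
    gb q (a + 1) (b + 1) = gb q a (b + 1) + q ^ (a + 1) * gb q (a + 1) b := by
  have h1 := gb_mul q hq (a + 1) (b + 1)
  have h2 := gb_mul q hq a (b + 1)
  have h3 := gb_mul q hq (a + 1) b
  apply (isUnit_poch q hq (a + 1)).mul_right_cancel
  apply (isUnit_poch q hq (b + 1)).mul_right_cancel
  rw [h1]
  have e1 : a + 1 + (b + 1) = (a + b + 1) + 1 := by ring
  have e2 : a + (b + 1) = a + b + 1 := by ring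
  have e3 : a + 1 + b = a + b + 1 := by ring
  rw [e2] at h2
  rw [e3] at h3
  rw [e1, poch_succ q (a + b + 1)]
  have h4 := poch_succ q a
  have h5 := poch_succ q b
  linear_combination (-(1 - q ^ (a + 1))) * h2 - (q ^ (a + 1) * (1 - q ^ (b + 1))) * h3
    - gb q a (b + 1) * poch q (b + 1) * h4 - q ^ (a + 1) * gb q (a + 1) b * poch q (a + 1) * h5

theorem gb_pascal' (q : PowerSeries K) (hq : X ∣ q) (a b : ℕ) :
    gb q (a + 1) (b + 1) = gb q (a + 1) b + q ^ (b + 1) * gb q a (b + 1) := by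
  rw [gb_comm, gb_pascal q hq b a, gb_comm q b, gb_comm q (b + 1) a]

/-- The general term of Ramanujan's theta function. -/
def rth (α β : PowerSeries K) (k : ℤ) : PowerSeries K :=
  α ^ (k * (k + 1) / 2).toNat * β ^ (k * (k - 1) / 2).toNat

theorem tri_nonneg (k : ℤ) : 0 ≤ k * (k + 1) / 2 := by
  apply Int.ediv_nonneg _ (by norm_num)
  rcases le_or_gt 0 k with h | h
  · positivity
  · nlinarith

theorem tri_nonneg' (k : ℤ) : 0 ≤ k * (k - 1) / 2 := by
  have := tri_nonneg (k - 1)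
  have e : (k - 1) * (k - 1 + 1) = k * (k - 1) := by ring
  rwa [e] at this

theorem tri_two (k : ℤ) : 2 * (k * (k + 1) / 2) = k * (k + 1) :=
  Int.mul_ediv_cancel' (Int.even_mul_succ_self k).two_dvd

theorem tri_two' (k : ℤ) : 2 * (k * (k - 1) / 2) = k * (k - 1) := by
  have := tri_two (k - 1)
  have e : (k - 1) * (k - 1 + 1) = k * (k - 1) := by ring
  rwa [e] at this

theorem rth_up (α β : PowerSeries K) (N a b : ℕ) (hab : a + b = 2 * N) :
    α * (α * β) ^ N * rth α β ((a : ℤ) - N) = (α * β) ^ b * rth α β ((a : ℤ) + 1 - N) := by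
  unfold rth
  set k : ℤ := (a : ℤ) - N with hk
  have hk1 : (a : ℤ) + 1 - N = k + 1 := by rw [hk]; ring
  rw [hk1]
  have h1 := tri_two k
  have h2 := tri_two' k
  have h3 := tri_two (k + 1)
  have h4 := tri_two' (k + 1)
  have p1 := tri_nonneg k
  have p2 := tri_nonneg' k
  have p3 := tri_nonneg (k + 1)
  have p4 := tri_nonneg' (k + 1)
  have e1 : 1 + N + (k * (k + 1) / 2).toNat = b + ((k + 1) * (k + 1 + 1) / 2).toNat := by
    zify
    rw [Int.toNat_of_nonneg p1, Int.toNat_of_nonneg p3]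
    have : (b : ℤ) = N - k := by omega
    nlinarith
  have e2 : N + (k * (k - 1) / 2).toNat = b + ((k + 1) * (k + 1 - 1) / 2).toNat := by
    zify
    rw [Int.toNat_of_nonneg p2, Int.toNat_of_nonneg p4]
    have : (b : ℤ) = N - k := by omega
    nlinarith
  calc _ = α ^ (1 + N + (k * (k + 1) / 2).toNat) * β ^ (N + (k * (k - 1) / 2).toNat) := by ring
    _ = _ := by rw [e1, e2]; ring

theorem rth_down (α β : PowerSeries K) (N a b : ℕ) (hab : a + b = 2 * N + 1) :
    β * (α * β) ^ N * rth α β ((a : ℤ) - N) = (α * β) ^ a * rth α β ((a : ℤ) - (N + 1)) := by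
  unfold rth
  set k : ℤ := (a : ℤ) - N with hk
  have hk1 : (a : ℤ) - (N + 1) = k - 1 := by rw [hk]; ring
  rw [hk1]
  have h1 := tri_two k
  have h2 := tri_two' k
  have h3 := tri_two (k - 1)
  have h4 := tri_two' (k - 1)
  have p1 := tri_nonneg k
  have p2 := tri_nonneg' k
  have p3 := tri_nonneg (k - 1)
  have p4 := tri_nonneg' (k - 1)
  have e1 : N + (k * (k + 1) / 2).toNat = a + ((k - 1) * (k - 1 + 1) / 2).toNat := by
    zify
    rw [Int.toNat_of_nonneg p1, Int.toNat_of_nonneg p3]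
    have : (a : ℤ) = N + k := by omega
    nlinarith
  have e2 : 1 + N + (k * (k - 1) / 2).toNat = a + ((k - 1) * (k - 1 - 1) / 2).toNat := by
    zify
    rw [Int.toNat_of_nonneg p2, Int.toNat_of_nonneg p4]
    have : (a : ℤ) = N + k := by omega
    nlinarith
  calc _ = α ^ (N + (k * (k + 1) / 2).toNat) * β ^ (1 + N + (k * (k - 1) / 2).toNat) := by ring
    _ = _ := by rw [e1, e2]; ring

theorem sum_antidiag_step (q : PowerSeries K) (hq : X ∣ q) (n : ℕ) (g : ℕ → PowerSeries K) :
    ∑ p ∈ Finset.HasAntidiagonal.antidiagonal n, gb q p.1 p.2 * (g p.1 + q ^ p.2 * g (p.1 + 1))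
      = ∑ p ∈ Finset.HasAntidiagonal.antidiagonal (n + 1), gb q p.1 p.2 * g p.1 := by
  simp only [mul_add, Finset.sum_add_distrib]
  cases n with
  | zero => simp [Finset.Nat.antidiagonal_succ, gb_zero_left q hq, gb_zero_right q hq]
  | succ n =>
    have e0 : ∑ p ∈ Finset.HasAntidiagonal.antidiagonal (n + 1 + 1), gb q p.1 p.2 * g p.1
        = g 0 + (g (n + 1 + 1) + ∑ p ∈ Finset.HasAntidiagonal.antidiagonal n,
            gb q (p.1 + 1) (p.2 + 1) * g (p.1 + 1)) := by
      rw [Finset.Nat.sum_antidiagonal_succ (n := n + 1),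
        Finset.Nat.sum_antidiagonal_succ' (n := n)]
      simp [gb_zero_left q hq, gb_zero_right q hq]
    have e1 : ∑ p ∈ Finset.HasAntidiagonal.antidiagonal (n + 1), gb q p.1 p.2 * g p.1
        = g 0 + ∑ p ∈ Finset.HasAntidiagonal.antidiagonal n,
            gb q (p.1 + 1) p.2 * g (p.1 + 1) := by
      rw [Finset.Nat.sum_antidiagonal_succ (n := n)]
      simp [gb_zero_left q hq]
    have e2 : ∑ p ∈ Finset.HasAntidiagonal.antidiagonal (n + 1),
          gb q p.1 p.2 * (q ^ p.2 * g (p.1 + 1))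
        = g (n + 1 + 1) + ∑ p ∈ Finset.HasAntidiagonal.antidiagonal n,
            gb q p.1 (p.2 + 1) * (q ^ (p.2 + 1) * g (p.1 + 1)) := by
      rw [Finset.Nat.sum_antidiagonal_succ' (n := n)]
      simp [gb_zero_right q hq]
    have e3 : ∑ p ∈ Finset.HasAntidiagonal.antidiagonal n,
            gb q (p.1 + 1) (p.2 + 1) * g (p.1 + 1)
        = ∑ p ∈ Finset.HasAntidiagonal.antidiagonal n, gb q (p.1 + 1) p.2 * g (p.1 + 1)
          + ∑ p ∈ Finset.HasAntidiagonal.antidiagonal n,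
            gb q p.1 (p.2 + 1) * (q ^ (p.2 + 1) * g (p.1 + 1)) := by
      rw [← Finset.sum_add_distrib]
      refine Finset.sum_congr rfl fun p _ => ?_
      rw [gb_pascal' q hq]; ring
    rw [e0, e1, e2, e3]
    ring

theorem finite_jtp (α β : PowerSeries K) (hq : X ∣ α * β) (N : ℕ) :
    ∏ n ∈ Finset.range N, ((1 + α * (α * β) ^ n) * (1 + β * (α * β) ^ n))
      = ∑ p ∈ Finset.HasAntidiagonal.antidiagonal (2 * N), gb (α * β) p.1 p.2 * rth α β ((p.1 : ℤ) - N) := by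
  induction N with
  | zero => simp [gb_zero_left _ hq, rth]
  | succ N ih =>
    rw [Finset.prod_range_succ, ih]
    have s1 : (∑ p ∈ Finset.HasAntidiagonal.antidiagonal (2 * N), gb (α * β) p.1 p.2 * rth α β ((p.1 : ℤ) - N))
        * (1 + α * (α * β) ^ N)
        = ∑ p ∈ Finset.HasAntidiagonal.antidiagonal (2 * N + 1), gb (α * β) p.1 p.2 * rth α β ((p.1 : ℤ) - N) := by
      rw [← sum_antidiag_step _ hq _ (fun a => rth α β ((a : ℤ) - N)), Finset.sum_mul]
      refine Finset.sum_congr rfl fun p hp => ?_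
      have h := rth_up α β N p.1 p.2 (Finset.HasAntidiagonal.mem_antidiagonal.1 hp)
      push_cast
      linear_combination (gb (α * β) p.1 p.2) * h
    have s2 : (∑ p ∈ Finset.HasAntidiagonal.antidiagonal (2 * N + 1),
          gb (α * β) p.1 p.2 * rth α β ((p.1 : ℤ) - N)) * (1 + β * (α * β) ^ N)
        = ∑ p ∈ Finset.HasAntidiagonal.antidiagonal (2 * N + 1 + 1),
          gb (α * β) p.1 p.2 * rth α β ((p.1 : ℤ) - (N + 1)) := by
      have hsw : ∀ n (F : ℕ → ℕ → PowerSeries K), ∑ p ∈ Finset.HasAntidiagonal.antidiagonal n, F p.1 p.2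
          = ∑ p ∈ Finset.HasAntidiagonal.antidiagonal n, F p.2 p.1 := fun n F =>
        (Finset.Nat.sum_antidiagonal_swap (n := n) (f := fun p => F p.1 p.2)).symm
      have st := sum_antidiag_step (α * β) hq (2 * N + 1)
        (fun b => rth α β (2 * N + 2 - (b : ℤ) - (N + 1)))
      have l1 : ∑ p ∈ Finset.HasAntidiagonal.antidiagonal (2 * N + 1 + 1),
          gb (α * β) p.1 p.2 * rth α β ((p.1 : ℤ) - (N + 1)) =
          ∑ p ∈ Finset.HasAntidiagonal.antidiagonal (2 * N + 1 + 1),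
            gb (α * β) p.1 p.2 * rth α β (2 * N + 2 - (p.1 : ℤ) - (N + 1)) := by
        rw [hsw _ (fun a b => gb (α * β) a b * rth α β ((a : ℤ) - (N + 1)))]
        refine Finset.sum_congr rfl fun p hp => ?_
        have := Finset.HasAntidiagonal.mem_antidiagonal.1 hp
        rw [gb_comm]
        congr 2
        omega
      rw [l1, ← st, Finset.sum_mul,
        hsw _ (fun a b => gb (α * β) a b * rth α β ((a : ℤ) - N) * (1 + β * (α * β) ^ N))]
      refine Finset.sum_congr rfl fun p hp => ?_
      have hp' := Finset.HasAntidiagonal.mem_antidiagonal.1 hp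
      have h := rth_down α β N p.2 p.1 (by omega)
      have e1 : (2 * N + 2 - (p.1 : ℤ) - (N + 1)) = (p.2 : ℤ) - N := by omega
      have e2 : (2 * N + 2 - ((p.1 + 1 : ℕ) : ℤ) - (N + 1)) = (p.2 : ℤ) - (N + 1) := by
        push_cast; omega
      rw [e1, e2, gb_comm _ p.2]
      linear_combination (gb (α * β) p.1 p.2) * h
    rw [← mul_assoc, s1, s2]
    push_cast
    rfl

theorem cg_poch (q : PowerSeries K) (hq : X ∣ q) (M N : ℕ) (h : M ≤ N) :
    Cg M (poch q N) (poch q M) := by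
  induction N, h using Nat.le_induction with
  | base => exact Cg.refl _ _
  | succ N hN ih =>
    rw [poch_succ]
    have : Cg M (1 - q ^ (N + 1)) 1 := by
      unfold Cg
      rw [sub_sub_cancel_left, dvd_neg]
      exact (pow_dvd_pow_of_dvd hq M).trans (pow_dvd_pow q (by omega))
    simpa using ih.mul this

theorem cg_gb (q : PowerSeries K) (hq : X ∣ q) (M N a b : ℕ) (hN : M ≤ N) (ha : M ≤ a)
    (hb : M ≤ b) : Cg M (gb q a b * poch q N) 1 := by
  have h1 := gb_mul q hq a b
  have hu := isUnit_poch q hq M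
  have c1 : Cg M (gb q a b * poch q M * poch q M) (poch q M) := by
    refine Cg.trans ?_ ((Cg.of_eq h1).trans (cg_poch q hq M _ (by omega)))
    exact ((Cg.refl _ _).mul (cg_poch q hq M a ha).symm).mul (cg_poch q hq M b hb).symm
  have c2 := c1.mul (Cg.refl M (Ring.inverse (poch q M)))
  rw [mul_assoc, Ring.mul_inverse_cancel _ hu, mul_one] at c2
  exact ((Cg.refl _ _).mul (cg_poch q hq M N hN)).trans c2

theorem rth_dvd (α β : PowerSeries K) (hq : X ∣ α * β) (M : ℕ) (k : ℤ)
    (hk : (M : ℤ) + 2 ≤ |k|) : X ^ M ∣ rth α β k := by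
  have hd : (α * β) ^ M ∣ rth α β k := by
    rw [mul_pow]
    have h1 := tri_two k
    have h2 := tri_two' k
    have p1 := tri_nonneg k
    have p2 := tri_nonneg' k
    refine mul_dvd_mul (pow_dvd_pow _ ?_) (pow_dvd_pow _ ?_)
    · zify
      rw [Int.toNat_of_nonneg p1]
      rcases abs_cases k with ⟨h, _⟩ | ⟨h, _⟩ <;> nlinarith
    · zify
      rw [Int.toNat_of_nonneg p2]
      rcases abs_cases k with ⟨h, _⟩ | ⟨h, _⟩ <;> nlinarith
  exact (pow_dvd_pow_of_dvd hq M).trans hd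

theorem jtp (α β S : PowerSeries K) (hq : X ∣ α * β) (hS : HasISum (rth α β) S) :
    HasIProd (fun n => (1 + α * (α * β) ^ n) * (1 + β * (α * β) ^ n) * (1 - (α * β) ^ (n + 1)))
      S := by
  intro M
  obtain ⟨L0, hL⟩ := hS M
  refine ⟨max L0 (2 * M + 2), fun N hN => ?_⟩
  have hN1 : L0 ≤ N := le_trans (le_max_left _ _) hN
  have hN2 : 2 * M + 2 ≤ N := le_trans (le_max_right _ _) hN
  refine Cg.trans ?_ (hL N hN1)
  rw [Finset.prod_mul_distrib, finite_jtp α β hq]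
  change Cg M (_ * poch (α * β) N) _
  have e : ∑ k ∈ Finset.Icc (-(N : ℤ)) N, rth α β k
      = ∑ p ∈ Finset.HasAntidiagonal.antidiagonal (2 * N), rth α β ((p.1 : ℤ) - N) := by
    symm
    refine Finset.sum_bij (fun p _ => (p.1 : ℤ) - N) ?_ ?_ ?_ ?_
    · intro p hp
      have := Finset.HasAntidiagonal.mem_antidiagonal.1 hp
      rw [Finset.mem_Icc]; omega
    · intro p hp p' hp' h
      have := Finset.HasAntidiagonal.mem_antidiagonal.1 hp
      have := Finset.HasAntidiagonal.mem_antidiagonal.1 hp'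
      ext <;> omega
    · intro k hk
      rw [Finset.mem_Icc] at hk
      refine ⟨((k + N).toNat, (N - k).toNat), ?_, ?_⟩
      · rw [Finset.HasAntidiagonal.mem_antidiagonal]; simp only; omega
      · simp only; omega
    · intro p hp; rfl
  rw [e, Finset.sum_mul]
  refine Cg.sum _ fun p hp => ?_
  have hp' := Finset.HasAntidiagonal.mem_antidiagonal.1 hp
  by_cases hk : (M : ℤ) + 2 ≤ |(p.1 : ℤ) - N|
  · have := rth_dvd α β hq M _ hk
    unfold Cg
    exact dvd_sub (dvd_mul_of_dvd_left (dvd_mul_of_dvd_right this _) _) this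
  · have hk' := abs_lt.1 (not_le.1 hk)
    have := (cg_gb (α * β) hq M N p.1 p.2 (by omega) (by omega) (by omega)).mul
      (Cg.refl M (rth α β ((p.1 : ℤ) - N)))
    rw [one_mul] at this
    convert this using 1
    ring

end JTP

end NOC




namespace NOC

/-! ### Theta sums -/

section Theta

variable {K : Type*} [CommRing K]

/-- The theta sum `∑ₖ M k · X ^ e k`. -/
def thetaS (e : ℤ → ℕ) (M : ℤ → K) : PowerSeries K :=
  PowerSeries.mk fun n => ∑ k ∈ Finset.Icc (-((n : ℤ) + 1)) (n + 1), if e k = n then M k else 0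

/-- Growth condition for exponents. -/
def Grow (e : ℤ → ℕ) : Prop := ∀ k : ℤ, |k| ≤ (e k : ℤ) + 1

theorem coeff_thetaS {e : ℤ → ℕ} (he : Grow e) (M : ℤ → K) (n L : ℕ) (hL : n + 1 ≤ L) :
    coeff n (thetaS e M) = ∑ k ∈ Finset.Icc (-(L : ℤ)) L, if e k = n then M k else 0 := by
  rw [thetaS, coeff_mk]
  apply Finset.sum_subset
  · apply Finset.Icc_subset_Icc <;> omega
  · intro k _ hk
    rw [if_neg]
    intro h
    apply hk
    have := abs_le.1 (he k)
    rw [Finset.mem_Icc]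
    omega

theorem cg_thetaS {e : ℤ → ℕ} (he : Grow e) (M : ℤ → K) (N L : ℕ) (hL : N ≤ L) :
    Cg N (thetaS e M) (∑ k ∈ Finset.Icc (-(L : ℤ)) L, PowerSeries.monomial (e k) (M k)) := by
  rw [cg_iff]
  intro n hn
  rw [coeff_thetaS he M n L (by omega), map_sum]
  refine Finset.sum_congr rfl fun k _ => ?_
  rw [coeff_monomial]
  simp [eq_comm]

theorem hasISum_thetaS {e : ℤ → ℕ} (he : Grow e) (M : ℤ → K) :
    HasISum (fun k => PowerSeries.monomial (e k) (M k)) (thetaS e M) := fun N =>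
  ⟨N, fun L hL => (cg_thetaS he M N L hL).symm⟩

theorem map_thetaS {K' : Type*} [CommRing K'] (φ : K →+* K') (e : ℤ → ℕ) (M : ℤ → K) :
    PowerSeries.map φ (thetaS e M) = thetaS e (fun k => φ (M k)) := by
  ext n
  simp [thetaS, apply_ite φ]

theorem thetaS_mul_const (e : ℤ → ℕ) (M : ℤ → K) (c : K) :
    thetaS e (fun k => M k * c) = thetaS e M * PowerSeries.C c := by
  ext n
  simp [thetaS, coeff_mul_C, Finset.sum_mul]

theorem coeff_thetaS_mul {e e' : ℤ → ℕ} (he : Grow e) (he' : Grow e') (M M' : ℤ → K) (n : ℕ) :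
    coeff n (thetaS e M * thetaS e' M') =
      ∑ᶠ p : ℤ × ℤ, if e p.1 + e' p.2 = n then M p.1 * M' p.2 else 0 := by
  have h := (cg_thetaS he M (n+1) (n+1) le_rfl).mul (cg_thetaS he' M' (n+1) (n+1) le_rfl)
  rw [h.coeff_eq (Nat.lt_succ_self n), Finset.sum_mul_sum, ← Finset.sum_product', map_sum]
  rw [finsum_eq_sum_of_support_subset (s := Finset.Icc (-((n+1 : ℕ) : ℤ)) ((n+1 : ℕ)) ×ˢ
    Finset.Icc (-((n+1 : ℕ) : ℤ)) ((n+1 : ℕ)))]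
  · refine Finset.sum_congr rfl fun p _ => ?_
    rw [monomial_mul_monomial, coeff_monomial]
    simp [eq_comm]
  · intro p hp
    rw [Function.mem_support, ne_eq, ite_eq_right_iff, Classical.not_imp] at hp
    have h1 := abs_le.1 (he p.1)
    have h2 := abs_le.1 (he' p.2)
    simp only [Finset.coe_product, Set.mem_prod, Finset.coe_Icc, Set.mem_Icc]
    omega

theorem support_thetaS_mul {e e' : ℤ → ℕ} (he : Grow e) (he' : Grow e') (M M' : ℤ → K) (n : ℕ) :
    (Function.support (fun p : ℤ × ℤ => if e p.1 + e' p.2 = n then M p.1 * M' p.2 else 0)).Finite := by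
  apply Set.Finite.subset (Finset.finite_toSet (Finset.Icc (-((n+1 : ℕ) : ℤ)) ((n+1 : ℕ)) ×ˢ
    Finset.Icc (-((n+1 : ℕ) : ℤ)) ((n+1 : ℕ))))
  intro p hp
  rw [Function.mem_support, ne_eq, ite_eq_right_iff, Classical.not_imp] at hp
  have h1 := abs_le.1 (he p.1)
  have h2 := abs_le.1 (he' p.2)
  simp only [Finset.coe_product, Set.mem_prod, Finset.coe_Icc, Set.mem_Icc]
  omega

/-- exponents -/
def eA (k : ℤ) : ℕ := (2 * k ^ 2).toNat
def eC (k : ℤ) : ℕ := (2 * k ^ 2 + 2 * k).toNat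
def eG (k : ℤ) : ℕ := (k * (k - 1) / 2).toNat
def eT (k : ℤ) : ℕ := (k * (k - 1)).toNat
def eF (t i : ℕ) (k : ℤ) : ℕ := (2 * t * k ^ 2 + (2 * i + 1) * k).toNat

theorem eA_cast (k : ℤ) : (eA k : ℤ) = 2 * k ^ 2 := Int.toNat_of_nonneg (by positivity)

theorem kk_nonneg (k : ℤ) : 0 ≤ k * (k - 1) := by
  have := tri_two' k
  have := tri_nonneg' k
  omega

theorem eC_cast (k : ℤ) : (eC k : ℤ) = 2 * k ^ 2 + 2 * k := Int.toNat_of_nonneg (by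
  have := kk_nonneg (k + 1); nlinarith)

theorem eT_cast (k : ℤ) : (eT k : ℤ) = k * (k - 1) := Int.toNat_of_nonneg (kk_nonneg k)

theorem eG_cast (k : ℤ) : 2 * (eG k : ℤ) = k * (k - 1) := by
  rw [eG, Int.toNat_of_nonneg (tri_nonneg' k), tri_two' k]

theorem eF_aux (t i : ℕ) (hi : i < t) (k : ℤ) :
    |k| ≤ 2 * t * k ^ 2 + (2 * i + 1) * k := by
  have h1 : (i : ℤ) + 1 ≤ t := by exact_mod_cast hi
  have h0 : (0 : ℤ) ≤ i := by positivity
  rcases abs_cases k with ⟨h, h'⟩ | ⟨h, h'⟩ <;> rw [h]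
  · nlinarith [mul_nonneg h0 h', sq_nonneg k, mul_nonneg (by omega : (0:ℤ) ≤ t) (sq_nonneg k)]
  · have h2 : 0 ≤ (-k - 1) := by omega
    have h3 : (k:ℤ)^2 ≥ -k := by nlinarith
    nlinarith [mul_le_mul_of_nonneg_left h3 (by omega : (0:ℤ) ≤ t),
      mul_nonneg (by omega : (0:ℤ) ≤ t - i - 1) (by omega : 0 ≤ -k)]

theorem eF_cast (t i : ℕ) (hi : i < t) (k : ℤ) :
    (eF t i k : ℤ) = 2 * t * k ^ 2 + (2 * i + 1) * k := Int.toNat_of_nonneg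
  ((abs_nonneg k).trans (eF_aux t i hi k))

theorem grow_eF (t i : ℕ) (hi : i < t) : Grow (eF t i) := fun k => by
  rw [eF_cast t i hi]
  have := eF_aux t i hi k
  omega

theorem grow_eA : Grow eA := fun k => by
  rw [eA_cast]
  rcases abs_cases k with ⟨h, h'⟩ | ⟨h, h'⟩ <;> rw [h] <;> nlinarith [sq_nonneg (k-1), sq_nonneg (k+1)]

theorem grow_eT : Grow eT := fun k => by
  rw [eT_cast]
  rcases abs_cases k with ⟨h, h'⟩ | ⟨h, h'⟩ <;> rw [h] <;> nlinarith [sq_nonneg (k-1), sq_nonneg (k+1)]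

theorem grow_eC : Grow eC := fun k => by
  rw [eC_cast]
  have := kk_nonneg (k + 1)
  have h3 := kk_nonneg (k + 2)
  rcases abs_cases k with ⟨h, h'⟩ | ⟨h, h'⟩ <;> rw [h] <;> nlinarith

theorem grow_eG : Grow eG := fun k => by
  have h0 := eG_cast k
  have := kk_nonneg (k - 1)
  have h3 := kk_nonneg (k + 1)
  rcases abs_cases k with ⟨h, h'⟩ | ⟨h, h'⟩ <;> rw [h] <;> nlinarith

/-- The addition formula. -/
theorem addition_formula (z w : Kˣ) :
    thetaS eA (fun k => ((z ^ (2 * k) : Kˣ) : K)) * thetaS eC (fun k => ((w ^ (2 * k + 1) : Kˣ) : K))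
    - thetaS eA (fun k => ((w ^ (2 * k) : Kˣ) : K)) * thetaS eC (fun k => ((z ^ (2 * k + 1) : Kˣ) : K))
    = PowerSeries.C (w : K) * (thetaS eT (fun k => (((-1) ^ k * (z / w) ^ k : Kˣ) : K)) *
      thetaS eT (fun k => (((-1) ^ k * ((z * w)⁻¹) ^ k : Kˣ) : K))) := by
  ext n
  rw [map_sub, coeff_C_mul, coeff_thetaS_mul grow_eA grow_eC, coeff_thetaS_mul grow_eA grow_eC,
    coeff_thetaS_mul grow_eT grow_eT]
  set f : ℤ × ℤ → K := fun p => if eT p.1 + eT p.2 = n then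
      (((-1) ^ p.1 * (z / w) ^ p.1 : Kˣ) : K) * (((-1) ^ p.2 * ((z * w)⁻¹) ^ p.2 : Kˣ) : K) else 0
    with hf
  have hfin : (Function.support f).Finite := support_thetaS_mul grow_eT grow_eT
    (fun k => (((-1) ^ k * (z / w) ^ k : Kˣ) : K)) (fun k => (((-1) ^ k * ((z * w)⁻¹) ^ k : Kˣ) : K)) n
  set s : Set (ℤ × ℤ) := {p | Even (p.1 - p.2)} with hs
  have e1 := finsum_mem_inter_add_sdiff' (s := Set.univ) (f := f) s (by simpa using hfin)
  rw [finsum_mem_univ] at e1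
  rw [← e1, mul_add, sub_eq_add_neg]
  congr 1
  · have := finsum_mem_eq_of_bijOn (s := Set.univ) (t := Set.univ ∩ s)
      (f := fun p : ℤ × ℤ => (if eA p.1 + eC p.2 = n then ((z ^ (2 * p.1) : Kˣ) : K) *
        ((w ^ (2 * p.2 + 1) : Kˣ) : K) else 0) * ((w⁻¹ : Kˣ) : K)) (g := f)
      (fun p => (p.1 - p.2, - p.2 - p.1)) ?_ ?_
    · rw [← this, finsum_mem_univ, ← finsum_mul', mul_comm, mul_assoc]
      · simp
      · exact support_thetaS_mul grow_eA grow_eC (fun k => ((z ^ (2 * k) : Kˣ) : K))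
          (fun k => ((w ^ (2 * k + 1) : Kˣ) : K)) n
    · refine ⟨?_, ?_, ?_⟩
      · intro p _
        simp only [hs, Set.mem_inter_iff, Set.mem_univ, true_and, Set.mem_ofPred_eq]
        exact ⟨p.1, by ring⟩
      · rintro ⟨a, b⟩ _ ⟨c, d⟩ _ h
        simp only [Prod.mk.injEq] at h ⊢
        omega
      · rintro ⟨a, b⟩ ⟨_, h⟩
        simp only [hs, Set.mem_ofPred_eq] at h
        obtain ⟨r, hr⟩ := h
        exact ⟨(r, r - a), trivial, by simp only [Prod.mk.injEq]; omega⟩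
    · rintro ⟨k, l⟩ _
      have hh : eT (k - l) + eT (- l - k) = eA k + eC l := by
        zify; rw [eT_cast, eT_cast, eA_cast, eC_cast]; ring
      simp only [hf, hh]
      split_ifs
      · rw [← Units.val_mul, ← Units.val_mul, ← Units.val_mul]
        congr 1
        have : (-1 : Kˣ) ^ (k - l) * (-1) ^ (- l - k) = 1 := by
          rw [← zpow_add, show k - l + (-l - k) = 2 * (-l) by ring, zpow_mul]; simp
        calc _ = ((z / w) ^ (k - l)) * ((z * w)⁻¹) ^ (-l - k) := by
                simp only [div_eq_mul_inv, mul_zpow, inv_zpow', ← zpow_neg, mul_inv]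
                have e1 : (z:Kˣ) ^ (2*k) = z ^ (k-l) * z ^ (-(-l-k)) := by
                  rw [← zpow_add]; congr 1; ring
                have e2 : (w:Kˣ) ^ (2*l+1) * w⁻¹ = w ^ (-(k-l)) * w ^ (-(-l-k)) := by
                  rw [← zpow_neg_one, ← zpow_add, ← zpow_add]; congr 1; ring
                rw [mul_assoc, e2, e1]; simp only [mul_assoc, mul_comm, mul_left_comm]
          _ = ((-1 : Kˣ) ^ (k - l) * (-1) ^ (- l - k)) * (((z / w) ^ (k - l)) * ((z * w)⁻¹) ^ (-l - k)) := by
                rw [this, one_mul]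
          _ = _ := by simp only [mul_assoc, mul_comm, mul_left_comm]
      · simp
  · have := finsum_mem_eq_of_bijOn (s := Set.univ) (t := Set.univ \ s)
      (f := fun p : ℤ × ℤ => (if eA p.1 + eC p.2 = n then ((w ^ (2 * p.1) : Kˣ) : K) *
        ((z ^ (2 * p.2 + 1) : Kˣ) : K) else 0) * ((-w⁻¹ : Kˣ) : K)) (g := f)
      (fun p => (p.2 + 1 - p.1, - p.1 - p.2)) ?_ ?_
    · rw [← this, finsum_mem_univ, ← finsum_mul', mul_comm, mul_assoc]
      · simp
      · exact support_thetaS_mul grow_eA grow_eC (fun k => ((w ^ (2 * k) : Kˣ) : K))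
          (fun k => ((z ^ (2 * k + 1) : Kˣ) : K)) n
    · refine ⟨?_, ?_, ?_⟩
      · intro p _
        simp only [hs, Set.mem_sdiff, Set.mem_univ, true_and, Set.mem_ofPred_eq]
        rintro ⟨r, hr⟩; omega
      · rintro ⟨a, b⟩ _ ⟨c, d⟩ _ h
        simp only [Prod.mk.injEq] at h ⊢
        omega
      · rintro ⟨a, b⟩ ⟨_, h⟩
        simp only [hs, Set.mem_ofPred_eq, Int.not_even_iff_odd] at h
        obtain ⟨r, hr⟩ := h
        exact ⟨(-b - r, r), trivial, by simp only [Prod.mk.injEq]; omega⟩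
    · rintro ⟨k, l⟩ _
      have hh : eT (l + 1 - k) + eT (- k - l) = eA k + eC l := by
        zify; rw [eT_cast, eT_cast, eA_cast, eC_cast]; ring
      simp only [hf, hh]
      split_ifs
      · rw [← Units.val_mul, ← Units.val_mul, ← Units.val_mul]
        congr 1
        have : (-1 : Kˣ) ^ (l + 1 - k) * (-1) ^ (- k - l) = -1 := by
          rw [← zpow_add, show l + 1 - k + (- k - l) = 2 * (-k) + 1 by ring, zpow_add, zpow_mul]; simp
        calc _ = - (((z / w) ^ (l + 1 - k)) * ((z * w)⁻¹) ^ (- k - l)) := by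
                simp only [div_eq_mul_inv, mul_zpow, inv_zpow', ← zpow_neg, mul_inv]
                have e1 : (z:Kˣ) ^ (2*l+1) = z ^ (l+1-k) * z ^ (-(-k-l)) := by
                  rw [← zpow_add]; congr 1; ring
                have e2 : (w:Kˣ) ^ (2*k) * w⁻¹ = w ^ (-(l+1-k)) * w ^ (-(-k-l)) := by
                  rw [← zpow_neg_one, ← zpow_add, ← zpow_add]; congr 1; ring
                rw [mul_right_comm, mul_neg, e2, e1, neg_mul]
                simp only [mul_assoc, mul_comm, mul_left_comm]
          _ = ((-1 : Kˣ) ^ (l + 1 - k) * (-1) ^ (- k - l)) * (((z / w) ^ (l + 1 - k)) * ((z * w)⁻¹) ^ (-k - l)) := by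
                rw [this, neg_one_mul]
          _ = _ := by simp only [mul_assoc, mul_comm, mul_left_comm]
      · simp

end Theta

end NOC




namespace NOC

/-! ### Quasi-periodic series with Laurent polynomial coefficients -/

section QPeriodic

open LaurentPolynomial (T)

variable {R : Type*} [CommRing R]

theorem lcoeff_mul (a b : LaurentPolynomial R) (m : ℤ) (S : Finset ℤ) (hS : a.coeff.support ⊆ S) :
    (a * b).coeff m = ∑ l ∈ S, a.coeff l * b.coeff (m - l) := by
  rw [AddMonoidAlgebra.coeff_mul, Finsupp.sum_of_support_subset _ hS _ (by simp [Finsupp.sum])]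
  refine Finset.sum_congr rfl fun l _ => ?_
  rw [Finsupp.sum]
  have : ∀ x : ℤ, (l + x = m) ↔ (x = m - l) := fun x => by omega
  simp only [this, Finset.sum_ite_eq', Finsupp.mem_support_iff]
  split_ifs with h
  · rfl
  · rw [Finsupp.notMem_support_iff.1 h, mul_zero]

/-- The coefficient of `x ^ n z ^ m`. -/
def cf (H : PowerSeries (LaurentPolynomial R)) (n m : ℤ) : R :=
  if 0 ≤ n then (coeff n.toNat H).coeff m else 0

theorem cf_nat (H : PowerSeries (LaurentPolynomial R)) (n : ℕ) (m : ℤ) :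
    cf H n m = (coeff n H).coeff m := by simp [cf]

theorem cf_neg (H : PowerSeries (LaurentPolynomial R)) {n : ℤ} (m : ℤ) (h : n < 0) :
    cf H n m = 0 := by rw [cf, if_neg (by omega)]

theorem cf_mul (H G : PowerSeries (LaurentPolynomial R)) (n m : ℤ) :
    cf (H * G) n m = ∑ᶠ u : ℤ × ℤ, cf H u.1 u.2 * cf G (n - u.1) (m - u.2) := by
  classical
  rcases lt_or_ge n 0 with hn | hn
  · rw [cf_neg _ _ hn, finsum_eq_zero_of_forall_eq_zero]
    intro u
    rcases lt_or_ge u.1 0 with h | h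
    · rw [cf_neg H _ h, zero_mul]
    · rw [cf_neg G _ (by omega), mul_zero]
  · lift n to ℕ using hn
    set S : Finset ℤ := (Finset.range (n + 1)).biUnion fun p => (coeff p H).coeff.support with hS
    rw [finsum_eq_sum_of_support_subset (s := (Finset.range (n+1)).map Nat.castEmbedding ×ˢ S)]
    · rw [Finset.sum_product, Finset.sum_map, cf_nat, PowerSeries.coeff_mul,
        Finset.Nat.sum_antidiagonal_eq_sum_range_succ (fun p q => coeff p H * coeff q G),
        AddMonoidAlgebra.coeff_sum, Finsupp.finsetSum_apply]
      refine Finset.sum_congr rfl fun p hp => ?_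
      rw [lcoeff_mul _ _ _ S]
      · refine Finset.sum_congr rfl fun l _ => ?_
        rw [Finset.mem_range] at hp
        simp only [Nat.castEmbedding_apply]
        rw [cf_nat, show (n : ℤ) - p = ((n - p : ℕ) : ℤ) by omega, cf_nat]
      · exact Finset.subset_biUnion_of_mem (fun p => (coeff p H).coeff.support) hp
    · rintro ⟨a, b⟩ hu
      simp only [Function.mem_support] at hu
      have h1 := left_ne_zero_of_mul hu
      have h2 := right_ne_zero_of_mul hu
      have ha : 0 ≤ a := by
        by_contra h; exact h1 (cf_neg _ _ (by omega))
      have ha' : a ≤ n := by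
        by_contra h; exact h2 (cf_neg _ _ (by omega))
      lift a to ℕ using ha
      rw [cf_nat] at h1
      simp only [Finset.coe_product, Set.mem_prod, Finset.mem_coe]
      have h4 : a ∈ Finset.range (n + 1) := by rw [Finset.mem_range]; omega
      refine ⟨?_, ?_⟩
      · rw [Finset.mem_map]
        exact ⟨a, h4, rfl⟩
      · rw [hS, Finset.mem_biUnion]
        exact ⟨a, h4, by simpa using h1⟩

theorem ext_cf {H G : PowerSeries (LaurentPolynomial R)} (h : ∀ (n : ℕ) (m : ℤ), cf H n m = cf G n m) : H = G := by
  refine PowerSeries.ext fun n => LaurentPolynomial.ext fun m => ?_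
  rw [← cf_nat, ← cf_nat, h]

def QP (d κ : ℤ) (H : PowerSeries (LaurentPolynomial R)) : Prop :=
  ∀ n m, cf H (n + 2 * m + κ) (m + d) = cf H n m

def Sy (c : ℤ) (H : PowerSeries (LaurentPolynomial R)) : Prop :=
  ∀ n m, cf H n (c - m) = cf H n m

theorem QP.mul {d κ d' κ' : ℤ} {H G : PowerSeries (LaurentPolynomial R)} (h : QP d κ H) (h' : QP d' κ' G) :
    QP (d + d') (κ + κ') (H * G) := by
  intro n m
  rw [cf_mul, cf_mul]
  let e : ℤ × ℤ ≃ ℤ × ℤ :=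
    { toFun := fun v => (v.1 + 2 * v.2 + κ, v.2 + d)
      invFun := fun v => (v.1 - 2 * (v.2 - d) - κ, v.2 - d)
      left_inv := fun v => by ext <;> simp only <;> ring
      right_inv := fun v => by ext <;> simp only <;> ring }
  rw [← finsum_comp_equiv e]
  refine finsum_congr fun v => ?_
  simp only [e, Equiv.coe_fn_mk]
  rw [h, show n + 2 * m + (κ + κ') - (v.1 + 2 * v.2 + κ) = (n - v.1) + 2 * (m - v.2) + κ' by ring,
    show m + (d + d') - (v.2 + d) = (m - v.2) + d' by ring, h']

theorem Sy.mul {c c' : ℤ} {H G : PowerSeries (LaurentPolynomial R)} (h : Sy c H) (h' : Sy c' G) :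
    Sy (c + c') (H * G) := by
  intro n m
  rw [cf_mul, cf_mul]
  let e : ℤ × ℤ ≃ ℤ × ℤ :=
    { toFun := fun v => (v.1, c - v.2)
      invFun := fun v => (v.1, c - v.2)
      left_inv := fun v => by ext <;> simp only <;> ring
      right_inv := fun v => by ext <;> simp only <;> ring }
  rw [← finsum_comp_equiv e]
  refine finsum_congr fun v => ?_
  simp only [e, Equiv.coe_fn_mk]
  rw [h, show c + c' - m - (c - v.2) = c' - (m - v.2) by ring, h']

theorem cf_one (n m : ℤ) : cf (1 : PowerSeries (LaurentPolynomial R)) n m = if n = 0 ∧ m = 0 then 1 else 0 := by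
  rcases lt_or_ge n 0 with hn | hn
  · rw [cf_neg _ _ hn, if_neg (by omega)]
  · lift n to ℕ using hn
    rw [cf_nat, PowerSeries.coeff_one]
    by_cases h : n = 0
    · simp [h, ← LaurentPolynomial.T_zero, eq_comm]
    · simp [h]

theorem QP.one : QP 0 0 (1 : PowerSeries (LaurentPolynomial R)) := by
  intro n m
  rw [cf_one, cf_one]
  congr 1
  simp only [eq_iff_iff]
  omega

theorem Sy.one : Sy 0 (1 : PowerSeries (LaurentPolynomial R)) := by
  intro n m
  rw [cf_one, cf_one]
  congr 1
  simp

theorem QP.pow {d κ : ℤ} {H : PowerSeries (LaurentPolynomial R)} (h : QP d κ H) (j : ℕ) :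
    QP (j * d) (j * κ) (H ^ j) := by
  induction j with
  | zero => simpa using QP.one
  | succ j ih =>
    rw [pow_succ]
    have := ih.mul h
    convert this using 1 <;> push_cast <;> ring

theorem Sy.pow {H : PowerSeries (LaurentPolynomial R)} (h : Sy 0 H) (j : ℕ) :
    Sy 0 (H ^ j) := by
  induction j with
  | zero => simpa using Sy.one
  | succ j ih =>
    rw [pow_succ]
    simpa using ih.mul h

theorem cf_thetaS {e : ℤ → ℕ} (he : Grow e) {r : ℤ → ℤ} (hr : Function.Injective r) (n m : ℤ) :
    cf (thetaS e (fun k => (T (r k) : LaurentPolynomial R))) n m =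
      open Classical in if ∃ k, r k = m ∧ (e k : ℤ) = n then 1 else 0 := by
  classical
  rcases lt_or_ge n 0 with hn | hn
  · rw [cf_neg _ _ hn, if_neg]
    rintro ⟨k, _, h⟩
    omega
  · lift n to ℕ using hn
    rw [cf_nat, coeff_thetaS he _ n (n + 1) le_rfl, AddMonoidAlgebra.coeff_sum, Finsupp.finsetSum_apply]
    split_ifs with h
    · obtain ⟨k, h1, h2⟩ := h
      rw [Finset.sum_eq_single k]
      · rw [if_pos (by exact_mod_cast h2)]; simp [h1]
      · intro l _ hl
        split_ifs
        · simp only [LaurentPolynomial.T_apply]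
          rw [if_neg]
          intro h; exact hl (hr (h.trans h1.symm))
        · simp
      · intro h3; exfalso; apply h3
        have := abs_le.1 (he k)
        rw [Finset.mem_Icc]; omega
    · apply Finset.sum_eq_zero
      intro k _
      split_ifs with h1
      · simp only [LaurentPolynomial.T_apply]
        rw [if_neg]
        intro h2; exact h ⟨k, h2, by exact_mod_cast h1⟩
      · simp

theorem QP_thetaS {e : ℤ → ℕ} (he : Grow e) {r : ℤ → ℤ} (hr : Function.Injective r) (d κ j : ℤ)
    (h1 : ∀ k, r (k + j) = r k + d) (h2 : ∀ k, (e (k + j) : ℤ) = e k + 2 * r k + κ) :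
    QP d κ (thetaS e (fun k => (T (r k) : LaurentPolynomial R))) := by
  intro n m
  rw [cf_thetaS he hr, cf_thetaS he hr]
  congr 1
  simp only [eq_iff_iff]
  constructor
  · rintro ⟨k, h3, h4⟩
    refine ⟨k - j, ?_, ?_⟩
    · have := h1 (k - j); simp only [sub_add_cancel] at this; omega
    · have h6 := h1 (k - j)
      have := h2 (k - j); simp only [sub_add_cancel] at this h6; omega
  · rintro ⟨k, h3, h4⟩
    refine ⟨k + j, ?_, ?_⟩
    · rw [h1, h3]
    · rw [h2, h4, h3]

theorem Sy_thetaS {e : ℤ → ℕ} (he : Grow e) {r : ℤ → ℤ} (hr : Function.Injective r) (c j : ℤ)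
    (h1 : ∀ k, r (j - k) = c - r k) (h2 : ∀ k, e (j - k) = e k) :
    Sy c (thetaS e (fun k => (T (r k) : LaurentPolynomial R))) := by
  intro n m
  rw [cf_thetaS he hr, cf_thetaS he hr]
  congr 1
  simp only [eq_iff_iff]
  constructor
  · rintro ⟨k, h3, h4⟩
    exact ⟨j - k, by rw [h1, h3]; ring, by rw [h2, h4]⟩
  · rintro ⟨k, h3, h4⟩
    exact ⟨j - k, by rw [h1, h3], by rw [h2, h4]⟩

variable (R)

def Lg : PowerSeries (LaurentPolynomial R) := thetaS eG (fun k => T k)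
def LA : PowerSeries (LaurentPolynomial R) := thetaS eA (fun k => T (2 * k))
def LC : PowerSeries (LaurentPolynomial R) := thetaS eC (fun k => T (2 * k + 1))
def Lf (t i : ℕ) : PowerSeries (LaurentPolynomial R) :=
  thetaS (eF t i) (fun k => T (i + 1 + 2 * t * k) + T (- i - 2 * t * k))
def Lh (t j : ℕ) : PowerSeries (LaurentPolynomial R) :=
  Lg R * (LA R ^ j * LC R ^ (t - 1 - j))

theorem QP_Lg : QP 2 1 (Lg R) := by
  refine QP_thetaS grow_eG (r := fun k => k) (fun a b h => h) 2 1 2 (fun k => rfl) (fun k => ?_)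
  have := eG_cast (k+2)
  have := eG_cast k
  linarith

theorem QP_LA : QP 2 2 (LA R) := by
  refine QP_thetaS grow_eA (r := fun k => 2 * k) (fun a b h => by simpa using h) 2 2 1
    (fun k => by ring) (fun k => ?_)
  rw [eA_cast, eA_cast]; ring

theorem QP_LC : QP 2 2 (LC R) := by
  refine QP_thetaS grow_eC (r := fun k => 2 * k + 1) (fun a b h => by simpa using h) 2 2 1
    (fun k => by ring) (fun k => ?_)
  rw [eC_cast, eC_cast]; ring

theorem Sy_Lg : Sy 1 (Lg R) := by
  refine Sy_thetaS grow_eG (r := fun k => k) (fun a b h => h) 1 1 (fun k => rfl) (fun k => ?_)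
  have := eG_cast (1-k)
  have := eG_cast k
  zify; linarith

theorem Sy_LA : Sy 0 (LA R) := by
  refine Sy_thetaS grow_eA (r := fun k => 2 * k) (fun a b h => by simpa using h) 0 0
    (fun k => by ring) (fun k => ?_)
  zify; rw [eA_cast, eA_cast]; ring

theorem Sy_LC : Sy 0 (LC R) := by
  refine Sy_thetaS grow_eC (r := fun k => 2 * k + 1) (fun a b h => by simpa using h) 0 (-1)
    (fun k => by ring) (fun k => ?_)
  zify; rw [eC_cast, eC_cast]; ring

theorem QP_Lh (t j : ℕ) (hj : j < t) : QP (2 * t) (2 * t - 1) (Lh R t j) := by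
  have := (QP_Lg R).mul (((QP_LA R).pow j).mul ((QP_LC R).pow (t - 1 - j)))
  rw [Lh]
  convert this using 1 <;> (push_cast [show j ≤ t - 1 by omega, show 1 ≤ t by omega]; ring)

theorem Sy_Lh (t j : ℕ) : Sy 1 (Lh R t j) := by
  rw [Lh]
  simpa using (Sy_Lg R).mul (((Sy_LA R).pow j).mul ((Sy_LC R).pow (t - 1 - j)))

variable {R}

theorem qp_iter {t : ℕ} {H : PowerSeries (LaurentPolynomial R)} (h : QP (2 * t) (2 * t - 1) H)
    (i : ℤ) (n k : ℤ) :
    cf H (n + (2 * t * k ^ 2 + (2 * i + 1) * k)) (i + 1 + 2 * t * k) = cf H n (i + 1) := by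
  induction k using Int.induction_on with
  | zero => simp
  | succ k ih =>
    rw [← ih, ← h _ (i + 1 + 2 * t * k)]
    congr 1 <;> ring
  | pred k ih =>
    rw [← ih]
    symm
    rw [← h _ (i + 1 + 2 * t * (-k - 1))]
    congr 1 <;> ring

theorem monomial_eq_C_mul_X_pow {K : Type*} [CommRing K] (n : ℕ) (a : K) :
    PowerSeries.monomial n a = PowerSeries.C a * X ^ n := by
  rw [X_pow_eq, ← monomial_zero_eq_C_apply, monomial_mul_monomial, zero_add, mul_one]

theorem coeff_mul_thetaS {K : Type*} [CommRing K] {e : ℤ → ℕ} (he : Grow e) (B : PowerSeries K) (M : ℤ → K) (n L : ℕ)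
    (hL : n + 1 ≤ L) :
    coeff n (B * thetaS e M) = ∑ k ∈ Finset.Icc (-(L : ℤ)) L,
      if e k ≤ n then coeff (n - e k) B * M k else 0 := by
  have h := (Cg.refl (n+1) B).mul (cg_thetaS he M (n+1) L hL)
  rw [h.coeff_eq (Nat.lt_succ_self n), Finset.mul_sum, map_sum]
  refine Finset.sum_congr rfl fun k _ => ?_
  rw [monomial_eq_C_mul_X_pow, ← mul_assoc, coeff_mul_X_pow', coeff_mul_C]

theorem emod_unique {t : ℤ} {a b k k' : ℤ} (ha : 0 ≤ a) (ha' : a < 2 * t) (hb : 0 ≤ b)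
    (hb' : b < 2 * t) (h : a + 2 * t * k = b + 2 * t * k') : a = b ∧ k = k' := by
  have h1 : a = b := by
    have := congrArg (· % (2 * t)) h
    simpa [Int.emod_eq_of_lt ha ha', Int.emod_eq_of_lt hb hb'] using this
  refine ⟨h1, ?_⟩
  subst h1
  have : (2 * t) * k = (2 * t) * k' := by linarith
  exact mul_left_cancel₀ (by omega) this

/-- the coefficient series -/
def Bs (H : PowerSeries (LaurentPolynomial R)) (i : ℕ) : PowerSeries R :=
  PowerSeries.mk fun n => (coeff n H).coeff (i + 1)

theorem Sy.add {c : ℤ} {H G : PowerSeries (LaurentPolynomial R)} (h : Sy c H) (h' : Sy c G) :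
    Sy c (H + G) := by
  intro n m
  have := h n m; have := h' n m
  simp only [cf] at *
  split_ifs at * <;> simp_all

theorem cf_expand (t : ℕ) (H : PowerSeries (LaurentPolynomial R)) (n : ℕ) (m : ℤ) (L : ℕ) (hL : n + 1 ≤ L) :
    cf (∑ i : Fin t, PowerSeries.map LaurentPolynomial.C (Bs H i) * Lf R t i) n m =
    ∑ i : Fin t, ∑ k ∈ Finset.Icc (-(L : ℤ)) L, if eF t i k ≤ n then
      cf H (n - eF t i k) (i + 1) * ((if i + 1 + 2 * t * k = m then 1 else 0) +
        (if - i - 2 * t * k = m then 1 else 0)) else 0 := by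
  rw [cf_nat, map_sum, AddMonoidAlgebra.coeff_sum, Finsupp.finsetSum_apply]
  refine Finset.sum_congr rfl fun i _ => ?_
  rw [Lf, coeff_mul_thetaS (grow_eF t i i.2) _ _ n L hL, AddMonoidAlgebra.coeff_sum, Finsupp.finsetSum_apply]
  refine Finset.sum_congr rfl fun k _ => ?_
  by_cases h1 : eF t i k ≤ n
  · rw [if_pos h1, if_pos h1, ← Nat.cast_sub h1, cf_nat, PowerSeries.coeff_map,
      ← LaurentPolynomial.smul_eq_C_mul, AddMonoidAlgebra.coeff_smul_apply]
    simp [Bs]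
  · rw [if_neg h1, if_neg h1]; simp

theorem expand {t : ℕ} (ht : 0 < t) {H : PowerSeries (LaurentPolynomial R)} (h : QP (2 * t) (2 * t - 1) H)
    (hs : Sy 1 H) :
    H = ∑ i : Fin t, PowerSeries.map LaurentPolynomial.C (Bs H i) * Lf R t i := by
  set G := ∑ i : Fin t, PowerSeries.map LaurentPolynomial.C (Bs H i) * Lf R t i with hG
  have key : ∀ (n : ℕ) (m : ℤ), (m - 1) % (2 * t) < t → cf H n m = cf G n m := by
    intro n m hm
    have ht' : (0 : ℤ) < 2 * t := by omega
    have h0 := Int.emod_nonneg (m - 1) ht'.ne'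
    have hdm := Int.emod_add_mul_ediv (m - 1) (2 * t)
    set k0 := (m - 1) / (2 * t) with hk0
    obtain ⟨i0, hi0⟩ := Int.eq_ofNat_of_zero_le h0
    rw [hi0] at hm hdm
    have hi : i0 < t := by exact_mod_cast hm
    rw [hG, cf_expand t H n m (n + 1 + k0.natAbs) (by omega)]
    rw [Finset.sum_eq_single (⟨i0, hi⟩ : Fin t), Finset.sum_eq_single k0]
    · have h1 : (i0 : ℤ) + 1 + 2 * t * k0 = m := by linarith
      have h2 : ¬ (-(i0 : ℤ) - 2 * t * k0 = m) := by
        intro h2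
        have h3 : (i0 + i0 + 1 : ℤ) + 2 * t * k0 = 0 + 2 * t * (- k0) := by linarith
        have := emod_unique (by omega) (by omega) (by omega) (by omega) h3
        omega
      simp only [if_pos h1, if_neg h2, add_zero, mul_one]
      have h4 := qp_iter h i0 (n - eF t i0 k0) k0
      rw [← eF_cast t i0 hi, h1, sub_add_cancel] at h4
      rw [h4]
      split_ifs with h5
      · rfl
      · exact cf_neg _ _ (by omega)
    · intro k _ hk
      have h2 : ¬ (-(i0 : ℤ) - 2 * t * k = m) := by
        intro h2
        have h3 : (i0 + i0 + 1 : ℤ) + 2 * t * k0 = 0 + 2 * t * (- k) := by linarith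
        have := emod_unique (by omega) (by omega) (by omega) (by omega) h3
        omega
      have h1 : ¬ ((i0 : ℤ) + 1 + 2 * t * k = m) := by
        intro h1
        have h3 : (i0 : ℤ) + 2 * t * k0 = i0 + 2 * t * k := by linarith
        have := emod_unique (by omega) (by omega) (by omega) (by omega) h3
        omega
      simp [h1, h2]
    · intro h3; exfalso; apply h3
      rw [Finset.mem_Icc]; omega
    · rintro ⟨i, hi'⟩ _ hne
      have hne' : i ≠ i0 := fun h => hne (by simp [h])
      apply Finset.sum_eq_zero
      intro k _
      have h2 : ¬ (-(i : ℤ) - 2 * t * k = m) := by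
        intro h2
        have h3 : (i0 + i + 1 : ℤ) + 2 * t * k0 = 0 + 2 * t * (- k) := by linarith
        have := emod_unique (by omega) (by omega) (by omega) (by omega) h3
        omega
      have h1 : ¬ ((i : ℤ) + 1 + 2 * t * k = m) := by
        intro h1
        have h3 : (i0 : ℤ) + 2 * t * k0 = i + 2 * t * k := by linarith
        have := emod_unique (by omega) (by omega) (by omega) (by omega) h3
        omega
      simp [h1, h2]
    · simp
  have hGs : ∀ (n : ℕ) (m : ℤ), cf G n (1 - m) = cf G n m := by
    intro n m
    rw [hG, cf_expand t H n m (n + 1) le_rfl, cf_expand t H n (1 - m) (n + 1) le_rfl]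
    refine Finset.sum_congr rfl fun i _ => Finset.sum_congr rfl fun k _ => ?_
    congr 2
    rw [add_comm]
    congr 2 <;> (simp only [eq_iff_iff]; constructor <;> intro h <;> linarith)
  apply ext_cf
  intro n m
  rcases lt_or_ge ((m - 1) % (2 * t)) (t : ℤ) with hm | hm
  · exact key n m hm
  · rw [← hs, ← hGs]
    apply key
    have ht' : (0 : ℤ) < 2 * t := by omega
    have h1 := Int.emod_lt_of_pos (m - 1) ht'
    have hdm := Int.emod_add_mul_ediv (m - 1) (2 * t)
    have : 1 - m - 1 = (2 * t - 1 - (m - 1) % (2 * t)) + 2 * t * (- ((m - 1) / (2 * t)) - 1) := by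
      linarith
    rw [this, Int.add_mul_emod_self_left, Int.emod_eq_of_lt (by omega) (by omega)]
    omega

end QPeriodic

end NOC




namespace NOC

section Eval

variable {R K : Type*} [CommRing R] [CommRing K]

theorem zpow_tri (u : Kˣ) (k : ℤ) :
    ((u : K)) ^ (k * (k + 1) / 2).toNat * ((u⁻¹ : Kˣ) : K) ^ (k * (k - 1) / 2).toNat =
      ((u ^ k : Kˣ) : K) := by
  rw [← Units.val_pow_eq_pow_val, ← Units.val_pow_eq_pow_val, ← Units.val_mul]
  congr 1
  rw [← zpow_natCast, ← zpow_natCast, Int.toNat_of_nonneg (tri_nonneg k),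
    Int.toNat_of_nonneg (tri_nonneg' k), inv_zpow', ← zpow_add]
  congr 1
  have := tri_two k
  have := tri_two' k
  linarith

/-- Jacobi triple product for theta sums. -/
theorem theta_prod {e : ℤ → ℕ} (he : Grow e) (a b : ℕ) (hab : 0 < a + b)
    (hE : ∀ k : ℤ, 2 * (e k : ℤ) = a * (k * (k + 1)) + b * (k * (k - 1))) (u : Kˣ) :
    HasIProd (fun n => (1 + PowerSeries.C (u : K) * X ^ a * X ^ ((a + b) * n)) *
      (1 + PowerSeries.C ((u⁻¹ : Kˣ) : K) * X ^ b * X ^ ((a + b) * n)) * (1 - X ^ ((a + b) * (n + 1))))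
      (thetaS e (fun k => ((u ^ k : Kˣ) : K))) := by
  have hq : PowerSeries.C (u : K) * X ^ a * (PowerSeries.C ((u⁻¹ : Kˣ) : K) * X ^ b) = X ^ (a + b) := by
    have : PowerSeries.C (u : K) * PowerSeries.C ((u⁻¹ : Kˣ) : K) = 1 := by
      rw [← map_mul]; simp
    linear_combination (X : PowerSeries K) ^ (a + b) * this
  have hS := hasISum_thetaS he (fun k => ((u ^ k : Kˣ) : K))
  have := jtp (PowerSeries.C (u : K) * X ^ a) (PowerSeries.C ((u⁻¹ : Kˣ) : K) * X ^ b)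
    (hq := by rw [hq]; exact dvd_pow_self X (by omega)) (S := thetaS e (fun k => ((u ^ k : Kˣ) : K))) ?_
  · simpa only [hq, ← pow_mul] using this
  · convert hS using 2 with k
    rw [rth, mul_pow, mul_pow, monomial_eq_C_mul_X_pow, ← zpow_tri, map_mul, map_pow, map_pow]
    have : e k = a * (k * (k + 1) / 2).toNat + b * (k * (k - 1) / 2).toNat := by
      zify
      rw [Int.toNat_of_nonneg (tri_nonneg k), Int.toNat_of_nonneg (tri_nonneg' k)]
      have h1 := tri_two k
      have h2 := tri_two' k
      have h3 := hE k
      rw [← h1, ← h2] at h3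
      linarith
    rw [this, pow_add, ← pow_mul, ← pow_mul]
    ring

variable (K) in
def gth (z : Kˣ) : PowerSeries K := thetaS eG (fun k => ((z ^ k : Kˣ) : K))
def Ath (z : Kˣ) : PowerSeries K := thetaS eA (fun k => ((z ^ (2 * k) : Kˣ) : K))
def Cth (z : Kˣ) : PowerSeries K := thetaS eC (fun k => ((z ^ (2 * k + 1) : Kˣ) : K))
def Tth (u : Kˣ) : PowerSeries K := thetaS eT (fun k => (((-u) ^ k : Kˣ) : K))
def fth (t i : ℕ) (z : Kˣ) : PowerSeries K :=
  thetaS (eF t i) (fun k => ((z ^ (i + 1 + 2 * t * k) : Kˣ) : K) + ((z ^ (- i - 2 * t * k) : Kˣ) : K))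

theorem addition_formula' (z w : Kˣ) : Ath z * Cth w - Ath w * Cth z =
    PowerSeries.C (w : K) * (Tth (z / w) * Tth ((z * w)⁻¹)) := by
  rw [Ath, Cth, Ath, Cth, addition_formula, Tth, Tth]
  simp only [← mul_zpow, neg_one_mul]

theorem gth_prod (z : Kˣ) : HasIProd (fun n => (1 + PowerSeries.C (z : K) * X ^ n) *
      (1 + PowerSeries.C ((z⁻¹ : Kˣ) : K) * X ^ (n + 1)) * (1 - X ^ (n + 1))) (gth K z) := by
  have := theta_prod grow_eG 0 1 (by norm_num) (fun k => by rw [eG_cast]; push_cast; ring) z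
  simp only [gth]
  convert this using 2 with n
  ring

theorem Tth_prod (u : Kˣ) : HasIProd (fun n => (1 - PowerSeries.C (u : K) * X ^ (2 * n)) *
      (1 - PowerSeries.C ((u⁻¹ : Kˣ) : K) * X ^ (2 * (n + 1))) * (1 - X ^ (2 * (n + 1)))) (Tth u) := by
  have := theta_prod grow_eT 0 2 (by norm_num) (fun k => by rw [eT_cast]; push_cast; ring) (-u)
  simp only [Tth]
  convert this using 2 with n
  rw [inv_neg, Units.val_neg, Units.val_neg, map_neg, map_neg]
  ring

/-- evaluation -/
def ev (φ : R →+* K) (z : Kˣ) : PowerSeries (LaurentPolynomial R) →+* PowerSeries K :=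
  PowerSeries.map (LaurentPolynomial.eval₂ φ z)

theorem ev_Lg (φ : R →+* K) (z : Kˣ) : ev φ z (Lg R) = gth K z := by
  rw [ev, Lg, map_thetaS, gth]; simp
theorem ev_LA (φ : R →+* K) (z : Kˣ) : ev φ z (LA R) = Ath z := by
  rw [ev, LA, map_thetaS, Ath]; simp
theorem ev_LC (φ : R →+* K) (z : Kˣ) : ev φ z (LC R) = Cth z := by
  rw [ev, LC, map_thetaS, Cth]; simp
theorem ev_Lf (φ : R →+* K) (z : Kˣ) (t i : ℕ) : ev φ z (Lf R t i) = fth t i z := by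
  rw [ev, Lf, map_thetaS, fth]; simp
theorem ev_C (φ : R →+* K) (z : Kˣ) (B : PowerSeries R) :
    ev φ z (PowerSeries.map LaurentPolynomial.C B) = PowerSeries.map φ B := by
  ext n
  simp [ev]

variable (R) in
/-- the matrix of coefficient series -/
def Bmat (t : ℕ) : Matrix (Fin t) (Fin t) (PowerSeries R) :=
  Matrix.of fun i k => Bs (Lh R t k) i

theorem det_main (φ : R →+* K) (t : ℕ) (ht : 0 < t) (z : Fin t → Kˣ) :
    (∏ j, gth K (z j)) * ∏ i, ∏ j ∈ Finset.Ioi i,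
      (PowerSeries.C (z i : K) * (Tth (z j / z i) * Tth ((z j * z i)⁻¹))) =
    (Matrix.of fun j i : Fin t => fth t i (z j)).det * PowerSeries.map φ (Bmat R t).det := by
  have h1 : (PowerSeries.map φ).mapMatrix (Bmat R t) = Matrix.of fun i k : Fin t => PowerSeries.map φ (Bs (Lh R t k) i) := by
    ext i k; simp [Bmat]
  have h2 : (Matrix.of fun j i : Fin t => fth t i (z j)) * (PowerSeries.map φ).mapMatrix (Bmat R t) =
      Matrix.of fun j k : Fin t => ev φ (z j) (Lh R t k) := by
    ext1 j k
    rw [h1, Matrix.mul_apply, Matrix.of_apply]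
    rw [show ev φ (z j) (Lh R t k) = _ from congrArg (ev φ (z j)) (expand ht (QP_Lh R t k k.2) (Sy_Lh R t k))]
    rw [map_sum]
    refine Finset.sum_congr rfl fun i _ => ?_
    rw [map_mul, ev_C, ev_Lf, mul_comm]; rfl
  have h3 : (Matrix.of fun j k : Fin t => ev φ (z j) (Lh R t k)) =
      Matrix.of fun j k : Fin t => (gth K (z j)) *
        (Matrix.projVandermonde (fun j => Ath (z j)) (fun j => Cth (z j))) j k := by
    ext1 j k
    rw [Matrix.of_apply, Matrix.of_apply, Lh, map_mul, map_mul, map_pow, map_pow, ev_Lg, ev_LA, ev_LC,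
      Matrix.projVandermonde_apply, Fin.val_rev]
    congr 3
    omega
  rw [RingHom.map_det, ← Matrix.det_mul, h2, h3, Matrix.det_mul_column, Matrix.det_projVandermonde]
  congr 1
  refine Finset.prod_congr rfl fun i _ => Finset.prod_congr rfl fun j _ => ?_
  rw [← addition_formula']

end Eval

end NOC




namespace NOC

section Prods

variable {K : Type*} [CommRing K]

/-- infinite product of a sequence whose `i`-th term is `1 + O(X^(i+1))` -/
def iprod (f : ℕ → PowerSeries K) : PowerSeries K :=
  open Classical in if h : ∃ P, HasIProd f P then h.choose else 0

theorem hasIProd_iprod {f : ℕ → PowerSeries K} (hf : ∀ i, Cg (i + 1) (f i) 1) :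
    HasIProd f (iprod f) := by
  have h := exists_hasIProd f hf
  rw [iprod, dif_pos h]
  exact h.choose_spec

theorem cg_one_add {N : ℕ} {a : PowerSeries K} (h : X ^ N ∣ a) : Cg N (1 + a) 1 := by
  unfold Cg; simpa using h

theorem cg_one_sub {N : ℕ} {a : PowerSeries K} (h : X ^ N ∣ a) : Cg N (1 - a) 1 := by
  unfold Cg; simpa using h

theorem Cg.mul_one {N : ℕ} {a b : PowerSeries K} (h : Cg N a 1) (h' : Cg N b 1) : Cg N (a * b) 1 := by
  simpa using h.mul h'

theorem X_pow_dvd_aux (s i : ℕ) (hs : 0 < s) : (X : PowerSeries K) ^ (i + 1) ∣ X ^ (s * (i + 1)) :=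
  pow_dvd_pow _ (Nat.le_mul_of_pos_left _ hs)

/-- `∏ (1 - X^{s n})` -/
def Eu (K : Type*) [CommRing K] (s : ℕ) : PowerSeries K := iprod fun n => 1 - X ^ (s * (n + 1))
/-- `∏ (1 + X^{s n})` -/
def Ep (K : Type*) [CommRing K] (s : ℕ) : PowerSeries K := iprod fun n => 1 + X ^ (s * (n + 1))

theorem hasIProd_Eu {s : ℕ} (hs : 0 < s) : HasIProd (fun n => 1 - X ^ (s * (n + 1))) (Eu K s) :=
  hasIProd_iprod fun i => cg_one_sub (X_pow_dvd_aux s i hs)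

theorem hasIProd_Ep {s : ℕ} (hs : 0 < s) : HasIProd (fun n => 1 + X ^ (s * (n + 1))) (Ep K s) :=
  hasIProd_iprod fun i => cg_one_add (X_pow_dvd_aux s i hs)

theorem map_Eu {K' : Type*} [CommRing K'] (φ : K →+* K') {s : ℕ} (hs : 0 < s) :
    PowerSeries.map φ (Eu K s) = Eu K' s := by
  have := (hasIProd_Eu (K := K) hs).map φ
  simp only [map_sub, map_one, map_pow, PowerSeries.map_X] at this
  exact this.unique (hasIProd_Eu hs)

theorem map_Ep {K' : Type*} [CommRing K'] (φ : K →+* K') {s : ℕ} (hs : 0 < s) :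
    PowerSeries.map φ (Ep K s) = Ep K' s := by
  have := (hasIProd_Ep (K := K) hs).map φ
  simp only [map_add, map_one, map_pow, PowerSeries.map_X] at this
  exact this.unique (hasIProd_Ep hs)

/-- the symmetric triple product -/
def P3 (s : ℕ) (u : Kˣ) : PowerSeries K := iprod fun n => (1 - PowerSeries.C (u : K) * X ^ (s * (n + 1))) *
  (1 - PowerSeries.C ((u⁻¹ : Kˣ) : K) * X ^ (s * (n + 1))) * (1 - X ^ (s * (n + 1)))

theorem hasIProd_P3 {s : ℕ} (hs : 0 < s) (u : Kˣ) : HasIProd (fun n => (1 - PowerSeries.C (u : K) * X ^ (s * (n + 1))) *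
  (1 - PowerSeries.C ((u⁻¹ : Kˣ) : K) * X ^ (s * (n + 1))) * (1 - X ^ (s * (n + 1)))) (P3 s u) :=
  hasIProd_iprod fun i => ((cg_one_sub ((X_pow_dvd_aux s i hs).mul_left _)).mul_one
    (cg_one_sub ((X_pow_dvd_aux s i hs).mul_left _))).mul_one (cg_one_sub (X_pow_dvd_aux s i hs))

theorem map_P3 {K' : Type*} [CommRing K'] (φ : K →+* K') {s : ℕ} (hs : 0 < s) (u : Kˣ) :
    PowerSeries.map φ (P3 s u) = P3 s (Units.map φ u) := by
  have := (hasIProd_P3 (K := K) hs u).map φ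
  simp only [map_sub, map_mul, map_one, map_pow, PowerSeries.map_X, PowerSeries.map_C] at this
  exact this.unique (hasIProd_P3 hs (Units.map (φ : K →* K') u))

theorem HasIProd.shift {u v : ℕ → PowerSeries K} {P Q : PowerSeries K}
    (h : HasIProd (fun n => u n * v n) P) (hu : ∀ n, Cg n (u n) 1)
    (h' : HasIProd (fun n => u (n + 1) * v n) Q) : P = u 0 * Q := by
  apply eq_of_cg
  intro M
  obtain ⟨N1, h1⟩ := h M
  obtain ⟨N2, h2⟩ := h' M
  set N := max M (max N1 N2) with hN
  have h3 := h1 N (by omega)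
  have h4 := h2 N (by omega)
  have h5 : Cg M (u N) 1 := (hu N).mono (by omega)
  have h6 : (∏ i ∈ Finset.range N, (u i * v i)) * u N = u 0 * ∏ i ∈ Finset.range N, (u (i + 1) * v i) := by
    have e := Finset.prod_range_succ u N
    rw [Finset.prod_range_succ'] at e
    rw [Finset.prod_mul_distrib, Finset.prod_mul_distrib]
    linear_combination (-∏ i ∈ Finset.range N, v i) * e
  have h7 := h3.symm.mul h5.symm
  rw [mul_one, h6] at h7
  exact h7.trans ((Cg.refl M (u 0)).mul h4)

theorem gth_eq (z : Kˣ) : gth K z = PowerSeries.C (1 + (z : K)) * P3 1 (-z) := by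
  have h1 := gth_prod z
  have h2 := hasIProd_P3 (s := 1) one_pos (-z)
  have := HasIProd.shift (u := fun n => 1 + PowerSeries.C (z : K) * X ^ n)
    (v := fun n => (1 + PowerSeries.C ((z⁻¹ : Kˣ) : K) * X ^ (n + 1)) * (1 - X ^ (n + 1)))
    (P := gth K z) (Q := P3 1 (-z)) ?_ ?_ ?_
  · rw [this]; simp
  · simpa only [mul_assoc] using h1
  · intro n
    exact cg_one_add (Dvd.intro_left _ rfl)
  · convert h2 using 2 with n
    rw [inv_neg, Units.val_neg, Units.val_neg, map_neg, map_neg, one_mul]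
    ring

theorem Tth_eq (u : Kˣ) : Tth u = PowerSeries.C (1 - (u : K)) * P3 2 u := by
  have h1 := Tth_prod u
  have h2 := hasIProd_P3 (s := 2) two_pos u
  have := HasIProd.shift (u := fun n => 1 - PowerSeries.C (u : K) * X ^ (2 * n))
    (v := fun n => (1 - PowerSeries.C ((u⁻¹ : Kˣ) : K) * X ^ (2 * (n + 1))) * (1 - X ^ (2 * (n + 1))))
    (P := Tth u) (Q := P3 2 u) ?_ ?_ ?_
  · rw [this]; simp
  · simpa only [mul_assoc] using h1
  · intro n
    refine cg_one_sub (Dvd.dvd.mul_left (pow_dvd_pow _ (by omega)) _)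
  · convert h2 using 2 with n
    ring

/-- Splitting a full double product. -/
theorem prod_offdiag {M : Type*} [CommMonoid M] {t : ℕ} (f : Fin t → Fin t → M) :
    ∏ i, ∏ j, f i j = (∏ i, f i i) * ∏ i, ∏ j ∈ Finset.Ioi i, (f i j * f j i) := by
  have h1 : ∀ i : Fin t, ∏ j, f i j = f i i * ((∏ j ∈ Finset.Ioi i, f i j) * ∏ j ∈ Finset.Iio i, f i j) := by
    intro i
    rw [← Finset.prod_union, ← Finset.prod_insert]
    · refine Finset.prod_congr ?_ fun _ _ => rfl
      ext j
      simp only [Finset.mem_univ, Finset.mem_insert, Finset.mem_union, Finset.mem_Ioi, Finset.mem_Iio, true_iff]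
      rcases lt_trichotomy i j with h | h | h <;> simp [h]
    · simp
    · rw [Finset.disjoint_left]
      intro j hj
      simp only [Finset.mem_Ioi, Finset.mem_Iio] at *
      exact not_lt.2 hj.le
  simp only [h1, Finset.prod_mul_distrib]
  congr 2
  apply Finset.prod_comm'
  simp

theorem root_prod {A : Type*} [CommRing A] [IsDomain A] {n : ℕ} (hn : 0 < n) {η : A}
    (h : IsPrimitiveRoot η n) (v : A) : ∏ m ∈ Finset.range n, (1 - v * η ^ m) = 1 - v ^ n := by
  classical
  have := h.pow_sub_pow_eq_prod_sub_mul (1 : A) v hn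
  rw [one_pow] at this
  rw [this]
  have h2 : Polynomial.nthRootsFinset n (1 : A) = (Finset.range n).image (fun m => η ^ m) := by
    symm
    apply Finset.eq_of_subset_of_card_le
    · intro x hx
      rw [Finset.mem_image] at hx
      obtain ⟨m, _, rfl⟩ := hx
      rw [Polynomial.mem_nthRootsFinset hn, ← pow_mul, mul_comm, pow_mul, h.pow_eq_one, one_pow]
    · rw [h.card_nthRootsFinset, Finset.card_image_of_injOn, Finset.card_range]
      intro a ha b hb hab
      simp only [Finset.coe_range, Set.mem_Iio] at ha hb
      exact h.pow_inj ha hb hab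
  rw [h2, Finset.prod_image]
  · refine Finset.prod_congr rfl fun m _ => by rw [mul_comm]
  · intro a ha b hb hab
    simp only [Finset.coe_range, Set.mem_Iio] at ha hb
    exact h.pow_inj ha hb hab

end Prods

end NOC




namespace NOC

section EvalOne

def Od (K : Type*) [CommRing K] : PowerSeries K := iprod fun n => 1 - X ^ (2 * n + 1)

theorem hasIProd_Od {K : Type*} [CommRing K] : HasIProd (fun n => 1 - X ^ (2 * n + 1)) (Od K) :=
  hasIProd_iprod fun i => cg_one_sub (pow_dvd_pow _ (by omega))

theorem Od_mul_Eu {K : Type*} [CommRing K] : Od K * Eu K 2 = Eu K 1 := by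
  have h1 := hasIProd_Od (K := K).mul (hasIProd_Eu (K := K) two_pos)
  have h2 := (hasIProd_Eu (K := K) one_pos).group 2 two_pos
  refine h1.unique ?_
  convert h2 using 2 with n
  rw [Finset.prod_range_succ, Finset.prod_range_one]
  congr 3 <;> ring

theorem constantCoeff_Eu {K : Type*} [CommRing K] {s : ℕ} (hs : 0 < s) :
    constantCoeff (Eu K s) = 1 := by
  have := hasIProd_Eu (K := K) hs
  exact this.constantCoeff_eq (fun n => by simp [hs.ne'])

variable {t : ℕ}

theorem zeta_pow (ht : 0 < t) (ζ : ℂˣ) (hζ : IsPrimitiveRoot (ζ : ℂ) (4 * t)) : ζ ^ (2 * t) = -1 := by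
  ext
  have h := hζ.pow_eq_one
  have h1 : ((ζ : ℂ) ^ (2 * t)) ^ 2 = 1 := by rw [← pow_mul, ← h]; congr 1; ring
  have h2 : ((ζ : ℂ) ^ (2 * t)) ≠ 1 := hζ.pow_ne_one_of_pos_of_lt (by omega) (by omega)
  have h3 : ((ζ : ℂ) ^ (2 * t) - 1) * ((ζ : ℂ) ^ (2 * t) + 1) = 0 := by linear_combination h1
  have h4 := (mul_eq_zero.1 h3).resolve_left (sub_ne_zero.2 h2)
  simpa using eq_neg_of_add_eq_zero_left h4

/-- odd powers -/
def xi (ζ : ℂˣ) (j : ℕ) : ℂˣ := ζ ^ (2 * j + 1)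

theorem zeta_pow4 (ht : 0 < t) (ζ : ℂˣ) (hζ : IsPrimitiveRoot (ζ : ℂ) (4 * t)) : ζ ^ (4 * t) = 1 := by
  rw [show 4 * t = 2 * t * 2 by ring, pow_mul, zeta_pow ht ζ hζ]; simp

theorem prim_C (ζ : ℂˣ) (hζ : IsPrimitiveRoot (ζ : ℂ) (4 * t)) : IsPrimitiveRoot (PowerSeries.C (ζ : ℂ)) (4 * t) :=
  hζ.map_of_injective (f := (PowerSeries.C : ℂ →+* PowerSeries ℂ)) PowerSeries.C_injective

theorem rootprod1 (ht : 0 < t) (ζ : ℂˣ) (hζ : IsPrimitiveRoot (ζ : ℂ) (4 * t)) (w : PowerSeries ℂ) :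
    ∏ j : Fin t, ((1 - w * PowerSeries.C (xi ζ j : ℂ)) * (1 - w * PowerSeries.C ((xi ζ j)⁻¹ : ℂˣ).val)) =
      1 + w ^ (2 * t) := by
  have h1 : IsPrimitiveRoot (PowerSeries.C (ζ : ℂ) ^ 2) (2 * t) :=
    (prim_C ζ hζ).pow (by omega) (by ring)
  have h2 := root_prod (by omega) h1 (w * PowerSeries.C (ζ : ℂ))
  have h3 : (w * PowerSeries.C (ζ : ℂ)) ^ (2 * t) = - w ^ (2 * t) := by
    rw [mul_pow, ← map_pow, ← Units.val_pow_eq_pow_val, zeta_pow ht ζ hζ]; simp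
  rw [h3, sub_neg_eq_add, two_mul, Finset.prod_range_add] at h2
  rw [two_mul, ← h2, Fin.prod_univ_eq_prod_range (fun j => ((1 - w * PowerSeries.C (xi ζ j : ℂ)) * (1 - w * PowerSeries.C ((xi ζ j)⁻¹ : ℂˣ).val)))]
  rw [Finset.prod_mul_distrib]
  refine congrArg₂ (· * ·) ?_ ?_
  · refine Finset.prod_congr rfl fun j hj => ?_
    rw [mul_assoc]
    congr 2
    rw [xi, ← map_pow, ← map_pow, ← map_mul]
    simp only [Units.val_pow_eq_pow_val]
    congr 1
    ring
  · rw [← Finset.prod_range_reflect]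
    refine Finset.prod_congr rfl fun j hj => ?_
    rw [Finset.mem_range] at hj
    rw [mul_assoc]
    congr 2
    rw [xi, ← map_pow, ← map_pow, ← map_mul]
    simp only [← Units.val_pow_eq_pow_val, ← Units.val_mul]
    congr 2
    rw [_root_.inv_eq_iff_mul_eq_one, ← pow_mul, ← pow_succ', ← pow_add, ← zeta_pow4 ht ζ hζ]
    congr 1
    omega

theorem rootprod2 (ht : 0 < t) (ζ : ℂˣ) (hζ : IsPrimitiveRoot (ζ : ℂ) (4 * t)) (y : PowerSeries ℂ) :
    ∏ j : Fin t, (1 - y * PowerSeries.C ((xi ζ j * xi ζ j : ℂˣ) : ℂ)) = 1 + y ^ t := by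
  have h1 : IsPrimitiveRoot (PowerSeries.C (ζ : ℂ) ^ 4) t :=
    (prim_C ζ hζ).pow (by omega) (by ring)
  have h2 := root_prod (by omega) h1 (y * PowerSeries.C (ζ : ℂ) ^ 2)
  have h3 : (y * PowerSeries.C (ζ : ℂ) ^ 2) ^ t = - y ^ t := by
    rw [mul_pow, ← pow_mul, ← map_pow, ← Units.val_pow_eq_pow_val, zeta_pow ht ζ hζ]; simp
  rw [h3, sub_neg_eq_add] at h2
  rw [← h2, Fin.prod_univ_eq_prod_range (fun j => (1 - y * PowerSeries.C ((xi ζ j * xi ζ j : ℂˣ) : ℂ)))]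
  refine Finset.prod_congr rfl fun j hj => ?_
  rw [mul_assoc, xi]
  simp only [← map_pow, ← map_mul, ← Units.val_pow_eq_pow_val, ← Units.val_mul]
  congr 4
  rw [← pow_add, ← pow_mul, ← pow_add]
  congr 1
  ring

theorem R_identity (ht : 0 < t) (ζ : ℂˣ) (hζ : IsPrimitiveRoot (ζ : ℂ) (4 * t)) (y : PowerSeries ℂ) :
    (∏ i : Fin t, ∏ j ∈ Finset.Ioi i, ((1 - PowerSeries.C ((xi ζ j / xi ζ i : ℂˣ) : ℂ) * y) *
      (1 - PowerSeries.C (((xi ζ j / xi ζ i)⁻¹ : ℂˣ) : ℂ) * y) *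
      ((1 - PowerSeries.C (((xi ζ j * xi ζ i)⁻¹ : ℂˣ) : ℂ) * y) *
      (1 - PowerSeries.C ((((xi ζ j * xi ζ i)⁻¹)⁻¹ : ℂˣ) : ℂ) * y)))) * ((1 - y) ^ t * (1 + y ^ t)) = (1 - y ^ (2 * t)) ^ t := by
  have h1 : ∀ j : Fin t, ∏ i : Fin t, ((1 - y * PowerSeries.C ((xi ζ j * xi ζ i : ℂˣ) : ℂ)) *
      (1 - y * PowerSeries.C ((xi ζ j / xi ζ i : ℂˣ) : ℂ))) = 1 - y ^ (2 * t) := by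
    intro j
    have := rootprod1 ht ζ hζ (y * PowerSeries.C (xi ζ j : ℂ))
    have e0 : (xi ζ j) ^ (2 * t) = -1 := by
      rw [xi, ← pow_mul, mul_comm (2 * (j : ℕ) + 1), pow_mul ζ (2 * t), zeta_pow ht ζ hζ]
      simp [pow_succ, pow_mul]
    have e : (y * PowerSeries.C (xi ζ j : ℂ)) ^ (2 * t) = - y ^ (2 * t) := by
      rw [mul_pow, ← map_pow, ← Units.val_pow_eq_pow_val, e0]
      simp
    rw [e, ← sub_eq_add_neg] at this
    rw [← this]
    refine Finset.prod_congr rfl fun i _ => ?_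
    rw [div_eq_mul_inv, Units.val_mul, Units.val_mul, map_mul, map_mul, mul_assoc, mul_assoc]
  have h2 : ∏ j : Fin t, ∏ i : Fin t, ((1 - y * PowerSeries.C ((xi ζ j * xi ζ i : ℂˣ) : ℂ)) *
      (1 - y * PowerSeries.C ((xi ζ j / xi ζ i : ℂˣ) : ℂ))) = (1 - y ^ (2 * t)) ^ t := by
    rw [Finset.prod_congr rfl fun j _ => h1 j]; simp
  rw [prod_offdiag] at h2
  have hD : ∏ i : Fin t, ((1 - y * PowerSeries.C ((xi ζ i * xi ζ i : ℂˣ) : ℂ)) *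
      (1 - y * PowerSeries.C ((xi ζ i / xi ζ i : ℂˣ) : ℂ))) = (1 - y) ^ t * (1 + y ^ t) := by
    rw [Finset.prod_mul_distrib, rootprod2 ht ζ hζ]
    simp [mul_comm]
  rw [hD] at h2
  rw [← h2, mul_comm]
  have h3 : (∏ i : Fin t, ∏ j ∈ Finset.Ioi i, (1 - PowerSeries.C (((xi ζ j * xi ζ i)⁻¹ : ℂˣ) : ℂ) * y)) =
      ∏ i : Fin t, ∏ j ∈ Finset.Ioi i, (1 - y * PowerSeries.C ((xi ζ j * xi ζ i : ℂˣ) : ℂ)) := by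
    have : ∀ i : Fin t, xi ζ (Fin.rev i) = - (xi ζ i)⁻¹ := by
      intro i
      rw [← mul_right_inj (xi ζ i), mul_neg, mul_inv_cancel, xi, xi, ← pow_add, ← zeta_pow ht ζ hζ]
      congr 1
      rw [Fin.val_rev]; omega
    rw [Finset.prod_sigma', Finset.prod_sigma']
    refine Finset.prod_bij (fun p _ => ⟨Fin.rev p.2, Fin.rev p.1⟩) ?_ ?_ ?_ ?_
    · simp
    · rintro ⟨a, b⟩ _ ⟨c, d⟩ _ h
      simp only [Sigma.mk.injEq, heq_eq_eq, Fin.rev_inj] at h ⊢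
      exact ⟨h.2, h.1⟩
    · rintro ⟨a, b⟩ h
      refine ⟨⟨Fin.rev b, Fin.rev a⟩, ?_, by simp⟩
      simpa using h
    · rintro ⟨a, b⟩ _
      simp only [this]
      rw [mul_comm]
      congr 4
      simp [mul_comm]
  refine congrArg₂ (· * ·) rfl ?_
  have h4 : ∀ i j : Fin t, ((1 - PowerSeries.C ((xi ζ j / xi ζ i : ℂˣ) : ℂ) * y) *
      (1 - PowerSeries.C (((xi ζ j / xi ζ i)⁻¹ : ℂˣ) : ℂ) * y) *
      ((1 - PowerSeries.C (((xi ζ j * xi ζ i)⁻¹ : ℂˣ) : ℂ) * y) *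
      (1 - PowerSeries.C ((((xi ζ j * xi ζ i)⁻¹)⁻¹ : ℂˣ) : ℂ) * y))) =
      (1 - PowerSeries.C (((xi ζ j * xi ζ i)⁻¹ : ℂˣ) : ℂ) * y) *
      ((1 - PowerSeries.C ((xi ζ j / xi ζ i : ℂˣ) : ℂ) * y) *
      (1 - PowerSeries.C (((xi ζ i / xi ζ j) : ℂˣ) : ℂ) * y) *
      (1 - PowerSeries.C ((xi ζ i * xi ζ j : ℂˣ) : ℂ) * y)) := by
    intro i j
    rw [inv_inv, inv_div, mul_comm (xi ζ j) (xi ζ i)]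
    ring
  rw [Finset.prod_congr rfl fun i _ => Finset.prod_congr rfl fun j _ => h4 i j]
  rw [Finset.prod_congr rfl fun i _ => Finset.prod_mul_distrib, Finset.prod_mul_distrib, h3]
  rw [← Finset.prod_mul_distrib]
  refine Finset.prod_congr rfl fun i _ => ?_
  rw [← Finset.prod_mul_distrib]
  refine Finset.prod_congr rfl fun j _ => ?_
  ring

end EvalOne

end NOC




namespace NOC

section EvalOneB

theorem sum_card_Ioi (t : ℕ) : (∑ i : Fin t, (Finset.Ioi i).card) * 2 = t * (t - 1) := by
  simp only [Fin.card_Ioi]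
  rw [Fin.sum_univ_eq_sum_range (fun i => t - 1 - i), Finset.sum_range_reflect (fun i => i),
    Finset.sum_range_id_mul_two]

theorem prod_pairs_const {M : Type*} [CommMonoid M] (t : ℕ) (a : M) :
    ∏ i : Fin t, ∏ _j ∈ Finset.Ioi i, (a * a) = a ^ (t * (t - 1)) := by
  simp only [Finset.prod_const]
  rw [Finset.prod_pow_eq_pow_sum, ← pow_two, ← pow_mul, ← sum_card_Ioi, mul_comm]

variable {K : Type*} [CommRing K]

theorem lhs_split {t : ℕ} (z : Fin t → Kˣ) :
    (∏ j, gth K (z j)) * ∏ i, ∏ j ∈ Finset.Ioi i,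
      (PowerSeries.C (z i : K) * (Tth (z j / z i) * Tth ((z j * z i)⁻¹))) =
    PowerSeries.C ((∏ j, (1 + (z j : K))) * ∏ i, ∏ j ∈ Finset.Ioi i,
      ((z i : K) * (1 - ((z j / z i : Kˣ) : K)) * (1 - (((z j * z i)⁻¹ : Kˣ) : K)))) *
    ((∏ j, P3 1 (- z j)) * ∏ i, ∏ j ∈ Finset.Ioi i, (P3 2 (z j / z i) * P3 2 ((z j * z i)⁻¹))) := by
  simp only [gth_eq, Tth_eq, Finset.prod_mul_distrib, map_mul, map_prod]
  ring

theorem prod_T (t : ℕ) (ht : 0 < t) :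
    ∏ i : Fin t, thetaS (eF t i) (fun k => (((-1 : Kˣ) ^ k : Kˣ) : K)) = Od K * Eu K (4 * t) ^ t := by
  have h1 : ∀ i ∈ (Finset.univ : Finset (Fin t)), HasIProd (fun n =>
      (1 - X ^ (2 * (2 * t * n + (t + i)) + 1)) * (1 - X ^ (2 * (2 * t * n + (t - 1 - i)) + 1)) *
        (1 - X ^ (4 * t * (n + 1))))
      (thetaS (eF t i) (fun k => (((-1 : Kˣ) ^ k : Kˣ) : K))) := by
    intro i _
    have hi := i.2
    have := theta_prod (K := K) (grow_eF t i hi) (2 * t + 2 * i + 1) (2 * t - 2 * i - 1) (by omega)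
      (fun k => by
        rw [eF_cast t i hi k]
        have : ((2 * t - 2 * i - 1 : ℕ) : ℤ) = 2 * t - 2 * i - 1 := by omega
        rw [this]; push_cast; ring) (-1)
    convert this using 2 with n
    have e : 2 * t + 2 * (i : ℕ) + 1 + (2 * t - 2 * i - 1) = 4 * t := by omega
    rw [e, mul_assoc (PowerSeries.C _) (X ^ (2 * t + 2 * (i : ℕ) + 1)), mul_assoc (PowerSeries.C _) (X ^ (2 * t - 2 * (i : ℕ) - 1)), ← pow_add, ← pow_add]
    have e1 : 2 * t + 2 * (i : ℕ) + 1 + 4 * t * n = 2 * (2 * t * n + (t + i)) + 1 := by ring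
    have e2 : 2 * t - 2 * (i : ℕ) - 1 + 4 * t * n = 2 * (2 * t * n + (t - 1 - i)) + 1 := by
      have : 4 * t * n = 2 * (2 * t * n) := by ring
      omega
    rw [e1, e2]
    simp [sub_eq_add_neg]
  refine (HasIProd.prod _ h1).unique ?_
  have h2 := (hasIProd_Od (K := K)).group (2 * t) (by omega)
  have h3 := (hasIProd_Eu (K := K) (s := 4 * t) (by omega)).pow t
  convert h2.mul h3 using 2 with n
  rw [two_mul t, Finset.prod_range_add, ← Finset.prod_range_reflect (fun j => 1 - X ^ (2 * ((t + t) * n + j) + 1)) t]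
  rw [Finset.prod_mul_distrib, Finset.prod_mul_distrib, ← Fin.prod_univ_eq_prod_range, ← Fin.prod_univ_eq_prod_range]
  simp
  ring

variable {t : ℕ}

theorem gpart (ht : 0 < t) (ζ : ℂˣ) (hζ : IsPrimitiveRoot (ζ : ℂ) (4 * t)) : ∏ j : Fin t, P3 1 (-xi ζ j) = Ep ℂ (2 * t) * Eu ℂ 1 ^ t := by
  have h1 := HasIProd.prod Finset.univ (fun (j : Fin t) _ => hasIProd_P3 one_pos (-xi ζ j))
  refine h1.unique ?_
  convert (hasIProd_Ep (K := ℂ) (s := 2 * t) (by omega)).mul ((hasIProd_Eu (K := ℂ) one_pos).pow t) using 2 with n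
  rw [Finset.prod_mul_distrib]
  refine congrArg₂ (· * ·) ?_ ?_
  · have := rootprod1 ht ζ hζ (- X ^ (1 * (n + 1)))
    rw [Even.neg_pow (even_two_mul t), ← pow_mul] at this
    convert this using 2
    · simp only [inv_neg, Units.val_neg, map_neg]
      ring
    · ring
  · simp

theorem wpart (ht : 0 < t) (ζ : ℂˣ) (hζ : IsPrimitiveRoot (ζ : ℂ) (4 * t)) : (∏ i : Fin t, ∏ j ∈ Finset.Ioi i, (P3 2 (xi ζ j / xi ζ i) * P3 2 ((xi ζ j * xi ζ i)⁻¹))) *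
    (Eu ℂ 2 ^ t * Ep ℂ (2 * t)) = Eu ℂ (4 * t) ^ t * Eu ℂ 2 ^ (t * (t - 1)) := by
  have h1 := HasIProd.prod Finset.univ (fun (i : Fin t) _ => HasIProd.prod (Finset.Ioi i)
    (fun (j : Fin t) _ => (hasIProd_P3 two_pos (xi ζ j / xi ζ i)).mul (hasIProd_P3 two_pos ((xi ζ j * xi ζ i)⁻¹))))
  have h2 := h1.mul (((hasIProd_Eu (K := ℂ) two_pos).pow t).mul (hasIProd_Ep (K := ℂ) (s := 2 * t) (by omega)))
  refine h2.unique ?_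
  convert ((hasIProd_Eu (K := ℂ) (s := 4 * t) (by omega)).pow t).mul ((hasIProd_Eu (K := ℂ) two_pos).pow (t * (t - 1))) using 2 with n
  have := R_identity ht ζ hζ (X ^ (2 * (n + 1)))
  rw [← prod_pairs_const]
  have e1 : (X : PowerSeries ℂ) ^ (4 * t * (n + 1)) = (X ^ (2 * (n + 1))) ^ (2 * t) := by
    rw [← pow_mul]; congr 1; ring
  have e2 : (X : PowerSeries ℂ) ^ (2 * t * (n + 1)) = (X ^ (2 * (n + 1))) ^ t := by
    rw [← pow_mul]; congr 1; ring
  rw [e1, e2, ← this]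
  generalize (X : PowerSeries ℂ) ^ (2 * (n + 1)) = y
  rw [mul_right_comm]
  refine congrArg₂ (· * ·) ?_ rfl
  rw [← Finset.prod_mul_distrib]
  refine Finset.prod_congr rfl fun i _ => ?_
  rw [← Finset.prod_mul_distrib]
  refine Finset.prod_congr rfl fun j _ => ?_
  ring

theorem fpart (ht : 0 < t) (ζ : ℂˣ) (hζ : IsPrimitiveRoot (ζ : ℂ) (4 * t)) : ∃ c : ℂ, (Matrix.of fun j i : Fin t => fth t i (xi ζ j)).det =
    PowerSeries.C c * (Od ℂ * Eu ℂ (4 * t) ^ t) := by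
  have e0 : ∀ j : ℕ, (xi ζ j) ^ (2 * t) = -1 := by
    intro j
    rw [xi, ← pow_mul, mul_comm (2 * (j : ℕ) + 1), pow_mul ζ (2 * t), zeta_pow ht ζ hζ]
    simp [pow_succ, pow_mul]
  have e1 : ∀ (j : ℕ) (k : ℤ), (xi ζ j) ^ (2 * (t : ℤ) * k) = (-1) ^ k := by
    intro j k
    rw [zpow_mul, ← e0 j]
    congr 1
  have h1 : ∀ j i : Fin t, fth t i (xi ζ j) =
      thetaS (eF t i) (fun k => (((-1 : ℂˣ) ^ k : ℂˣ) : ℂ)) *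
      PowerSeries.C (((xi ζ j ^ ((i : ℤ) + 1) : ℂˣ) : ℂ) + ((xi ζ j ^ (-(i : ℤ)) : ℂˣ) : ℂ)) := by
    intro j i
    rw [← thetaS_mul_const, fth]
    congr 1
    funext k
    have e2 : ((-1 : ℂˣ) ^ k)⁻¹ = (-1) ^ k := by rw [← inv_zpow]; simp
    rw [zpow_add, zpow_sub, e1, e2, mul_add, Units.val_mul, Units.val_mul]
    ring
  have h2 : (Matrix.of fun j i : Fin t => fth t i (xi ζ j)) = Matrix.of fun j i : Fin t =>
      thetaS (eF t i) (fun k => (((-1 : ℂˣ) ^ k : ℂˣ) : ℂ)) *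
      ((PowerSeries.C (R := ℂ)).mapMatrix (Matrix.of fun j i : Fin t => (((xi ζ j ^ ((i : ℤ) + 1) : ℂˣ) : ℂ) + ((xi ζ j ^ (-(i : ℤ)) : ℂˣ) : ℂ)))) j i := by
    ext1 j i
    simp [h1]
  rw [h2, Matrix.det_mul_row, ← RingHom.map_det, prod_T t ht, mul_comm]
  exact ⟨_, rfl⟩

theorem zeta_inj (ht : 0 < t) (ζ : ℂˣ) (hζ : IsPrimitiveRoot (ζ : ℂ) (4 * t)) (a b : ℕ) (ha : a < 4 * t) (hb : b < 4 * t) (h : ζ ^ a = ζ ^ b) : a = b := by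
  apply hζ.pow_inj ha hb
  rw [← Units.val_pow_eq_pow_val, h, Units.val_pow_eq_pow_val]

theorem const_ne (ht : 0 < t) (ζ : ℂˣ) (hζ : IsPrimitiveRoot (ζ : ℂ) (4 * t)) : ((∏ j : Fin t, (1 + (xi ζ j : ℂ))) * ∏ i : Fin t, ∏ j ∈ Finset.Ioi i,
      ((xi ζ i : ℂ) * (1 - ((xi ζ j / xi ζ i : ℂˣ) : ℂ)) * (1 - (((xi ζ j * xi ζ i)⁻¹ : ℂˣ) : ℂ)))) ≠ 0 := by
  refine mul_ne_zero (Finset.prod_ne_zero_iff.2 fun j _ => ?_) (Finset.prod_ne_zero_iff.2 fun i _ =>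
    Finset.prod_ne_zero_iff.2 fun j hj => mul_ne_zero (mul_ne_zero (Units.ne_zero _) ?_) ?_)
  · intro h
    have : xi ζ j = ζ ^ (2 * t) := by
      rw [zeta_pow ht ζ hζ]; ext
      simpa using eq_neg_of_add_eq_zero_right h
    have := zeta_inj ht ζ hζ _ _ (by omega) (by omega) this
    omega
  · intro h
    have h1 : xi ζ j / xi ζ i = 1 := by ext; simpa using (sub_eq_zero.1 h).symm
    rw [div_eq_one] at h1
    have := zeta_inj ht ζ hζ _ _ (by omega) (by omega) h1
    simp only [Finset.mem_Ioi, Fin.lt_def] at hj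
    omega
  · intro h
    have h1 : (xi ζ j * xi ζ i)⁻¹ = 1 := by ext; simpa using (sub_eq_zero.1 h).symm
    rw [inv_eq_one, xi, xi, ← pow_add, ← pow_zero ζ] at h1
    simp only [Finset.mem_Ioi, Fin.lt_def] at hj
    have := zeta_inj ht ζ hζ _ _ (by omega) (by omega) h1
    omega

theorem Eu_ne_zero {K : Type*} [CommRing K] [Nontrivial K] {s : ℕ} (hs : 0 < s) : Eu K s ≠ 0 := by
  intro h
  have := constantCoeff_Eu (K := K) hs
  simp [h] at this

theorem eval_one (t : ℕ) (ht : 0 < t) : ∃ c c3 : ℂ, c ≠ 0 ∧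
    PowerSeries.C c * (Eu ℂ 1 ^ t * Eu ℂ 2 ^ (t * (t - 1))) =
    PowerSeries.C c3 * (Eu ℂ 1 * Eu ℂ 2 ^ (t - 1)) * (Bmat ℂ t).det := by
  have hp := Complex.isPrimitiveRoot_exp (4 * t) (by omega)
  obtain ⟨ζ, hz⟩ : ∃ ζ : ℂˣ, (ζ : ℂ) = Complex.exp (2 * Real.pi * Complex.I / (4 * t : ℕ)) :=
    ⟨Units.mk0 _ (Complex.exp_ne_zero _), rfl⟩
  have hζ : IsPrimitiveRoot (ζ : ℂ) (4 * t) := by rw [hz]; exact hp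
  have h := det_main (RingHom.id ℂ) t ht (fun j => xi ζ j)
  obtain ⟨c3, hc3⟩ := fpart ht ζ hζ
  rw [lhs_split, gpart ht ζ hζ, hc3] at h
  simp only [PowerSeries.map_id, RingHom.id_apply, id] at h
  refine ⟨_, c3, const_ne ht ζ hζ, ?_⟩
  apply mul_left_cancel₀ (pow_ne_zero t (Eu_ne_zero (K := ℂ) (s := 4 * t) (by omega)))
  have hw := wpart ht ζ hζ
  have hO := Od_mul_Eu (K := ℂ)
  have e : Eu ℂ 2 ^ t = Eu ℂ 2 * Eu ℂ 2 ^ (t - 1) := by rw [← pow_succ']; congr 1; omega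
  linear_combination (Eu ℂ 2 ^ t) * h - PowerSeries.C _ * Eu ℂ 1 ^ t * hw + PowerSeries.C c3 * Eu ℂ (4 * t) ^ t * (Bmat ℂ t).det * Eu ℂ 2 ^ (t - 1) * hO + PowerSeries.C c3 * Eu ℂ (4 * t) ^ t * (Bmat ℂ t).det * Od ℂ * e

end EvalOneB

end NOC




namespace NOC

section EvalTwo

variable {K : Type*} [CommRing K]

open Polynomial.Chebyshev in
theorem cheb_monic [Nontrivial K] (n : ℕ) : ((C K (n + 1)).Monic ∧ (C K (n + 1)).natDegree = n + 1) ∧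
    ((C K (n + 2)).Monic ∧ (C K (n + 2)).natDegree = n + 2) := by
  have key : ∀ (m : ℕ) (p q : Polynomial K), p.Monic → p.natDegree = m + 1 → q.natDegree ≤ m + 1 →
      (Polynomial.X * p - q).Monic ∧ (Polynomial.X * p - q).natDegree = m + 2 := by
    intro m p q hp hd hq
    have h1 : (Polynomial.X * p).Monic := Polynomial.monic_X.mul hp
    have h2 : (Polynomial.X * p).natDegree = m + 2 := by
      rw [Polynomial.monic_X.natDegree_mul hp, hd]; simp; ring
    have h3 : q.degree < (Polynomial.X * p).degree := by
      apply Polynomial.degree_lt_degree; omega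
    exact ⟨h1.sub_of_left h3, by rw [Polynomial.natDegree_sub_eq_left_of_natDegree_lt (by omega), h2]⟩
  induction n with
  | zero =>
    have h1 : (C K (((0 : ℕ) : ℤ) + 1)) = Polynomial.X := by simp
    have h2 : (C K (((0 : ℕ) : ℤ) + 2)) = Polynomial.X * Polynomial.X - 2 := by
      have := C_add_two K 0; simpa using this
    rw [h1, h2]
    refine ⟨⟨Polynomial.monic_X, Polynomial.natDegree_X⟩, ?_⟩
    exact key 0 _ _ Polynomial.monic_X Polynomial.natDegree_X (by
      rw [show (2 : Polynomial K) = ((2 : ℕ) : Polynomial K) by simp, Polynomial.natDegree_natCast]; omega)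
  | succ n ih =>
    have e1 : (((n + 1 : ℕ) : ℤ) + 1) = (n : ℤ) + 2 := by push_cast; ring
    have e2 : (((n + 1 : ℕ) : ℤ) + 2) = ((n : ℤ) + 1) + 2 := by push_cast; ring
    rw [e1, e2]
    refine ⟨⟨ih.2.1, by rw [ih.2.2]⟩, ?_⟩
    rw [C_add_two]
    have e3 : ((n : ℤ) + 1 + 1) = n + 2 := by ring
    rw [e3]
    exact key (n + 1) _ _ ih.2.1 ih.2.2 (by rw [ih.1.2]; omega)

open Polynomial.Chebyshev in
theorem cheb_eval (z : Kˣ) (n : ℕ) : (C K n).eval ((z : K) + ((z⁻¹ : Kˣ) : K)) = ((z ^ n : Kˣ) : K) + (((z ^ n)⁻¹ : Kˣ) : K) ∧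
    (C K (n + 1)).eval ((z : K) + ((z⁻¹ : Kˣ) : K)) = ((z ^ (n + 1) : Kˣ) : K) + (((z ^ (n + 1))⁻¹ : Kˣ) : K) := by
  induction n with
  | zero => simp; norm_num
  | succ n ih =>
    have e1 : ((n + 1 : ℕ) : ℤ) = (n : ℤ) + 1 := by push_cast; ring
    have e2 : ((n : ℤ) + 1 + 1) = n + 2 := by ring
    rw [e1, e2]
    refine ⟨ih.2, ?_⟩
    rw [C_add_two, Polynomial.eval_sub, Polynomial.eval_mul, Polynomial.eval_X, ih.1, ih.2]
    have hz : (z : K) * ((z⁻¹ : Kˣ) : K) = 1 := by simp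
    simp only [pow_succ, mul_inv_rev, Units.val_mul]
    linear_combination (((z ^ n : Kˣ) : K) + (((z ^ n)⁻¹ : Kˣ) : K)) * hz

/-- polynomials for the determinant -/
def pc (K : Type*) [CommRing K] (j : ℕ) : Polynomial K := if j = 0 then 1 else Polynomial.Chebyshev.C K j

def kap (K : Type*) [CommRing K] (j : ℕ) : K := if j = 0 then 2 else 1

theorem pc_eval (z : Kˣ) (j : ℕ) : ((z ^ j : Kˣ) : K) + (((z ^ j)⁻¹ : Kˣ) : K) =
    kap K j * (pc K j).eval ((z : K) + ((z⁻¹ : Kˣ) : K)) := by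
  unfold pc kap
  split_ifs with h
  · subst h; simp; norm_num
  · rw [(cheb_eval z j).1, one_mul]

theorem pc_monic [Nontrivial K] (j : ℕ) : (pc K j).Monic ∧ (pc K j).natDegree = j := by
  unfold pc
  split_ifs with h
  · subst h; simp
  · obtain ⟨n, rfl⟩ := Nat.exists_eq_succ_of_ne_zero h
    have := (cheb_monic (K := K) n).1
    simpa using this

theorem cheb_det [Nontrivial K] {t : ℕ} (z : Fin t → Kˣ) (r : Fin t → K) :
    (Matrix.of fun j i : Fin t => r j * (((z i ^ (j : ℕ) : Kˣ) : K) + (((z i ^ (j : ℕ))⁻¹ : Kˣ) : K))).det =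
    (∏ j : Fin t, (r j * kap K j)) * ∏ i : Fin t, ∏ j ∈ Finset.Ioi i,
      (((z j : K) + (((z j)⁻¹ : Kˣ) : K)) - ((z i : K) + (((z i)⁻¹ : Kˣ) : K))) := by
  rw [← Matrix.det_vandermonde (fun i => (z i : K) + (((z i)⁻¹ : Kˣ) : K)),
    Matrix.det_eval_matrixOfPolynomials_eq_det_vandermonde _ (fun j : Fin t => pc K j)
      (fun i => (pc_monic (i : ℕ)).2) (fun i => (pc_monic (i : ℕ)).1),
    ← Matrix.det_mul_row, ← Matrix.det_transpose]
  congr 1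
  ext1 i j
  simp only [Matrix.of_apply, Matrix.transpose_apply, pc_eval]
  ring

/-- quantum integers -/
theorem exists_quantum (s : Kˣ) (ψ : K →+* ℂ) (hψ : ψ s = 1) (m : ℤ) :
    ∃ q : K, ((s ^ m : Kˣ) : K) - ((s ^ (-m) : Kˣ) : K) = ((s : K) - ((s⁻¹ : Kˣ) : K)) * q ∧ ψ q = m := by
  have hψz : ∀ m : ℤ, ψ ((s ^ m : Kˣ) : K) = 1 := by
    intro m
    have : Units.map (ψ : K →* ℂ) s = 1 := by ext; simpa using hψ
    have h2 : Units.map (ψ : K →* ℂ) (s ^ m) = 1 := by rw [map_zpow, this, one_zpow]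
    exact congrArg Units.val h2
  have hs : (s : K) * ((s⁻¹ : Kˣ) : K) = 1 := by simp
  induction m using Int.induction_on with
  | zero => exact ⟨0, by simp⟩
  | succ m ih =>
    obtain ⟨q, h1, h2⟩ := ih
    refine ⟨s * q + ((s ^ (-(m : ℤ)) : Kˣ) : K), ?_, ?_⟩
    · rw [zpow_add, neg_add, zpow_add, zpow_one, zpow_neg_one, Units.val_mul, Units.val_mul]
      linear_combination (s : K) * h1
    · rw [map_add, map_mul, h2, hψ, hψz]; push_cast; ring
  | pred m ih =>
    obtain ⟨q, h1, h2⟩ := ih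
    refine ⟨((s⁻¹ : Kˣ) : K) * q - ((s ^ (-(-(m : ℤ))) : Kˣ) : K), ?_, ?_⟩
    · rw [show -(-(m : ℤ) - 1) = -(-(m : ℤ)) + 1 by ring, sub_eq_add_neg (-(m : ℤ)), zpow_add, zpow_add, zpow_one, zpow_neg_one, Units.val_mul, Units.val_mul]
      linear_combination ((s⁻¹ : Kˣ) : K) * h1
    · rw [map_sub, map_mul, h2, hψz, show ((s⁻¹ : Kˣ) : K) = ((s ^ (-1 : ℤ) : Kˣ) : K) by simp, hψz]; push_cast; ring

/-- multilinear expansion of a determinant -/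
theorem det_sum_expand {t : ℕ} {A : Type*} [CommRing A] (S : Finset ℤ) (e : Fin t → ℤ → A) (m : Fin t → Fin t → ℤ → A) :
    (Matrix.of fun j i : Fin t => ∑ k ∈ S, e i k * m j i k).det =
    ∑ k ∈ Fintype.piFinset (fun _ : Fin t => S), (∏ i, e i (k i)) * (Matrix.of fun j i : Fin t => m j i (k i)).det := by
  simp only [Matrix.det_apply, Matrix.of_apply, Finset.prod_univ_sum, Finset.smul_sum, Finset.mul_sum]
  rw [Finset.sum_comm]
  refine Finset.sum_congr rfl fun k _ => Finset.sum_congr rfl fun σ _ => ?_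
  rw [Finset.prod_mul_distrib, mul_smul_comm]

end EvalTwo

end NOC




namespace NOC

section EvalTwoB

/-- the shifted vector -/
def Vv (t : ℕ) (i : ℕ) (k : ℤ) : ℤ := 2 * i + 1 + 4 * t * k

variable {K : Type*} [CommRing K]

theorem lhs_const (s : Kˣ) (ψ : K →+* ℂ) (hψ : ψ s = 1) (t : ℕ) : ∃ c : K, ((∏ j : Fin t, (1 + ((s ^ (2 * (j : ℕ)) : Kˣ) : K))) * ∏ i : Fin t, ∏ j ∈ Finset.Ioi i,
      (((s ^ (2 * (i : ℕ)) : Kˣ) : K) * (1 - ((s ^ (2 * (j : ℕ)) / s ^ (2 * (i : ℕ)) : Kˣ) : K)) *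
      (1 - (((s ^ (2 * (j : ℕ)) * s ^ (2 * (i : ℕ)))⁻¹ : Kˣ) : K)))) =
    ((s : K) - ((s⁻¹ : Kˣ) : K)) ^ (t * (t - 1)) * c := by
  have key : ∀ m : ℤ, ∃ g : K, 1 - ((s ^ (2 * m) : Kˣ) : K) = ((s : K) - ((s⁻¹ : Kˣ) : K)) * g := by
    intro m
    obtain ⟨q, h1, -⟩ := exists_quantum s ψ hψ m
    refine ⟨- ((s ^ m : Kˣ) : K) * q, ?_⟩
    have h2 : ((s ^ m : Kˣ) : K) * ((s ^ (-m) : Kˣ) : K) = 1 := by rw [← Units.val_mul, ← zpow_add]; simp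
    rw [two_mul, zpow_add, Units.val_mul]
    linear_combination - ((s ^ m : Kˣ) : K) * h1 - h2
  choose g hg using key
  refine ⟨(∏ j : Fin t, (1 + ((s ^ (2 * (j : ℕ)) : Kˣ) : K))) * ∏ i : Fin t, ∏ j ∈ Finset.Ioi i,
    (((s ^ (2 * (i : ℕ)) : Kˣ) : K) * g ((j : ℤ) - i) * g (-((j : ℤ) + i))), ?_⟩
  rw [← prod_pairs_const, mul_left_comm]
  refine congrArg₂ (· * ·) rfl ?_
  rw [← Finset.prod_mul_distrib]
  refine Finset.prod_congr rfl fun i _ => ?_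
  rw [← Finset.prod_mul_distrib]
  refine Finset.prod_congr rfl fun j _ => ?_
  have e1 : s ^ (2 * (j : ℕ)) / s ^ (2 * (i : ℕ)) = s ^ (2 * ((j : ℤ) - i)) := by
    rw [← zpow_natCast, ← zpow_natCast, div_eq_mul_inv, ← zpow_sub]; congr 1; push_cast; ring
  have e2 : (s ^ (2 * (j : ℕ)) * s ^ (2 * (i : ℕ)))⁻¹ = s ^ (2 * (-((j : ℤ) + i))) := by
    rw [← zpow_natCast, ← zpow_natCast, ← zpow_add, ← zpow_neg]; congr 1; push_cast; ring
  rw [e1, e2, hg, hg]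
  ring

theorem det_factor [IsDomain K] (s : Kˣ) (ψ : K →+* ℂ) (hψ : ψ s = 1) (t : ℕ) : ∃ g : (Fin t → ℤ) → K, ∀ k : Fin t → ℤ,
    (Matrix.of fun j i : Fin t => ((s ^ (j : ℕ) : Kˣ) : K) * ((((s ^ Vv t i (k i)) ^ (j : ℕ) : Kˣ) : K) +
      ((((s ^ Vv t i (k i)) ^ (j : ℕ))⁻¹ : Kˣ) : K))).det = ((s : K) - ((s⁻¹ : Kˣ) : K)) ^ (t * (t - 1)) * g k ∧
    ψ (g k) = (∏ j : Fin t, kap ℂ j) * (1 / 2) ^ (t * (t - 1)) *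
      ∏ i : Fin t, ∏ j ∈ Finset.Ioi i, ((Vv t j (k j) : ℂ) ^ 2 - (Vv t i (k i) : ℂ) ^ 2) := by
  choose q hq hq2 using exists_quantum s ψ hψ
  refine ⟨fun k => (∏ j : Fin t, (((s ^ (j : ℕ) : Kˣ) : K) * kap K j)) * ∏ i : Fin t, ∏ j ∈ Finset.Ioi i,
    (q ((j : ℤ) - i + 2 * t * (k j - k i)) * q ((j : ℤ) + i + 1 + 2 * t * (k j + k i))), fun k => ⟨?_, ?_⟩⟩
  · rw [cheb_det (fun i : Fin t => s ^ Vv t i (k i)) (fun j : Fin t => ((s ^ (j : ℕ) : Kˣ) : K))]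
    rw [← prod_pairs_const, mul_left_comm]
    refine congrArg₂ (· * ·) rfl ?_
    rw [← Finset.prod_mul_distrib]
    refine Finset.prod_congr rfl fun i _ => ?_
    rw [← Finset.prod_mul_distrib]
    refine Finset.prod_congr rfl fun j _ => ?_
    set a := (j : ℤ) - i + 2 * t * (k j - k i) with ha
    set b := (j : ℤ) + i + 1 + 2 * t * (k j + k i) with hb
    have e1 : Vv t j (k j) = a + b := by rw [ha, hb, Vv]; push_cast; ring
    have e2 : Vv t i (k i) = b - a := by rw [ha, hb, Vv]; push_cast; ring
    rw [e1, e2]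
    clear_value a b
    have e3 := hq a
    have e4 := hq b
    rw [← zpow_neg, ← zpow_neg, show -(a + b) = -a + -b by ring, show -(b - a) = -b + a by ring, sub_eq_add_neg b a,
      zpow_add, zpow_add, zpow_add, zpow_add]
    simp only [Units.val_mul]
    linear_combination (((s ^ b : Kˣ) : K) - ((s ^ (-b) : Kˣ) : K)) * e3 + ((s : K) - ((s⁻¹ : Kˣ) : K)) * q a * e4
  · have hk : ∀ j : ℕ, ψ (kap K j) = kap ℂ j := by
      intro j; unfold kap; split_ifs
      · exact map_ofNat ψ 2
      · exact map_one ψ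
    have hs : ∀ j : ℕ, ψ ((s ^ j : Kˣ) : K) = 1 := by
      intro j; rw [Units.val_pow_eq_pow_val, map_pow, hψ, one_pow]
    simp only [map_mul, map_prod, hk, hs, hq2, one_mul]
    rw [mul_assoc, ← prod_pairs_const]
    refine congrArg₂ (· * ·) rfl ?_
    rw [← Finset.prod_mul_distrib]
    refine Finset.prod_congr rfl fun i _ => ?_
    rw [← Finset.prod_mul_distrib]
    refine Finset.prod_congr rfl fun j _ => ?_
    simp only [Vv]; push_cast; ring

theorem fth_eq (s : Kˣ) (t : ℕ) (i j : ℕ) : fth t i (s ^ (2 * j)) = thetaS (eF t i) (fun k =>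
    ((s ^ j : Kˣ) : K) * ((((s ^ Vv t i k) ^ j : Kˣ) : K) + ((((s ^ Vv t i k) ^ j)⁻¹ : Kˣ) : K))) := by
  rw [fth]
  congr 1
  funext k
  rw [mul_add, ← Units.val_mul, ← Units.val_mul]
  congr 2
  · rw [← zpow_natCast, ← zpow_natCast, ← zpow_natCast, ← zpow_mul, ← zpow_mul, ← zpow_add]
    congr 1; rw [Vv]; push_cast; ring
  · rw [← zpow_natCast, ← zpow_natCast, ← zpow_natCast, ← zpow_mul, ← zpow_mul, ← zpow_neg, ← zpow_add]
    congr 1; rw [Vv]; push_cast; ring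

theorem cg_det {t N : ℕ} {A B : Fin t → Fin t → PowerSeries K} (h : ∀ i j, Cg N (A i j) (B i j)) :
    Cg N (Matrix.of A).det (Matrix.of B).det := by
  rw [Matrix.det_apply, Matrix.det_apply]
  refine Cg.sum _ fun σ _ => ?_
  simp only [Units.smul_def, zsmul_eq_mul]
  exact (Cg.refl _ _).mul (Cg.prod _ fun i _ => h _ _)

theorem cg_cancel [IsDomain K] {N : ℕ} {d : K} (hd : d ≠ 0) {a b : PowerSeries K}
    (h : Cg N (PowerSeries.C d * a) (PowerSeries.C d * b)) : Cg N a b := by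
  rw [cg_iff] at h ⊢
  intro n hn
  have := h n hn
  rw [coeff_C_mul, coeff_C_mul] at this
  exact mul_left_cancel₀ hd this

theorem eval_two_aux [IsDomain K] (s : Kˣ) (ψ : K →+* ℂ) (hψ : ψ s = 1) (hD : (s : K) - ((s⁻¹ : Kˣ) : K) ≠ 0) (φ : ℂ →+* K) (hφ : ψ.comp φ = RingHom.id ℂ) (t : ℕ) (ht : 0 < t) :
    ∃ c1 : ℂ, ∀ N L : ℕ, N ≤ L →
    Cg N (PowerSeries.C c1 * ((Ep ℂ 1 ^ 2 * Eu ℂ 1) ^ t * (Eu ℂ 2 ^ 3) ^ (t * (t - 1))))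
      ((∑ k ∈ Fintype.piFinset (fun _ : Fin t => Finset.Icc (-(L : ℤ)) L),
        PowerSeries.monomial (∑ i : Fin t, eF t i (k i))
        ((∏ j : Fin t, kap ℂ j) * (1 / 2) ^ (t * (t - 1)) *
      ∏ i : Fin t, ∏ j ∈ Finset.Ioi i, ((Vv t j (k j) : ℂ) ^ 2 - (Vv t i (k i) : ℂ) ^ 2))) * (Bmat ℂ t).det) := by
  obtain ⟨c, hc⟩ := lhs_const s ψ hψ t
  obtain ⟨g, hg⟩ := det_factor s ψ hψ t
  have hm := det_main φ t ht (fun j : Fin t => s ^ (2 * (j : ℕ)))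
  rw [lhs_split, hc, map_mul, mul_assoc] at hm
  refine ⟨ψ c, fun N L hNL => ?_⟩
  have h1 : Cg N (Matrix.of fun j i : Fin t => fth t i (s ^ (2 * (j : ℕ)))).det
      (PowerSeries.C (((s : K) - ((s⁻¹ : Kˣ) : K)) ^ (t * (t - 1))) *
      ∑ k ∈ Fintype.piFinset (fun _ : Fin t => Finset.Icc (-(L : ℤ)) L),
        PowerSeries.monomial (∑ i : Fin t, eF t i (k i)) (g k)) := by
    have h2 : Cg N (Matrix.of fun j i : Fin t => fth t i (s ^ (2 * (j : ℕ)))).det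
      (Matrix.of fun j i : Fin t => ∑ k ∈ Finset.Icc (-(L : ℤ)) L, X ^ (eF t i k) * (PowerSeries.C
        (((s ^ (j : ℕ) : Kˣ) : K) * ((((s ^ Vv t i k) ^ (j : ℕ) : Kˣ) : K) + ((((s ^ Vv t i k) ^ (j : ℕ))⁻¹ : Kˣ) : K))))).det := by
      refine cg_det fun j i => ?_
      rw [fth_eq]
      refine (cg_thetaS (grow_eF t i i.2) _ N L hNL).trans (Cg.of_eq ?_)
      refine Finset.sum_congr rfl fun k _ => ?_
      rw [monomial_eq_C_mul_X_pow, mul_comm]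
    refine h2.trans (Cg.of_eq ?_)
    rw [det_sum_expand, Finset.mul_sum]
    refine Finset.sum_congr rfl fun k _ => ?_
    have h3 : (Matrix.of fun j i : Fin t => (PowerSeries.C
        (((s ^ (j : ℕ) : Kˣ) : K) * ((((s ^ Vv t i (k i)) ^ (j : ℕ) : Kˣ) : K) + ((((s ^ Vv t i (k i)) ^ (j : ℕ))⁻¹ : Kˣ) : K))))) =
        (PowerSeries.C (R := K)).mapMatrix (Matrix.of fun j i : Fin t => (((s ^ (j : ℕ) : Kˣ) : K) * ((((s ^ Vv t i (k i)) ^ (j : ℕ) : Kˣ) : K) + ((((s ^ Vv t i (k i)) ^ (j : ℕ))⁻¹ : Kˣ) : K)))) := by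
      ext1 j i; simp
    rw [h3, ← RingHom.map_det, (hg k).1, monomial_eq_C_mul_X_pow, Finset.prod_pow_eq_pow_sum, map_mul]
    ring
  have h4 := h1.mul (Cg.refl N (PowerSeries.map φ (Bmat ℂ t).det))
  rw [← hm, mul_assoc] at h4
  have h5 := (cg_cancel (pow_ne_zero _ hD) h4).map ψ
  have hs : ∀ m : ℕ, Units.map (ψ : K →* ℂ) (s ^ m) = 1 := by
    intro m
    have : Units.map (ψ : K →* ℂ) s = 1 := by ext; simpa using hψ
    rw [map_pow, this, one_pow]
  have h6 : (PowerSeries.map ψ) ((PowerSeries.map φ) (Bmat ℂ t).det) = (Bmat ℂ t).det := by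
    ext n
    rw [PowerSeries.coeff_map, PowerSeries.coeff_map, ← RingHom.comp_apply, hφ, RingHom.id_apply]
  have p1 : P3 1 (-1 : ℂˣ) = Ep ℂ 1 ^ 2 * Eu ℂ 1 := by
    refine (hasIProd_P3 one_pos _).unique ?_
    convert ((hasIProd_Ep (K := ℂ) one_pos).pow 2).mul (hasIProd_Eu (K := ℂ) one_pos) using 2 with n
    simp only [inv_neg, inv_one, Units.val_neg, Units.val_one, map_neg, map_one]; ring
  have p2 : P3 2 (1 : ℂˣ) = Eu ℂ 2 ^ 3 := by
    refine (hasIProd_P3 two_pos _).unique ?_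
    convert ((hasIProd_Eu (K := ℂ) two_pos).pow 3) using 2 with n
    simp; ring
  have hn : ∀ u : Kˣ, Units.map (ψ : K →* ℂ) (-u) = - Units.map (ψ : K →* ℂ) u := by
    intro u; ext; simp
  rw [map_mul, map_mul, map_mul, map_prod, map_prod, PowerSeries.map_C, map_sum, h6] at h5
  simp only [map_P3 ψ one_pos, map_P3 ψ two_pos, map_prod, map_mul, map_div, map_inv, hs, hn, p1] at h5
  simp only [div_one, mul_one, inv_one, p2, prod_pairs_const] at h5
  have hmm : ∀ (n : ℕ) (a : K), PowerSeries.map ψ (PowerSeries.monomial n a) = PowerSeries.monomial n (ψ a) := by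
    intro n a; ext m; simp [coeff_monomial]; split_ifs <;> simp
  simp only [hmm, fun k => (hg k).2] at h5
  simpa using h5

end EvalTwoB

/-- the theta type series -/
def SS (t : ℕ) (w : (Fin t → ℤ) → ℂ) : PowerSeries ℂ := PowerSeries.mk fun n =>
  ∑ k ∈ Fintype.piFinset (fun _ : Fin t => Finset.Icc (-((n : ℤ) + 1)) (n + 1)), if ∑ i : Fin t, eF t i (k i) = n then w k else 0

theorem mem_box {t n L : ℕ} (hL : n + 1 ≤ L) (k : Fin t → ℤ) (h : ∑ i : Fin t, eF t i (k i) = n) :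
    k ∈ Fintype.piFinset (fun _ : Fin t => Finset.Icc (-(L : ℤ)) L) := by
  rw [Fintype.mem_piFinset]
  intro i
  have h1 := grow_eF t i i.2 (k i)
  have h2 : eF t i (k i) ≤ n := by
    rw [← h]; exact Finset.single_le_sum (f := fun i : Fin t => eF t i (k i)) (fun _ _ => Nat.zero_le _) (Finset.mem_univ i)
  rw [abs_le] at h1
  rw [Finset.mem_Icc]
  constructor <;> omega

theorem coeff_SS (t : ℕ) (w : (Fin t → ℤ) → ℂ) (n L : ℕ) (hL : n + 1 ≤ L) : coeff n (SS t w) =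
    ∑ k ∈ Fintype.piFinset (fun _ : Fin t => Finset.Icc (-(L : ℤ)) L), if ∑ i : Fin t, eF t i (k i) = n then w k else 0 := by
  rw [SS, coeff_mk]
  have := @mem_box t n (n + 1) le_rfl
  push_cast at this
  refine Finset.sum_subset ?_ ?_
  · apply Fintype.piFinset_subset
    intro _ x hx
    rw [Finset.mem_Icc] at *
    constructor <;> omega
  · intro k _ hk
    rw [if_neg]
    intro h
    exact hk (this k h)

theorem cg_SS (t : ℕ) (w : (Fin t → ℤ) → ℂ) (N L : ℕ) (hL : N ≤ L) : Cg N (SS t w)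
    (∑ k ∈ Fintype.piFinset (fun _ : Fin t => Finset.Icc (-(L : ℤ)) L),
        PowerSeries.monomial (∑ i : Fin t, eF t i (k i)) (w k)) := by
  rw [cg_iff]
  intro n hn
  rw [coeff_SS t w n L (by omega), map_sum]
  refine Finset.sum_congr rfl fun k _ => ?_
  rw [coeff_monomial]
  simp [eq_comm]

theorem SS_const_mul (t : ℕ) (w : (Fin t → ℤ) → ℂ) (c : ℂ) : SS t (fun k => c * w k) = PowerSeries.C c * SS t w := by
  ext n
  simp [SS, Finset.mul_sum]

/-- Vandermonde weight -/
def Wt (t : ℕ) (k : Fin t → ℤ) : ℂ :=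
  ∏ i : Fin t, ∏ j ∈ Finset.Ioi i, ((Vv t j (k j) : ℂ) ^ 2 - (Vv t i (k i) : ℂ) ^ 2)

theorem eval_two (t : ℕ) (ht : 0 < t) : ∃ c1 c2 : ℂ, c2 ≠ 0 ∧
    PowerSeries.C c1 * ((Ep ℂ 1 ^ 2 * Eu ℂ 1) ^ t * (Eu ℂ 2 ^ 3) ^ (t * (t - 1))) =
    PowerSeries.C c2 * SS t (Wt t) * (Bmat ℂ t).det := by
  let s : (LaurentPolynomial ℂ)ˣ := ⟨LaurentPolynomial.T 1, LaurentPolynomial.T (-1),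
    by rw [← LaurentPolynomial.T_add]; simp, by rw [← LaurentPolynomial.T_add]; simp⟩
  let ψ : LaurentPolynomial ℂ →+* ℂ := LaurentPolynomial.eval₂ (RingHom.id ℂ) 1
  have hψ : ψ (s : LaurentPolynomial ℂ) = 1 := by
    change LaurentPolynomial.eval₂ (RingHom.id ℂ) 1 (LaurentPolynomial.T 1) = 1
    simp
  have hD : (s : LaurentPolynomial ℂ) - ((s⁻¹ : (LaurentPolynomial ℂ)ˣ) : LaurentPolynomial ℂ) ≠ 0 := by
    intro h
    have h1 : (LaurentPolynomial.T 1 : LaurentPolynomial ℂ) = LaurentPolynomial.T (-1) := sub_eq_zero.1 h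
    have h2 := congrArg (LaurentPolynomial.eval₂ (RingHom.id ℂ) (Units.mk0 (2 : ℂ) two_ne_zero)) h1
    norm_num at h2
  obtain ⟨c1, h1⟩ := eval_two_aux s ψ hψ hD LaurentPolynomial.C (by ext; simp [ψ]) t ht
  refine ⟨c1, (∏ j : Fin t, kap ℂ j) * (1 / 2) ^ (t * (t - 1)), ?_, ?_⟩
  rotate_left
  · rw [← SS_const_mul]
    apply eq_of_cg
    intro M
    exact (h1 M M le_rfl).trans ((cg_SS t _ M M le_rfl).symm.mul (Cg.refl _ _))
  · refine mul_ne_zero (Finset.prod_ne_zero_iff.2 fun j _ => ?_) (pow_ne_zero _ (by norm_num))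
    unfold kap; split_ifs <;> simp

/-- Main analytic identity -/
theorem main_series (t : ℕ) (ht : 0 < t) :
    Eu ℂ 1 ^ (2 * t - 1) * SS t (Wt t) = PowerSeries.C (Wt t 0) * Eu ℂ 2 ^ ((t + 1) * (2 * t - 1)) := by
  obtain ⟨c, c3, hc, h1⟩ := eval_one t ht
  obtain ⟨c1, c2, hc2, h2⟩ := eval_two t ht
  have hEp : Eu ℂ 1 * Ep ℂ 1 = Eu ℂ 2 := by
    have := (hasIProd_Eu (K := ℂ) one_pos).mul (hasIProd_Ep (K := ℂ) one_pos)
    refine this.unique ?_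
    convert hasIProd_Eu (K := ℂ) two_pos using 2 with n
    ring
  have key : PowerSeries.C (c * c2) * (Eu ℂ 1 ^ (2 * t - 1) * SS t (Wt t)) = PowerSeries.C (c1 * c3) * Eu ℂ 2 ^ ((t + 1) * (2 * t - 1)) := by
    have ha := Eu_ne_zero (K := ℂ) one_pos
    have hb := Eu_ne_zero (K := ℂ) two_pos
    apply mul_left_cancel₀ (mul_ne_zero (pow_ne_zero t ha) (pow_ne_zero (t * (t - 1)) hb))
    obtain ⟨m, rfl⟩ := Nat.exists_eq_succ_of_ne_zero ht.ne'
    have e1 : 2 * (m + 1) - 1 = 2 * m + 1 := by omega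
    simp only [Nat.succ_eq_add_one, Nat.add_sub_cancel, e1, map_mul] at *
    rw [← hEp] at *
    generalize Eu ℂ 1 = a at *
    generalize Ep ℂ 1 = b at *
    linear_combination (exp := 1) PowerSeries.C c2 * a ^ (2 * m + 1) * SS (m + 1) (Wt (m + 1)) * h1 - PowerSeries.C c3 * a ^ (2 * m + 1) * a * (a * b) ^ m * h2
  have h0 : constantCoeff (SS t (Wt t)) = Wt t 0 := by
    rw [← coeff_zero_eq_constantCoeff_apply, coeff_SS t _ 0 1 (by omega)]
    rw [Finset.sum_eq_single 0]
    · rw [if_pos]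
      refine Finset.sum_eq_zero fun i _ => ?_
      have := eF_cast t i i.2 0
      simp at this ⊢
      exact this
    · intro k _ hk
      rw [if_neg]
      intro h
      apply hk
      funext i
      rw [Finset.sum_eq_zero_iff] at h
      have h3 := h i (Finset.mem_univ i)
      have h4 := eF_cast t i i.2 (k i)
      rw [h3] at h4
      by_contra h5
      rw [Pi.zero_apply] at h5
      have hi : ((i : ℕ) : ℤ) < t := by exact_mod_cast i.2
      have h6 : k i * (2 * t * k i + (2 * i + 1)) = 0 := by push_cast at h4; linear_combination -h4
      rcases mul_eq_zero.1 h6 with h7 | h7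
      · exact h5 h7
      · have : k i < 0 := by
          by_contra h8
          have := mul_nonneg (by positivity : (0 : ℤ) ≤ 2 * t) (not_lt.1 h8)
          omega
        nlinarith
    · intro h
      exact absurd (Fintype.mem_piFinset.2 fun i => by simp) h
  have h3 := congrArg constantCoeff key
  simp only [map_mul, map_pow, h0, constantCoeff_Eu one_pos, constantCoeff_Eu two_pos, one_pow, one_mul, mul_one, constantCoeff_C] at h3
  have hne : PowerSeries.C (c * c2) ≠ 0 := by
    intro h
    apply mul_ne_zero hc hc2
    apply PowerSeries.C_injective
    rw [h, map_zero]
  apply mul_left_cancel₀ hne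
  rw [key, ← mul_assoc, ← map_mul, h3]

end NOC




namespace NOC

section Cores

variable {t : ℕ}

/-- signed entries -/
def xx (k : Fin t → ℤ) (p : Fin t × ℤˣ) : ℤ := (p.2 : ℤ) * Vv t p.1 (k p.1)

theorem cls_unique (k : Fin t → ℤ) (p p' : Fin t × ℤˣ) (q : ℤ) (h : xx k p = xx k p' + 4 * t * q) : p = p' := by
  obtain ⟨i, e⟩ := p
  obtain ⟨j, e'⟩ := p'
  have hi := i.2
  have hj := j.2
  simp only [xx, Vv] at h
  have key : ∀ (c : ℤ) (r : ℤ), c = 4 * (t : ℤ) * r → |c| < 4 * t → c = 0 := by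
    intro c r h1 h2
    have : r = 0 := by
      by_contra hr
      have h3 : 1 ≤ |r| := Int.one_le_abs hr
      rw [h1, abs_mul] at h2
      have h4 : |4 * (t : ℤ)| = 4 * t := abs_of_nonneg (by positivity)
      rw [h4] at h2
      nlinarith [abs_nonneg r]
    simp [h1, this]
  rcases Int.units_eq_one_or e with rfl | rfl <;> rcases Int.units_eq_one_or e' with rfl | rfl <;>
    simp only [Units.val_one, Units.val_neg, one_mul, neg_mul] at h
  · have := key (2 * (i : ℤ) - 2 * j) (k j + q - k i) (by linear_combination h) (by rw [abs_lt]; constructor <;> omega)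
    have : i = j := by ext; omega
    rw [this]
  · have := key (2 * (i : ℤ) + 2 * j + 2) (- k j + q - k i) (by linear_combination h) (by rw [abs_lt]; constructor <;> omega)
    omega
  · have := key (2 * (i : ℤ) + 2 * j + 2) (- k j - q - k i) (by linear_combination -h) (by rw [abs_lt]; constructor <;> omega)
    omega
  · have := key (2 * (i : ℤ) - 2 * j) (k j - q - k i) (by linear_combination -h) (by rw [abs_lt]; constructor <;> omega)
    have : i = j := by ext; omega
    rw [this]

theorem cls_exists (ht : 0 < t) (k : Fin t → ℤ) (n : ℤ) : ∃ (p : Fin t × ℤˣ) (q : ℤ), xx k p = 2 * n + 1 + 4 * t * q := by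
  have h1 := Int.emod_add_mul_ediv n (2 * t)
  have h2 := Int.emod_nonneg n (b := 2 * t) (by omega)
  have h3 := Int.emod_lt_of_pos n (b := 2 * t) (by omega)
  generalize n % (2 * t) = r at *
  generalize n / (2 * t) = d at *
  by_cases h : r < t
  · refine ⟨(⟨r.toNat, by omega⟩, 1), k ⟨r.toNat, by omega⟩ - d, ?_⟩
    simp only [xx, Vv, Units.val_one, one_mul]
    rw [Int.toNat_of_nonneg h2]
    linear_combination 2 * h1
  · refine ⟨(⟨(2 * t - 1 - r).toNat, by omega⟩, -1), -k ⟨(2 * t - 1 - r).toNat, by omega⟩ - d - 1, ?_⟩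
    simp only [xx, Vv, Units.val_neg, Units.val_one, neg_mul, one_mul]
    rw [Int.toNat_of_nonneg (by omega)]
    linear_combination 2 * h1

theorem xx_neg (k : Fin t → ℤ) (i : Fin t) (e : ℤˣ) : xx k (i, -e) = - xx k (i, e) := by
  simp [xx]

/-- membership in the (infinite) bead set -/
def Rep (k : Fin t → ℤ) (n : ℤ) : Prop := ∃ (p : Fin t × ℤˣ) (q : ℕ), xx k p = 2 * n + 1 + 2 * t + 4 * t * q

theorem rep_of_class (k : Fin t → ℤ) {n : ℤ} {p : Fin t × ℤˣ} {q : ℤ} (h : xx k p = 2 * n + 1 + 2 * t + 4 * t * q) :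
    Rep k n ↔ 0 ≤ q := by
  constructor
  · rintro ⟨p', q', h'⟩
    have : p = p' := cls_unique k p p' (q - q') (by rw [h, h']; ring)
    subst this
    by_contra hq
    have h2 : 4 * (t : ℤ) * (q' - q) = 0 := by linear_combination h - h'
    have hp := p.1.2
    rcases mul_eq_zero.1 h2 with h3 | h3 <;> omega
  · intro hq
    exact ⟨p, q.toNat, by rw [h, Int.toNat_of_nonneg hq]⟩

theorem rep_class_exists (ht : 0 < t) (k : Fin t → ℤ) (n : ℤ) : ∃ (p : Fin t × ℤˣ) (q : ℤ), xx k p = 2 * n + 1 + 2 * t + 4 * t * q := by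
  obtain ⟨p, q, h⟩ := cls_exists ht k (n + t)
  exact ⟨p, q, by rw [h]; ring⟩

theorem rep_symm (ht : 0 < t) (k : Fin t → ℤ) (n : ℤ) : Rep k (-1 - n) ↔ ¬ Rep k n := by
  obtain ⟨⟨i, e⟩, q, h⟩ := rep_class_exists ht k n
  rw [rep_of_class k h]
  have h2 : xx k (i, -e) = 2 * (-1 - n) + 1 + 2 * t + 4 * t * (- q - 1) := by
    rw [xx_neg, h]; ring
  rw [rep_of_class k h2]
  omega

/-- move one bead -/
def mv (k : Fin t → ℤ) (p : Fin t × ℤˣ) : Fin t → ℤ := Function.update k p.1 (k p.1 + p.2)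

theorem xx_mv_self (k : Fin t → ℤ) (p : Fin t × ℤˣ) : xx (mv k p) p = xx k p + 4 * t := by
  obtain ⟨i, e⟩ := p
  have h : (e : ℤ) * e = 1 := by rcases Int.units_eq_one_or e with rfl | rfl <;> simp
  simp only [xx, mv, Function.update_self, Vv]
  linear_combination 4 * t * h

theorem xx_mv_neg (k : Fin t → ℤ) (p : Fin t × ℤˣ) : xx (mv k p) (p.1, -p.2) = - (xx k p + 4 * t) := by
  rw [xx_neg, xx_mv_self]

theorem xx_mv_ne (k : Fin t → ℤ) (p p' : Fin t × ℤˣ) (h : p'.1 ≠ p.1) : xx (mv k p) p' = xx k p' := by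
  simp [xx, mv, Function.update_of_ne h]

theorem cases_p (p p' : Fin t × ℤˣ) : p' = p ∨ p' = (p.1, -p.2) ∨ p'.1 ≠ p.1 := by
  obtain ⟨i, e⟩ := p
  obtain ⟨j, e'⟩ := p'
  by_cases h : j = i
  · subst h
    rcases Int.units_eq_one_or e with rfl | rfl <;> rcases Int.units_eq_one_or e' with rfl | rfl <;> simp
  · right; right; exact h

theorem rep_mv (k : Fin t → ℤ) (p : Fin t × ℤˣ) (a : ℕ) (h : xx k p = 2 * a + 1 - 2 * t) (n : ℕ) :
    Rep (mv k p) n ↔ Rep k n ∨ n = a := by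
  constructor
  · rintro ⟨p', q, h1⟩
    rcases cases_p p p' with rfl | rfl | h2
    · rw [xx_mv_self, h] at h1
      rcases Nat.eq_zero_or_pos q with rfl | hq
      · right; push_cast at h1; omega
      · left
        refine ⟨p', q - 1, ?_⟩
        rw [h]; push_cast [Nat.cast_sub hq]; linear_combination h1
    · rw [xx_mv_neg, h] at h1
      have : (0 : ℤ) ≤ 4 * t * q := by positivity
      omega
    · rw [xx_mv_ne _ _ _ h2] at h1
      exact Or.inl ⟨p', q, h1⟩
  · rintro (⟨p', q, h1⟩ | rfl)
    · rcases cases_p p p' with rfl | rfl | h2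
      · refine ⟨p', q + 1, ?_⟩
        rw [xx_mv_self, h1]; push_cast; ring
      · rw [xx_neg, Prod.mk.eta, h] at h1
        have : (0 : ℤ) ≤ 4 * t * q := by positivity
        omega
      · exact ⟨p', q, by rw [xx_mv_ne _ _ _ h2, h1]⟩
    · exact ⟨p, 0, by rw [xx_mv_self, h]; push_cast; ring⟩

/-- the relation between finite sets and vectors -/
def RA (A : Finset ℕ) (k : Fin t → ℤ) : Prop := ∀ a : ℕ, a ∈ A ↔ Rep k a

theorem RA_exists (k : Fin t → ℤ) : ∃ A, RA A k := by
  classical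
  have : {a : ℕ | Rep k a}.Finite := by
    refine (Finset.finite_toSet (Finset.range (∑ p : Fin t × ℤˣ, (xx k p).natAbs + 1))).subset ?_
    rintro a ⟨p, q, h⟩
    have h1 : (xx k p).natAbs ≤ ∑ p : Fin t × ℤˣ, (xx k p).natAbs :=
      Finset.single_le_sum (f := fun p : Fin t × ℤˣ => (xx k p).natAbs) (fun _ _ => Nat.zero_le _) (Finset.mem_univ p)
    have : (0 : ℤ) ≤ 4 * t * q := by positivity
    simp only [Finset.coe_range, Set.mem_Iio]
    omega
  exact ⟨this.toFinset, fun a => by simp⟩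

theorem RA_unique {A B : Finset ℕ} {k : Fin t → ℤ} (h : RA A k) (h' : RA B k) : A = B := by
  ext a; rw [h a, h' a]

theorem RA_le {A : Finset ℕ} {k k' : Fin t → ℤ} (ht : 0 < t) (h : RA A k) (h' : RA A k') (i : Fin t) : k' i ≤ k i := by
  by_contra hlt
  push Not at hlt
  have key : ∀ n : ℤ, Rep k n ↔ Rep k' n := by
    intro n
    rcases le_or_gt 0 n with hn | hn
    · obtain ⟨m, rfl⟩ := Int.eq_ofNat_of_zero_le hn
      exact (h m).symm.trans (h' m)
    · obtain ⟨m, hm⟩ := Int.eq_ofNat_of_zero_le (show 0 ≤ -1 - n by omega)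
      have e : n = -1 - (m : ℤ) := by omega
      rw [e, rep_symm ht, rep_symm ht, ← h, ← h']
  have e1 : xx k' (i, 1) = 2 * (i - t + 2 * t * k' i) + 1 + 2 * t + 4 * t * (0 : ℤ) := by
    simp [xx, Vv]; ring
  have e2 : xx k (i, 1) = 2 * (i - t + 2 * t * k' i) + 1 + 2 * t + 4 * t * (k i - k' i) := by
    simp [xx, Vv]; ring
  have := (key _).2 ((rep_of_class k' e1).2 le_rfl)
  rw [rep_of_class k e2] at this
  omega

theorem RA_inj {A : Finset ℕ} {k k' : Fin t → ℤ} (ht : 0 < t) (h : RA A k) (h' : RA A k') : k = k' :=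
  funext fun i => le_antisymm (RA_le ht h' h i) (RA_le ht h h' i)

theorem RA_zero (ht : 0 < t) : RA ∅ (0 : Fin t → ℤ) := by
  intro a
  simp only [Finset.notMem_empty, false_iff]
  rintro ⟨⟨i, e⟩, q, h⟩
  have hi := i.2
  have : (0 : ℤ) ≤ 4 * t * q := by positivity
  rcases Int.units_eq_one_or e with rfl | rfl <;> simp [xx, Vv] at h <;> omega

theorem RA_up {s : Finset ℕ} {k : Fin t → ℤ} (h : RA s k) (p : Fin t × ℤˣ) (a : ℕ) (hp : xx k p = 2 * a + 1 - 2 * t) :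
    RA (insert a s) (mv k p) := by
  intro n
  rw [rep_mv k p a hp, ← h n, Finset.mem_insert, or_comm]

theorem RA_down {s : Finset ℕ} {a : ℕ} {k : Fin t → ℤ} (hmax : ∀ x ∈ s, x < a) (h : RA (insert a s) k) :
    ∃ (k' : Fin t → ℤ) (p : Fin t × ℤˣ), xx k' p = 2 * a + 1 - 2 * t ∧ mv k' p = k ∧ RA s k' := by
  obtain ⟨p, q, hq⟩ := (h a).1 (Finset.mem_insert_self a s)
  have ht := p.1.2
  have hq0 : q = 0 := by
    by_contra hne
    have h1 : Rep k ((a + 2 * t * q : ℕ) : ℤ) := ⟨p, 0, by rw [hq]; push_cast; ring⟩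
    have h2 := (h _).2 h1
    have h3 : 0 < 2 * t * q := Nat.mul_pos (Nat.mul_pos two_pos (by omega)) (Nat.pos_of_ne_zero hne)
    rw [Finset.mem_insert] at h2
    rcases h2 with h2 | h2
    · omega
    · have := hmax _ h2; omega
  subst hq0
  have hmv : mv (Function.update k p.1 (k p.1 - p.2)) p = k := by
    funext j
    by_cases hj : j = p.1
    · subst hj; simp [mv]
    · simp [mv, Function.update_of_ne hj]
  have hx : xx (Function.update k p.1 (k p.1 - p.2)) p = 2 * a + 1 - 2 * t := by
    have := xx_mv_self (Function.update k p.1 (k p.1 - p.2)) p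
    rw [hmv, hq] at this
    push_cast at this
    linear_combination -this
  refine ⟨_, p, hx, hmv, ?_⟩
  intro n
  have h1 := rep_mv _ p a hx n
  rw [hmv, ← h n, Finset.mem_insert] at h1
  by_cases hn : n = a
  · subst hn
    constructor
    · intro h2; exact absurd (hmax _ h2) (lt_irrefl _)
    · intro h2
      have e : xx (Function.update k p.1 (k p.1 - p.2)) p = 2 * n + 1 + 2 * t + 4 * t * (-1) := by rw [hx]; ring
      rw [rep_of_class _ e] at h2
      omega
  · simpa [hn] using h1

theorem RA_empty {k : Fin t → ℤ} (ht : 0 < t) (h : RA ∅ k) : k = 0 := RA_inj ht h (RA_zero ht)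

theorem RA_size {A : Finset ℕ} (ht : 0 < t) : ∀ k : Fin t → ℤ, RA A k →
    ∑ a ∈ A, (2 * a + 1) = ∑ i : Fin t, eF t i (k i) := by
  induction A using Finset.induction_on_max with
  | empty =>
    intro k h
    rw [RA_empty ht h]
    simp [eF]
  | insert a s hmax ih =>
    intro k h
    obtain ⟨k', p, hx, rfl, h'⟩ := RA_down hmax h
    rw [Finset.sum_insert (fun h => lt_irrefl _ (hmax _ h)), ih k' h']
    rw [← Finset.add_sum_erase _ (fun i : Fin t => eF t i (k' i)) (Finset.mem_univ p.1), ← Finset.add_sum_erase _ (fun i : Fin t => eF t i (mv k' p i)) (Finset.mem_univ p.1)]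
    have e1 : ∑ i ∈ Finset.univ.erase p.1, eF t i (mv k' p i) = ∑ i ∈ Finset.univ.erase p.1, eF t i (k' i) := by
      refine Finset.sum_congr rfl fun i hi => ?_
      rw [mv, Function.update_of_ne (Finset.ne_of_mem_erase hi)]
    rw [e1, ← add_assoc]
    congr 1
    zify
    rw [eF_cast t _ p.1.2, eF_cast t _ p.1.2]
    obtain ⟨i, e⟩ := p
    have he : (e : ℤ) * e = 1 := by rcases Int.units_eq_one_or e with rfl | rfl <;> simp
    simp only [xx, Vv] at hx
    simp only [mv, Function.update_self]
    linear_combination -hx - 2 * t * he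

end Cores

end NOC




namespace NOC

section Weights

variable {t : ℕ}

/-- hook between two principal arms -/
def Hs (s : Finset ℕ) (a b : ℕ) : ℕ := if b ∈ s then a + b + 1 else a - b

theorem rep_gt {s : Finset ℕ} {a : ℕ} {k : Fin t → ℤ} (hmax : ∀ x ∈ s, x < a) (h : RA s k) {n : ℤ} (hn : (a : ℤ) ≤ n) :
    ¬ Rep k n := by
  obtain ⟨m, rfl⟩ := Int.eq_ofNat_of_zero_le (show 0 ≤ n by omega)
  intro h1
  have := hmax _ ((h m).2 h1)
  omega

open Classical in
theorem prod_Hs {s : Finset ℕ} {a : ℕ} {k : Fin t → ℤ} (ht : 0 < t) (hmax : ∀ x ∈ s, x < a) (h : RA s k) (f : ℕ → ℚ) :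
    ∏ b ∈ Finset.range a, f (Hs s a b) = ∏ x ∈ (Finset.Icc 1 (2 * a)).filter (fun x : ℕ => ¬ Rep k ((a : ℤ) - x)), f x := by
  refine Finset.prod_bij (fun b _ => Hs s a b) ?_ ?_ ?_ (fun _ _ => rfl)
  · intro b hb
    rw [Finset.mem_range] at hb
    rw [Finset.mem_filter, Finset.mem_Icc]
    unfold Hs
    split_ifs with hbs
    · refine ⟨by omega, ?_⟩
      have e : (a : ℤ) - ((a + b + 1 : ℕ) : ℤ) = -1 - (b : ℤ) := by push_cast; ring
      rw [e, rep_symm ht, not_not]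
      exact (h b).1 hbs
    · refine ⟨by omega, ?_⟩
      have e : (a : ℤ) - ((a - b : ℕ) : ℤ) = (b : ℤ) := by omega
      rw [e, ← h b]
      exact hbs
  · intro b hb c hc hbc
    rw [Finset.mem_range] at hb hc
    simp only [Hs] at hbc
    split_ifs at hbc <;> omega
  · intro x hx
    rw [Finset.mem_filter, Finset.mem_Icc] at hx
    obtain ⟨⟨h1, h2⟩, h3⟩ := hx
    by_cases hxa : x ≤ a
    · refine ⟨a - x, by rw [Finset.mem_range]; omega, ?_⟩
      have : a - x ∉ s := by
        rw [h]
        rwa [show ((a - x : ℕ) : ℤ) = (a : ℤ) - x by omega]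
      simp only [Hs, this, if_false]; omega
    · refine ⟨x - a - 1, by rw [Finset.mem_range]; omega, ?_⟩
      have : x - a - 1 ∈ s := by
        rw [h]
        by_contra h4
        rw [← rep_symm ht] at h4
        apply h3
        rwa [show -1 - ((x - a - 1 : ℕ) : ℤ) = (a : ℤ) - x by omega] at h4
      simp only [Hs, this, if_true]; omega

theorem telesc (T r : ℚ) (hr : ∀ m : ℤ, r + T * m ≠ 0) (m : ℕ) :
    ∏ q ∈ Finset.range m, (1 - T ^ 2 / (r + T * q) ^ 2) = ((r - T) / r) * ((r + T * m) / (r + T * m - T)) := by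
  have h0 := hr 0
  have h1 := hr (-1)
  push_cast at h0 h1
  have h0' : r ≠ 0 := by simpa using h0
  have h1' : r - T ≠ 0 := by intro h; apply h1; linear_combination h
  induction m with
  | zero => simp; field_simp
  | succ m ih =>
    rw [Finset.prod_range_succ, ih]
    have h2 := hr m
    have h3 : r + T * m - T ≠ 0 := by
      have := hr (m - 1); push_cast at this; intro h; apply this; linear_combination h
    push_cast at h2 ⊢
    have h4 : r + T * (m + 1) - T ≠ 0 := by intro h; apply h2; linear_combination h
    have h5 : r + T * (m + 1) - T = r + T * m := by ring
    rw [h5]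
    field_simp
    ring

theorem uu_exists {s : Finset ℕ} {a : ℕ} {k : Fin t → ℤ} (hmax : ∀ x ∈ s, x < a) (h : RA s k)
    (p : Fin t × ℤˣ) (hp : xx k p = 2 * a + 1 - 2 * t) (i : Fin t × ℤˣ) :
    ∃ r m : ℕ, xx k i = 2 * (a - (r + 2 * t * m : ℕ)) + 1 + 2 * t ∧ r < 2 * t ∧ (i ≠ p → 1 ≤ r) := by
  have ht := p.1.2
  obtain ⟨u, hu⟩ : ∃ u : ℤ, xx k i = 2 * (a - u) + 1 + 2 * t := by
    obtain ⟨j, e⟩ := i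
    rcases Int.units_eq_one_or e with rfl | rfl
    · refine ⟨a + t - j - 2 * t * k j, ?_⟩
      simp [xx, Vv]; ring
    · refine ⟨a + t + 1 + j + 2 * t * k j, ?_⟩
      simp [xx, Vv]; ring
  have hu0 : 0 ≤ u := by
    by_contra hlt
    exact rep_gt hmax h (n := a - u) (by omega) ⟨i, 0, by rw [hu]; push_cast; ring⟩
  obtain ⟨w, rfl⟩ := Int.eq_ofNat_of_zero_le hu0
  refine ⟨w % (2 * t), w / (2 * t), ?_, Nat.mod_lt _ (by omega), ?_⟩
  · rw [Nat.mod_add_div, hu]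
  · intro hne
    by_contra h0
    apply hne
    have h1 : w % (2 * t) = 0 := by omega
    have h2 := Nat.mod_add_div w (2 * t)
    rw [h1] at h2
    refine cls_unique k i p (1 - (w / (2 * t) : ℕ)) ?_
    rw [hu, hp]
    have h3 : (w : ℤ) = 2 * t * (w / (2 * t) : ℕ) := by exact_mod_cast (by omega : w = 2 * t * (w / (2 * t)))
    generalize ((w / (2 * t) : ℕ) : ℤ) = d at *
    rw [h3]; ring

theorem prod_frac (t : ℕ) (ht : 0 < t) : ∏ r ∈ Finset.Icc 1 (2 * t - 1), (((r : ℚ) - 2 * t) / r) = -1 := by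
  rw [Finset.prod_div_distrib]
  have h1 : ∏ r ∈ Finset.Icc 1 (2 * t - 1), ((r : ℚ) - 2 * t) = ∏ r ∈ Finset.Icc 1 (2 * t - 1), (-(r : ℚ)) := by
    refine Finset.prod_bij' (fun r _ => 2 * t - r) (fun r _ => 2 * t - r) ?_ ?_ ?_ ?_ ?_
    · intro r hr; rw [Finset.mem_Icc] at *; omega
    · intro r hr; rw [Finset.mem_Icc] at *; omega
    · intro r hr; rw [Finset.mem_Icc] at hr; omega
    · intro r hr; rw [Finset.mem_Icc] at hr; omega
    · intro r hr
      rw [Finset.mem_Icc] at hr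
      rw [Nat.cast_sub (by omega)]; push_cast; ring
  rw [h1, Finset.prod_neg]
  have h2 : ∏ r ∈ Finset.Icc 1 (2 * t - 1), (r : ℚ) ≠ 0 := by
    rw [Finset.prod_ne_zero_iff]
    intro r hr; rw [Finset.mem_Icc] at hr
    have : r ≠ 0 := by omega
    exact_mod_cast this
  rw [mul_div_assoc, div_self h2]
  simp only [Nat.card_Icc, Nat.add_sub_cancel, mul_one]
  exact Odd.neg_one_pow ⟨t - 1, by omega⟩

theorem G_eval {s : Finset ℕ} {a : ℕ} {k : Fin t → ℤ} (hmax : ∀ x ∈ s, x < a) (h : RA s k)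
    (p : Fin t × ℤˣ) (hp : xx k p = 2 * a + 1 - 2 * t) :
    ∏ b ∈ Finset.range a, (1 - (2 * t : ℚ) ^ 2 / (Hs s a b : ℚ) ^ 2) =
      - ∏ i ∈ Finset.univ.erase p, ((2 * a + 1 + 2 * t - xx k i : ℚ) / (2 * a + 1 - 2 * t - xx k i)) := by
  classical
  have ht : 0 < t := by have := p.1.2; omega
  choose r m hrm hr2 hr1 using uu_exists hmax h p hp
  rw [prod_Hs ht hmax h (fun x => 1 - (2 * t : ℚ) ^ 2 / (x : ℚ) ^ 2)]
  have hinj : ∀ i j (q q' : ℕ), r i + 2 * t * q = r j + 2 * t * q' → i = j := by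
    intro i j q q' e
    refine cls_unique k i j (q - m i - q' + m j) ?_
    rw [hrm i, hrm j]
    have e' : (r i : ℤ) + 2 * t * q = r j + 2 * t * q' := by exact_mod_cast e
    push_cast
    linear_combination -2 * e'
  have step1 : ∏ x ∈ (Finset.univ.erase p).sigma (fun i => Finset.range (m i)), (1 - (2 * t : ℚ) ^ 2 / ((r x.1 + 2 * t * x.2 : ℕ) : ℚ) ^ 2) =
      ∏ x ∈ (Finset.Icc 1 (2 * a)).filter (fun x : ℕ => ¬ Rep k ((a : ℤ) - x)), (1 - (2 * t : ℚ) ^ 2 / (x : ℚ) ^ 2) := by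
    refine Finset.prod_bij (fun x _ => r x.1 + 2 * t * x.2) ?_ ?_ ?_ (fun _ _ => rfl)
    · rintro ⟨i, q⟩ hx
      simp only [Finset.mem_sigma, Finset.mem_erase, Finset.mem_univ, and_true, Finset.mem_range] at hx
      obtain ⟨hi, hq⟩ := hx
      have hnr : ¬ Rep k ((a : ℤ) - (r i + 2 * t * q : ℕ)) := by
        rw [rep_of_class k (p := i) (q := q - m i) (by rw [hrm]; push_cast; ring)]
        omega
      rw [Finset.mem_filter, Finset.mem_Icc]
      have := hr1 i hi
      refine ⟨⟨?_, ?_⟩, hnr⟩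
      · exact le_trans this (Nat.le_add_right _ _)
      · by_contra hgt
        have h5 : -1 - ((a : ℤ) - (r i + 2 * t * q : ℕ)) ≥ a := by
          generalize r i + 2 * t * q = z at *
          omega
        have h6 := rep_gt hmax h h5
        rw [rep_symm ht] at h6
        exact h6 hnr
    · rintro ⟨i, q⟩ hx ⟨j, q'⟩ hx' e
      have e2 : r i + 2 * t * q = r j + 2 * t * q' := e
      have := hinj i j q q' e2
      subst this
      have : q = q' := Nat.eq_of_mul_eq_mul_left (show 0 < 2 * t by omega) (by omega)
      rw [this]
    · intro x hx
      rw [Finset.mem_filter, Finset.mem_Icc] at hx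
      obtain ⟨⟨h1, h2⟩, h3⟩ := hx
      obtain ⟨i, q, hq⟩ := rep_class_exists ht k ((a : ℤ) - x)
      rw [rep_of_class k hq] at h3
      push Not at h3
      have e : (x : ℤ) = r i + 2 * t * (q + m i) := by
        have := hrm i
        rw [hq] at this
        push_cast at this
        linarith
      have hi : i ≠ p := by
        rintro rfl
        rw [hq] at hp
        have h4 : (x : ℤ) = 2 * t * (1 + q) := by linarith
        have : (2 * t : ℤ) * (1 + q) ≤ 0 := mul_nonpos_of_nonneg_of_nonpos (by positivity) (by omega)
        omega
      have hqm : 0 ≤ q + m i := by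
        by_contra hlt
        have h5 : (2 * t : ℤ) * (q + m i) ≤ 2 * t * (-1) := by
          apply mul_le_mul_of_nonneg_left <;> omega
        have := hr2 i
        omega
      refine ⟨⟨i, (q + m i).toNat⟩, ?_, ?_⟩
      · simp only [Finset.mem_sigma, Finset.mem_erase, Finset.mem_univ, and_true, Finset.mem_range]
        exact ⟨hi, by omega⟩
      · zify
        rw [Int.toNat_of_nonneg hqm, e]
  rw [← step1, Finset.prod_sigma]
  have step2 : ∀ i ∈ Finset.univ.erase p, ∏ q ∈ Finset.range (m i), (1 - (2 * t : ℚ) ^ 2 / ((r i + 2 * t * q : ℕ) : ℚ) ^ 2) =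
      (((r i : ℚ) - 2 * t) / r i) * ((2 * a + 1 + 2 * t - xx k i : ℚ) / (2 * a + 1 - 2 * t - xx k i)) := by
    intro i hi
    have h1 := hr1 i (Finset.ne_of_mem_erase hi)
    have h2 := hr2 i
    have := telesc (2 * t : ℚ) (r i : ℚ) (by
      intro z hz
      have hz' : (r i : ℤ) + 2 * t * z = 0 := by exact_mod_cast hz
      have hd : (2 * t : ℤ) ∣ r i := ⟨-z, by linarith⟩
      have hd' : 2 * t ∣ r i := by exact_mod_cast hd
      exact absurd (Nat.le_of_dvd h1 hd') (by omega)) (m i)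
    push_cast
    rw [this]
    have e : (xx k i : ℚ) = 2 * (a - (r i + 2 * t * m i)) + 1 + 2 * t := by exact_mod_cast hrm i
    rw [e]
    congr 1
    rw [show (2 * a + 1 + 2 * t - (2 * (a - (r i + 2 * t * m i)) + 1 + 2 * t) : ℚ) = 2 * (r i + 2 * t * m i) by ring,
      show (2 * a + 1 - 2 * t - (2 * (a - (r i + 2 * t * m i)) + 1 + 2 * t) : ℚ) = 2 * (r i + 2 * t * m i - 2 * t) by ring,
      mul_div_mul_left _ _ two_ne_zero]
  rw [Finset.prod_congr rfl step2, Finset.prod_mul_distrib]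
  have step3 : ∏ i ∈ Finset.univ.erase p, (((r i : ℚ) - 2 * t) / r i) = -1 := by
    rw [← prod_frac t ht]
    have himg : (Finset.univ.erase p).image r = Finset.Icc 1 (2 * t - 1) := by
      apply Finset.eq_of_subset_of_card_le
      · intro x hx
        obtain ⟨i, hi, rfl⟩ := Finset.mem_image.1 hx
        have h1 := hr1 i (Finset.ne_of_mem_erase hi)
        have h2 := hr2 i
        rw [Finset.mem_Icc]; omega
      · rw [Finset.card_image_of_injective _ (fun i j e => hinj i j 0 0 (by simpa using e))]
        rw [Finset.card_erase_of_mem (Finset.mem_univ _), Finset.card_univ]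
        simp
        omega
    rw [← himg, Finset.prod_image (fun i _ j _ e => hinj i j 0 0 (by simpa using e))]
  rw [step3]
  ring

end Weights

end NOC




namespace NOC

section Weights2

variable {t : ℕ}

theorem G_eval2 {s : Finset ℕ} {a : ℕ} {k : Fin t → ℤ} (hmax : ∀ x ∈ s, x < a) (h : RA s k)
    (p : Fin t × ℤˣ) (hp : xx k p = 2 * a + 1 - 2 * t) :
    (1 - 2 * t / (2 * a + 1) : ℚ) * ∏ b ∈ Finset.range a, (1 - (2 * t : ℚ) ^ 2 / (Hs s a b : ℚ) ^ 2) =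
      - ∏ j ∈ Finset.univ.erase p.1, (((2 * a + 1 + 2 * t) ^ 2 - (Vv t j (k j) : ℚ) ^ 2) /
        ((2 * a + 1 - 2 * t) ^ 2 - (Vv t j (k j) : ℚ) ^ 2)) := by
  classical
  rw [G_eval hmax h p hp]
  have e1 : ∏ i ∈ Finset.univ.erase p, ((2 * a + 1 + 2 * t - xx k i : ℚ) / (2 * a + 1 - 2 * t - xx k i)) =
      ∏ i : Fin t × ℤˣ, (if i = p then 1 else ((2 * a + 1 + 2 * t - xx k i : ℚ) / (2 * a + 1 - 2 * t - xx k i))) := by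
    rw [← Finset.mul_prod_erase _ _ (Finset.mem_univ p), if_pos rfl, one_mul]
    refine Finset.prod_congr rfl fun i hi => ?_
    rw [if_neg (Finset.ne_of_mem_erase hi)]
  rw [e1, Fintype.prod_prod_type, ← Finset.mul_prod_erase _ _ (Finset.mem_univ p.1)]
  have hu : ∀ f : ℤˣ → ℚ, ∏ e : ℤˣ, f e = f 1 * f (-1) := by
    intro f
    rw [UnitsInt.univ, Finset.prod_insert (by decide), Finset.prod_singleton]
  have e2 : ∏ e : ℤˣ, (if (p.1, e) = p then 1 else ((2 * a + 1 + 2 * t - xx k (p.1, e) : ℚ) / (2 * a + 1 - 2 * t - xx k (p.1, e)))) =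
      (2 * a + 1) / (2 * a + 1 - 2 * t) := by
    obtain ⟨i, e⟩ := p
    have hc : ((2 * a + 1 + 2 * t - xx k (i, -e) : ℚ) / (2 * a + 1 - 2 * t - xx k (i, -e))) = (2 * a + 1) / (2 * a + 1 - 2 * t) := by
      rw [xx_neg, hp]
      push_cast
      rw [show (2 * a + 1 + 2 * t - -(2 * a + 1 - 2 * t) : ℚ) = 2 * (2 * a + 1) by ring,
        show (2 * a + 1 - 2 * t - -(2 * a + 1 - 2 * t) : ℚ) = 2 * (2 * a + 1 - 2 * t) by ring, mul_div_mul_left _ _ two_ne_zero]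
    rw [hu]
    rcases Int.units_eq_one_or e with rfl | rfl
    · rw [if_pos rfl, if_neg (by simp), one_mul]
      exact hc
    · rw [if_pos rfl, if_neg (by simp), mul_one]
      simpa using hc
  rw [e2]
  have e3 : ∏ j ∈ Finset.univ.erase p.1, ∏ e : ℤˣ, (if (j, e) = p then 1 else ((2 * a + 1 + 2 * t - xx k (j, e) : ℚ) / (2 * a + 1 - 2 * t - xx k (j, e)))) =
      ∏ j ∈ Finset.univ.erase p.1, (((2 * a + 1 + 2 * t) ^ 2 - (Vv t j (k j) : ℚ) ^ 2) /
        ((2 * a + 1 - 2 * t) ^ 2 - (Vv t j (k j) : ℚ) ^ 2)) := by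
    refine Finset.prod_congr rfl fun j hj => ?_
    have hj' := Finset.ne_of_mem_erase hj
    have : ∀ e : ℤˣ, (j, e) ≠ p := fun e he => hj' (by rw [← he])
    rw [hu, if_neg (this _), if_neg (this _), div_mul_div_comm]
    simp only [xx, Units.val_one, Units.val_neg, one_mul, neg_mul]
    push_cast
    congr 1 <;> ring
  rw [e3]
  have h1 : (2 * a + 1 : ℚ) ≠ 0 := by positivity
  have h2 : (2 * a + 1 - 2 * t : ℚ) ≠ 0 := by
    have : (2 * a + 1 - 2 * t : ℤ) ≠ 0 := by omega
    exact_mod_cast this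
  field_simp

/-- rational Vandermonde product -/
def vand (y : Fin t → ℚ) : ℚ := ∏ i : Fin t, ∏ j ∈ Finset.Ioi i, (y j - y i)

theorem vand_update_one (y : Fin t → ℚ) (i0 : Fin t) (c : ℚ) : ∃ K sg : ℚ, ∀ c, vand (Function.update y i0 c) = K * sg * ∏ j ∈ Finset.univ.erase i0, (c - y j) := by
  classical
  refine ⟨∏ i ∈ Finset.univ.erase i0, ∏ j ∈ (Finset.Ioi i).erase i0, (y j - y i), ∏ j ∈ Finset.Ioi i0, (-1), fun c => ?_⟩
  unfold vand
  rw [← Finset.mul_prod_erase _ _ (Finset.mem_univ i0)]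
  have e1 : ∏ j ∈ Finset.Ioi i0, (Function.update y i0 c j - Function.update y i0 c i0) = (∏ j ∈ Finset.Ioi i0, (-1)) * ∏ j ∈ Finset.Ioi i0, (c - y j) := by
    rw [← Finset.prod_mul_distrib]
    refine Finset.prod_congr rfl fun j hj => ?_
    rw [Finset.mem_Ioi] at hj
    rw [Function.update_self, Function.update_of_ne hj.ne']; ring
  have e2 : ∀ i ∈ Finset.univ.erase i0, ∏ j ∈ Finset.Ioi i, (Function.update y i0 c j - Function.update y i0 c i) =
      (if i < i0 then c - y i else 1) * ∏ j ∈ (Finset.Ioi i).erase i0, (y j - y i) := by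
    intro i hi
    have hi' := Finset.ne_of_mem_erase hi
    have e3 : ∏ j ∈ (Finset.Ioi i).erase i0, (Function.update y i0 c j - Function.update y i0 c i) = ∏ j ∈ (Finset.Ioi i).erase i0, (y j - y i) := by
      refine Finset.prod_congr rfl fun j hj => ?_
      rw [Function.update_of_ne (Finset.ne_of_mem_erase hj), Function.update_of_ne hi']
    by_cases hlt : i < i0
    · rw [← Finset.mul_prod_erase _ _ (Finset.mem_Ioi.2 hlt), e3, if_pos hlt, Function.update_self, Function.update_of_ne hi']
    · rw [if_neg hlt, one_mul, ← e3, Finset.erase_eq_of_notMem (by simpa using hlt)]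
  rw [e1, Finset.prod_congr rfl e2, Finset.prod_mul_distrib]
  have e4 : ∏ i ∈ Finset.univ.erase i0, (if i < i0 then c - y i else 1) = ∏ i ∈ Finset.Iio i0, (c - y i) := by
    rw [← Finset.prod_filter]
    refine Finset.prod_congr ?_ fun _ _ => rfl
    ext i
    simp only [Finset.mem_filter, Finset.mem_erase, Finset.mem_univ, and_true, Finset.mem_Iio]
    exact ⟨fun h => h.2, fun h => ⟨h.ne, h⟩⟩
  have e5 : ∏ j ∈ Finset.univ.erase i0, (c - y j) = (∏ i ∈ Finset.Iio i0, (c - y i)) * ∏ j ∈ Finset.Ioi i0, (c - y j) := by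
    rw [← Finset.prod_union]
    · refine Finset.prod_congr ?_ fun _ _ => rfl
      ext i
      simp only [Finset.mem_union, Finset.mem_erase, Finset.mem_univ, and_true, Finset.mem_Iio, Finset.mem_Ioi]
      exact ne_iff_lt_or_gt
    · rw [Finset.disjoint_left]
      intro i h1 h2
      rw [Finset.mem_Iio] at h1
      rw [Finset.mem_Ioi] at h2
      exact lt_asymm h1 h2
  rw [e4, e5]
  ring

theorem vand_update (y : Fin t → ℚ) (i0 : Fin t) (c c' : ℚ) (h : ∀ j, j ≠ i0 → c' - y j ≠ 0) :
    vand (Function.update y i0 c) = vand (Function.update y i0 c') * ∏ j ∈ Finset.univ.erase i0, ((c - y j) / (c' - y j)) := by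
  obtain ⟨K, sg, hK⟩ := vand_update_one y i0 c
  rw [hK c, hK c', Finset.prod_div_distrib]
  have : ∏ j ∈ Finset.univ.erase i0, (c' - y j) ≠ 0 := by
    rw [Finset.prod_ne_zero_iff]
    exact fun j hj => h j (Finset.ne_of_mem_erase hj)
  field_simp

/-- rational weight -/
def WQ (k : Fin t → ℤ) : ℚ := vand (fun i => (Vv t i (k i) : ℚ) ^ 2)

theorem WQ_cast (k : Fin t → ℤ) : ((WQ k : ℚ) : ℂ) = Wt t k := by
  simp [WQ, vand, Wt]

theorem sq_ne (k : Fin t → ℤ) (i j : Fin t) (h : j ≠ i) : (Vv t i (k i) : ℚ) ^ 2 - (Vv t j (k j) : ℚ) ^ 2 ≠ 0 := by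
  intro h0
  have h1 : (Vv t i (k i)) ^ 2 = (Vv t j (k j)) ^ 2 := by
    have : (Vv t i (k i) : ℚ) ^ 2 = (Vv t j (k j) : ℚ) ^ 2 := by linarith
    exact_mod_cast this
  rcases sq_eq_sq_iff_eq_or_eq_neg.1 h1 with h2 | h2
  · have := cls_unique k (i, 1) (j, 1) 0 (by simpa [xx] using h2)
    exact h (Prod.ext_iff.1 this).1.symm
  · have := cls_unique k (i, 1) (j, -1) 0 (by simpa [xx] using h2)
    exact h (Prod.ext_iff.1 this).1.symm

theorem WQ_ne_zero (k : Fin t → ℤ) : WQ k ≠ 0 := by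
  unfold WQ vand
  rw [Finset.prod_ne_zero_iff]
  intro i _
  rw [Finset.prod_ne_zero_iff]
  intro j hj
  rw [Finset.mem_Ioi] at hj
  exact sq_ne k j i hj.ne

theorem WQ_mv {a : ℕ} (k : Fin t → ℤ) (p : Fin t × ℤˣ) (hp : xx k p = 2 * a + 1 - 2 * t) :
    WQ (mv k p) = WQ k * ∏ j ∈ Finset.univ.erase p.1, (((2 * a + 1 + 2 * t) ^ 2 - (Vv t j (k j) : ℚ) ^ 2) /
        ((2 * a + 1 - 2 * t) ^ 2 - (Vv t j (k j) : ℚ) ^ 2)) := by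
  have hsq : ∀ (k : Fin t → ℤ), ((xx k p : ℚ)) ^ 2 = (Vv t p.1 (k p.1) : ℚ) ^ 2 := by
    intro k
    rcases Int.units_eq_one_or p.2 with h | h <;> simp [xx, h]
  have h1 : (2 * a + 1 - 2 * t : ℚ) ^ 2 = (Vv t p.1 (k p.1) : ℚ) ^ 2 := by
    rw [← hsq, hp]; push_cast; ring
  have h2 : (2 * a + 1 + 2 * t : ℚ) ^ 2 = (Vv t p.1 (mv k p p.1) : ℚ) ^ 2 := by
    rw [← hsq, xx_mv_self, hp]; push_cast; ring
  have e1 : (fun i : Fin t => (Vv t i (k i) : ℚ) ^ 2) = Function.update (fun i : Fin t => (Vv t i (k i) : ℚ) ^ 2) p.1 ((2 * a + 1 - 2 * t : ℚ) ^ 2) := by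
    rw [h1]; exact (Function.update_eq_self _ _).symm
  have e2 : (fun i : Fin t => (Vv t i (mv k p i) : ℚ) ^ 2) = Function.update (fun i : Fin t => (Vv t i (k i) : ℚ) ^ 2) p.1 ((2 * a + 1 + 2 * t : ℚ) ^ 2) := by
    funext i
    by_cases hi : i = p.1
    · subst hi; rw [Function.update_self, h2]
    · rw [Function.update_of_ne hi, mv, Function.update_of_ne hi]
  unfold WQ
  rw [e2, vand_update _ p.1 _ ((2 * a + 1 - 2 * t : ℚ) ^ 2), ← e1]
  intro j hj
  rw [h1]
  exact sq_ne k p.1 j hj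

/-- the hook product in terms of principal arms -/
def FF (t : ℕ) (A : Finset ℕ) : ℚ :=
  ∏ a ∈ A, ((1 - 2 * t / (2 * a + 1) : ℚ) * ∏ b ∈ Finset.range a, (1 - (2 * t : ℚ) ^ 2 / (Hs A a b : ℚ) ^ 2))

theorem FF_insert {s : Finset ℕ} {a : ℕ} (hmax : ∀ x ∈ s, x < a) :
    FF t (insert a s) = ((1 - 2 * t / (2 * a + 1) : ℚ) * ∏ b ∈ Finset.range a, (1 - (2 * t : ℚ) ^ 2 / (Hs s a b : ℚ) ^ 2)) * FF t s := by
  have hH : ∀ x b, b < a → Hs (insert a s) x b = Hs s x b := by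
    intro x b hb
    simp [Hs, Finset.mem_insert, hb.ne]
  unfold FF
  rw [Finset.prod_insert (fun h => lt_irrefl _ (hmax _ h))]
  refine congrArg₂ (· * ·) (congrArg₂ (· * ·) rfl ?_) ?_
  · refine Finset.prod_congr rfl fun b hb => ?_
    rw [hH _ _ (Finset.mem_range.1 hb)]
  · refine Finset.prod_congr rfl fun x hx => ?_
    refine congrArg₂ (· * ·) rfl ?_
    refine Finset.prod_congr rfl fun b hb => ?_
    rw [hH _ _ ((Finset.mem_range.1 hb).trans (hmax _ hx))]

theorem FF_WQ {A : Finset ℕ} (ht : 0 < t) : ∀ k : Fin t → ℤ, RA A k → (-1) ^ A.card * FF t A * WQ (0 : Fin t → ℤ) = WQ k := by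
  induction A using Finset.induction_on_max with
  | empty =>
    intro k h
    rw [RA_empty ht h]
    simp [FF]
  | insert a s hmax ih =>
    intro k h
    obtain ⟨k', p, hx, rfl, h'⟩ := RA_down hmax h
    rw [FF_insert hmax, Finset.card_insert_of_notMem (fun h => lt_irrefl _ (hmax _ h)), G_eval2 hmax h' p hx,
      WQ_mv k' p hx, ← ih k' h']
    ring

theorem Hs_ne_of_FF {A : Finset ℕ} (ht : 0 < t) (hF : FF t A ≠ 0) (a b : ℕ) (ha : a ∈ A) (hb : b < a) : Hs A a b ≠ 2 * t := by
  intro h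
  apply hF
  unfold FF
  apply Finset.prod_eq_zero ha
  apply mul_eq_zero_of_right
  apply Finset.prod_eq_zero (Finset.mem_range.2 hb)
  rw [h]
  have : (t : ℚ) ≠ 0 := by exact_mod_cast ht.ne'
  push_cast
  rw [div_self (by positivity), sub_self]

theorem RA_of_FF {A : Finset ℕ} (ht : 0 < t) : FF t A ≠ 0 → ∃ k : Fin t → ℤ, RA A k := by
  induction A using Finset.induction_on_max with
  | empty => exact fun _ => ⟨0, RA_zero ht⟩
  | insert a s hmax ih =>
    intro hF
    have hH := fun b => Hs_ne_of_FF ht hF a b (Finset.mem_insert_self a s)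
    rw [FF_insert hmax] at hF
    obtain ⟨k, hk⟩ := ih (right_ne_zero_of_mul hF)
    obtain ⟨p, q, hq⟩ := rep_class_exists ht k (a : ℤ)
    have h1 : ¬ Rep k a := rep_gt hmax hk le_rfl
    rw [rep_of_class k hq] at h1
    have h2 : Rep k ((a : ℤ) - 2 * t) := by
      by_cases hat : 2 * t ≤ a
      · have h3 : a - 2 * t ∈ s := by
          by_contra h4
          apply hH (a - 2 * t) (by omega)
          have : a - 2 * t ∉ insert a s := by
            rw [Finset.mem_insert, not_or]; exact ⟨by omega, h4⟩
          simp only [Hs, this, if_false]; omega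
        rw [hk] at h3
        rwa [show ((a - 2 * t : ℕ) : ℤ) = (a : ℤ) - 2 * t by omega] at h3
      · have h3 : 2 * t - 1 - a ∉ s := by
          intro h4
          have := hmax _ h4
          apply hH (2 * t - 1 - a) (by omega)
          simp only [Hs, Finset.mem_insert_of_mem h4, if_true]; omega
        rw [hk, ← rep_symm ht] at h3
        rwa [show -1 - ((2 * t - 1 - a : ℕ) : ℤ) = (a : ℤ) - 2 * t by omega] at h3
    rw [rep_of_class k (p := p) (q := q + 1) (by rw [hq]; ring)] at h2
    have hq1 : q = -1 := by omega
    exact ⟨_, RA_up hk p a (by rw [hq, hq1]; ring)⟩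

theorem RA_core {A : Finset ℕ} (ht : 0 < t) {k : Fin t → ℤ} (h : RA A k) (a b : ℕ) (ha : a ∈ A) (hb : b < a) : ¬ 2 * t ∣ Hs A a b := by
  intro hd
  obtain ⟨p, q, hq⟩ := (h a).1 ha
  unfold Hs at hd
  split_ifs at hd with hbA
  · obtain ⟨c, hc⟩ := hd
    have h1 := (h b).1 hbA
    have hc' : (a : ℤ) + b + 1 = 2 * t * c := by exact_mod_cast hc
    have h2 : Rep k (-1 - (b : ℤ)) := by
      refine ⟨p, q + c, ?_⟩
      rw [hq]; push_cast; linear_combination 2 * hc'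
    rw [rep_symm ht] at h2
    exact h2 h1
  · obtain ⟨c, hc⟩ := hd
    apply hbA
    rw [h b]
    refine ⟨p, q + c, ?_⟩
    have hc' : (a : ℤ) - b = 2 * t * c := by
      have : a = b + 2 * t * c := by omega
      rw [this]; push_cast; ring
    rw [hq]; push_cast; linear_combination 2 * hc'

theorem core_of_FF {A : Finset ℕ} (ht : 0 < t) (hF : FF t A ≠ 0) (a b : ℕ) (ha : a ∈ A) (hb : b < a) : ¬ 2 * t ∣ Hs A a b := by
  obtain ⟨k, hk⟩ := RA_of_FF ht hF
  exact RA_core ht hk a b ha hb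

end Weights2

end NOC




namespace NOC

section Diagrams

theorem mem_lower_iff {S : Finset ℕ} (h : ∀ i ∈ S, ∀ j < i, j ∈ S) (i : ℕ) : i ∈ S ↔ i < S.card := by
  constructor
  · intro hi
    have : Finset.range (i + 1) ⊆ S := by
      intro j hj
      rw [Finset.mem_range] at hj
      rcases Nat.lt_or_ge j i with h1 | h1
      · exact h i hi j h1
      · rwa [show j = i by omega]
    have := Finset.card_le_card this
    rw [Finset.card_range] at this
    omega
  · intro hi
    by_contra hn
    have : S ⊆ Finset.range i := by
      intro j hj
      rw [Finset.mem_range]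
      by_contra hji
      rcases Nat.lt_or_ge i j with h1 | h1
      · exact hn (h j hj i h1)
      · exact hn (by rwa [show i = j by omega])
    have := Finset.card_le_card this
    rw [Finset.card_range] at this
    omega

variable {μ : YoungDiagram}

theorem sc_mem (h : μ.transpose = μ) (i j : ℕ) : (i, j) ∈ μ ↔ (j, i) ∈ μ := by
  conv_lhs => rw [← h]
  rw [YoungDiagram.mem_transpose]
  rfl

theorem sc_row (h : μ.transpose = μ) (i j : ℕ) : j < μ.rowLen i ↔ i < μ.rowLen j := by
  rw [← YoungDiagram.mem_iff_lt_rowLen, ← YoungDiagram.mem_iff_lt_rowLen, sc_mem h]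

theorem sc_col (h : μ.transpose = μ) (i : ℕ) : μ.colLen i = μ.rowLen i := by
  conv_lhs => rw [← h]
  rw [YoungDiagram.colLen_transpose]

theorem row_anti (μ : YoungDiagram) {i j : ℕ} (h : i ≤ j) : μ.rowLen j ≤ μ.rowLen i := μ.rowLen_anti i j h

/-- indices of diagonal cells -/
def DD (μ : YoungDiagram) : Finset ℕ := (Finset.range (μ.rowLen 0)).filter fun i => i < μ.rowLen i

theorem mem_DD (μ : YoungDiagram) (i : ℕ) : i ∈ DD μ ↔ i < μ.rowLen i := by
  rw [DD, Finset.mem_filter, Finset.mem_range]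
  have := row_anti μ (Nat.zero_le i)
  omega

/-- the set of principal arm lengths -/
def Arm (μ : YoungDiagram) : Finset ℕ := (DD μ).image fun i => μ.rowLen i - i - 1

theorem arm_injOn (μ : YoungDiagram) : ∀ i ∈ DD μ, ∀ j ∈ DD μ, μ.rowLen i - i - 1 = μ.rowLen j - j - 1 → i = j := by
  intro i hi j hj h
  rw [mem_DD] at hi hj
  rcases Nat.lt_trichotomy i j with h1 | h1 | h1
  · have := row_anti μ h1.le; omega
  · exact h1
  · have := row_anti μ h1.le; omega

theorem mem_Arm (μ : YoungDiagram) (a : ℕ) : a ∈ Arm μ ↔ ∃ i, i < μ.rowLen i ∧ μ.rowLen i - i - 1 = a := by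
  simp [Arm, mem_DD]

theorem hook_sc (h : μ.transpose = μ) (i j : ℕ) : hookLen μ (i, j) = μ.rowLen i + μ.rowLen j - i - j - 1 := by
  rw [hookLen, sc_col h]

theorem durfee_Arm (μ : YoungDiagram) : durfee μ = (Arm μ).card := by
  rw [Arm, Finset.card_image_of_injOn (fun i hi j hj h => arm_injOn μ i hi j hj h), durfee]
  refine Finset.card_bij (fun c _ => c.1) ?_ ?_ ?_
  · rintro ⟨i, j⟩ hc
    simp only [Finset.mem_filter, YoungDiagram.mem_cells] at hc
    obtain ⟨h1, rfl⟩ := hc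
    rwa [mem_DD, ← YoungDiagram.mem_iff_lt_rowLen]
  · rintro ⟨i, j⟩ hc ⟨i', j'⟩ hc' e
    simp only [Finset.mem_filter] at hc hc'
    ext
    · exact e
    · rw [← hc.2, ← hc'.2]; exact e
  · intro i hi
    rw [mem_DD, ← YoungDiagram.mem_iff_lt_rowLen] at hi
    exact ⟨(i, i), by simpa using hi, rfl⟩

theorem row_prod (h : μ.transpose = μ) (i : ℕ) (hi : i < μ.rowLen i) (w : ℕ → ℚ) :
    ∏ j ∈ Finset.Ioo i (μ.rowLen i), w (hookLen μ (i, j)) =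
      ∏ b ∈ Finset.range (μ.rowLen i - i - 1), w (Hs (Arm μ) (μ.rowLen i - i - 1) b) := by
  classical
  let β : ℕ → ℕ := fun j => if j < μ.rowLen j then μ.rowLen j - j - 1 else j - μ.rowLen j
  have hβA : ∀ j, β j ∈ Arm μ ↔ j < μ.rowLen j := by
    intro j
    by_cases hj : j < μ.rowLen j
    · simp only [β, hj, if_true, iff_true]
      exact (mem_Arm _ _).2 ⟨j, hj, rfl⟩
    · simp only [β, hj, if_false, iff_false]
      intro hm
      obtain ⟨l, hl, e⟩ := (mem_Arm _ _).1 hm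
      have h1 := sc_row h l j
      omega
  have hβlt : ∀ j ∈ Finset.Ioo i (μ.rowLen i), β j < μ.rowLen i - i - 1 := by
    intro j hj
    rw [Finset.mem_Ioo] at hj
    have h1 := row_anti μ hj.1.le
    have h2 := (sc_row h i j).1 hj.2
    simp only [β]
    split_ifs <;> omega
  have hinj : Set.InjOn β (Finset.Ioo i (μ.rowLen i) : Finset ℕ) := by
    intro j hj l hl e
    have e1 := hβA j
    have e2 := hβA l
    rw [e] at e1
    have e3 := e1.symm.trans e2
    simp only [β] at e
    rcases Nat.lt_trichotomy j l with h1 | h1 | h1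
    · have := row_anti μ h1.le
      split_ifs at e <;> omega
    · exact h1
    · have := row_anti μ h1.le
      split_ifs at e <;> omega
  have himg : (Finset.Ioo i (μ.rowLen i)).image β = Finset.range (μ.rowLen i - i - 1) := by
    apply Finset.eq_of_subset_of_card_le
    · intro x hx
      obtain ⟨j, hj, rfl⟩ := Finset.mem_image.1 hx
      exact Finset.mem_range.2 (hβlt j hj)
    · rw [Finset.card_image_of_injOn hinj, Finset.card_range, Nat.card_Ioo]
  rw [← himg, Finset.prod_image hinj]
  refine Finset.prod_congr rfl fun j hj => ?_
  have h3 := hβlt j hj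
  rw [Finset.mem_Ioo] at hj
  have h2 := (sc_row h i j).1 hj.2
  congr 1
  rw [hook_sc h, Hs]
  by_cases hjj : j < μ.rowLen j
  · rw [if_pos ((hβA j).2 hjj)]
    simp only [β, hjj, if_true]
    omega
  · rw [if_neg (fun hm => hjj ((hβA j).1 hm))]
    simp only [β, hjj, if_false] at h3 ⊢
    omega

theorem cells_prod (h : μ.transpose = μ) (f : ℕ × ℕ → ℚ) (g w : ℕ → ℚ)
    (hg : ∀ i, i < μ.rowLen i → f (i, i) = g (μ.rowLen i - i - 1))
    (hw : ∀ i j, i < j → j < μ.rowLen i → f (i, j) * f (j, i) = w (hookLen μ (i, j))) :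
    ∏ c ∈ μ.cells, f c = ∏ a ∈ Arm μ, (g a * ∏ b ∈ Finset.range a, w (Hs (Arm μ) a b)) := by
  classical
  rw [Arm, Finset.prod_image (fun i hi j hj h => arm_injOn μ i hi j hj h), ← Arm, Finset.prod_mul_distrib]
  have hmem : ∀ i j, (i, j) ∈ μ.cells ↔ j < μ.rowLen i := fun i j => by
    rw [YoungDiagram.mem_cells, YoungDiagram.mem_iff_lt_rowLen]
  have e1 : ∏ i ∈ DD μ, ∏ b ∈ Finset.range (μ.rowLen i - i - 1), w (Hs (Arm μ) (μ.rowLen i - i - 1) b) =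
      ∏ i ∈ DD μ, ∏ j ∈ Finset.Ioo i (μ.rowLen i), (f (i, j) * f (j, i)) := by
    refine Finset.prod_congr rfl fun i hi => ?_
    rw [← row_prod h i ((mem_DD _ _).1 hi)]
    refine Finset.prod_congr rfl fun j hj => ?_
    rw [Finset.mem_Ioo] at hj
    rw [hw i j hj.1 hj.2]
  have e2 : ∏ i ∈ DD μ, g (μ.rowLen i - i - 1) = ∏ c ∈ μ.cells.filter (fun c => c.1 = c.2), f c := by
    refine Finset.prod_bij (fun i _ => (i, i)) ?_ ?_ ?_ ?_
    · intro i hi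
      rw [mem_DD] at hi
      rw [Finset.mem_filter, hmem]
      exact ⟨hi, rfl⟩
    · intro i _ j _ e
      exact (Prod.ext_iff.1 e).1
    · rintro ⟨i, j⟩ hc
      rw [Finset.mem_filter, hmem] at hc
      obtain ⟨h1, h2⟩ := hc
      simp only at h2
      subst h2
      exact ⟨i, (mem_DD _ _).2 h1, rfl⟩
    · intro i hi
      exact (hg i ((mem_DD _ _).1 hi)).symm
  have e3 : ∏ i ∈ DD μ, ∏ j ∈ Finset.Ioo i (μ.rowLen i), f (i, j) = ∏ c ∈ (μ.cells.filter (fun c => ¬ c.1 = c.2)).filter (fun c => c.1 < c.2), f c := by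
    rw [Finset.prod_sigma']
    refine Finset.prod_bij (fun x _ => (x.1, x.2)) ?_ ?_ ?_ (fun _ _ => rfl)
    · rintro ⟨i, j⟩ hx
      simp only [Finset.mem_sigma, mem_DD, Finset.mem_Ioo] at hx
      simp only [Finset.mem_filter, hmem]
      omega
    · rintro ⟨i, j⟩ _ ⟨i', j'⟩ _ e
      simp only [Prod.mk.injEq] at e
      obtain ⟨rfl, rfl⟩ := e
      rfl
    · rintro ⟨i, j⟩ hc
      simp only [Finset.mem_filter, hmem] at hc
      refine ⟨⟨i, j⟩, ?_, rfl⟩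
      simp only [Finset.mem_sigma, mem_DD, Finset.mem_Ioo]
      omega
  have e4 : ∏ i ∈ DD μ, ∏ j ∈ Finset.Ioo i (μ.rowLen i), f (j, i) = ∏ c ∈ (μ.cells.filter (fun c => ¬ c.1 = c.2)).filter (fun c => ¬ c.1 < c.2), f c := by
    rw [Finset.prod_sigma']
    refine Finset.prod_bij (fun x _ => (x.2, x.1)) ?_ ?_ ?_ (fun _ _ => rfl)
    · rintro ⟨i, j⟩ hx
      simp only [Finset.mem_sigma, mem_DD, Finset.mem_Ioo] at hx
      simp only [Finset.mem_filter, hmem]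
      have := sc_row h i j
      omega
    · rintro ⟨i, j⟩ _ ⟨i', j'⟩ _ e
      simp only [Prod.mk.injEq] at e
      obtain ⟨rfl, rfl⟩ := e
      rfl
    · rintro ⟨j, i⟩ hc
      simp only [Finset.mem_filter, hmem] at hc
      refine ⟨⟨i, j⟩, ?_, rfl⟩
      simp only [Finset.mem_sigma, mem_DD, Finset.mem_Ioo]
      have := sc_row h i j
      omega
  rw [e1, e2]
  simp only [Finset.prod_mul_distrib]
  rw [e3, e4, Finset.prod_filter_mul_prod_filter_not, Finset.prod_filter_mul_prod_filter_not]

theorem card_Arm (h : μ.transpose = μ) : μ.card = ∑ a ∈ Arm μ, (2 * a + 1) := by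
  have := cells_prod h (fun _ => 2) (fun _ => 2) (fun _ => 4) (fun _ _ => rfl) (fun _ _ _ _ => by norm_num)
  rw [Finset.prod_const] at this
  have e : ∏ a ∈ Arm μ, ((2 : ℚ) * ∏ b ∈ Finset.range a, 4) = 2 ^ ∑ a ∈ Arm μ, (2 * a + 1) := by
    rw [← Finset.prod_pow_eq_pow_sum]
    refine Finset.prod_congr rfl fun a _ => ?_
    rw [Finset.prod_const, Finset.card_range, pow_succ, pow_mul]
    norm_num [mul_comm]
  rw [e] at this
  exact Nat.pow_right_injective (le_refl 2) (by exact_mod_cast this)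

theorem weight_Arm (t : ℕ) (h : μ.transpose = μ) :
    ∏ c ∈ μ.cells, (1 - 2 * t / ((hookLen μ c : ℚ) * epsQ c)) = FF t (Arm μ) := by
  refine cells_prod h _ (fun a => (1 - 2 * t / (2 * a + 1) : ℚ)) (fun x => 1 - (2 * t : ℚ) ^ 2 / (x : ℚ) ^ 2) ?_ ?_
  · intro i hi
    have e : hookLen μ (i, i) = 2 * (μ.rowLen i - i - 1) + 1 := by
      rw [hook_sc h]; omega
    simp only [e, epsQ, lt_irrefl, if_false, mul_one]
    push_cast
    rfl
  · intro i j hij hj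
    have e : hookLen μ (j, i) = hookLen μ (i, j) := by
      rw [hook_sc h, hook_sc h]; omega
    have e0 : hookLen μ (i, j) ≠ 0 := by
      rw [hook_sc h]
      have := sc_row h i j
      omega
    have e0' : (hookLen μ (i, j) : ℚ) ≠ 0 := by exact_mod_cast e0
    rw [e]
    simp only [epsQ, hij, if_true, hij.not_gt, if_false]
    field_simp
    ring

theorem noncore_zero (t : ℕ) (ht : 0 < t) (h : μ.transpose = μ) (hc : ∃ c ∈ μ.cells, 2 * t ∣ hookLen μ c) : FF t (Arm μ) = 0 := by
  by_contra hF
  have key : ∀ i j, i ≤ j → j < μ.rowLen i → ¬ 2 * t ∣ hookLen μ (i, j) := by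
    intro i j hij hj hd
    rcases Nat.eq_or_lt_of_le hij with rfl | hlt
    · have e : hookLen μ (i, i) = 2 * (μ.rowLen i - i - 1) + 1 := by
        rw [hook_sc h]; omega
      rw [e] at hd
      have := (Dvd.intro _ rfl : 2 ∣ 2 * t).trans hd
      omega
    · have hi : i < μ.rowLen i := by omega
      -- the row product of the indicator vanishes
      have h1 := row_prod h i hi (fun x => if 2 * t ∣ x then 0 else 1)
      have h0 : ∏ j ∈ Finset.Ioo i (μ.rowLen i), (if 2 * t ∣ hookLen μ (i, j) then (0 : ℚ) else 1) = 0 :=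
        Finset.prod_eq_zero (Finset.mem_Ioo.2 ⟨hlt, hj⟩) (if_pos hd)
      rw [h0] at h1
      obtain ⟨b, hb, hb2⟩ := Finset.prod_eq_zero_iff.1 h1.symm
      have h2 := core_of_FF ht hF _ b ((mem_Arm _ _).2 ⟨i, hi, rfl⟩) (Finset.mem_range.1 hb)
      rw [if_neg h2] at hb2
      exact one_ne_zero hb2
  obtain ⟨⟨i, j⟩, hm, hd⟩ := hc
  rw [YoungDiagram.mem_cells, YoungDiagram.mem_iff_lt_rowLen] at hm
  rcases Nat.le_total i j with hij | hij
  · exact key i j hij hm hd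
  · refine key j i hij ((sc_row h i j).1 hm) ?_
    rw [hook_sc h] at hd ⊢
    rwa [show μ.rowLen j + μ.rowLen i - j - i - 1 = μ.rowLen i + μ.rowLen j - i - j - 1 by omega]

/-- number of arms at least `d` -/
def NN (A : Finset ℕ) (d : ℕ) : ℕ := (A.filter fun a => d ≤ a).card

theorem NN_succ (A : Finset ℕ) (d : ℕ) : NN A d = NN A (d + 1) + if d ∈ A then 1 else 0 := by
  unfold NN
  split_ifs with h
  · have : A.filter (fun a => d ≤ a) = insert d (A.filter fun a => d + 1 ≤ a) := by
      ext a
      simp only [Finset.mem_filter, Finset.mem_insert]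
      constructor
      · rintro ⟨h1, h2⟩
        rcases Nat.eq_or_lt_of_le h2 with rfl | h3
        · exact Or.inl rfl
        · exact Or.inr ⟨h1, h3⟩
      · rintro (rfl | ⟨h1, h2⟩)
        · exact ⟨h, le_rfl⟩
        · exact ⟨h1, by omega⟩
    rw [this, Finset.card_insert_of_notMem (by simp)]
  · rw [add_zero]
    congr 1
    ext a
    simp only [Finset.mem_filter]
    constructor
    · rintro ⟨h1, h2⟩
      refine ⟨h1, ?_⟩
      by_contra h3
      exact h (by rwa [show d = a by omega])
    · rintro ⟨h1, h2⟩
      exact ⟨h1, by omega⟩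

theorem NN_add (A : Finset ℕ) (d e : ℕ) : NN A (d + e) ≤ NN A d ∧ NN A d ≤ NN A (d + e) + e := by
  induction e with
  | zero => simp
  | succ e ih =>
    have := NN_succ A (d + e)
    rw [← add_assoc]
    split_ifs at this <;> omega

theorem NN_inj {A B : Finset ℕ} (h : ∀ d, NN A d = NN B d) : A = B := by
  ext a
  have h1 := NN_succ A a
  have h2 := NN_succ B a
  rw [h, h] at h1
  split_ifs at h1 h2 <;> first | tauto | omega

theorem arm_char (h : μ.transpose = μ) (i d : ℕ) : (i, i + d) ∈ μ ↔ i < NN (Arm μ) d := by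
  have h1 : NN (Arm μ) d = ((DD μ).filter fun i => i + d < μ.rowLen i).card := by
    rw [NN, Arm, Finset.filter_image, Finset.card_image_of_injOn]
    · congr 1
      ext i
      simp only [Finset.mem_filter, mem_DD]
      omega
    · intro i hi j hj e
      exact arm_injOn μ i (Finset.mem_filter.1 hi).1 j (Finset.mem_filter.1 hj).1 e
  rw [h1, ← mem_lower_iff, Finset.mem_filter, mem_DD, YoungDiagram.mem_iff_lt_rowLen]
  · omega
  · intro i hi j hj
    rw [Finset.mem_filter, mem_DD] at hi ⊢
    have := row_anti μ hj.le
    omega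

theorem arm_inj {ν : YoungDiagram} (h : μ.transpose = μ) (h' : ν.transpose = ν) (e : Arm μ = Arm ν) : μ = ν := by
  have key : ∀ i j, i ≤ j → ((i, j) ∈ μ ↔ (i, j) ∈ ν) := by
    intro i j hij
    obtain ⟨d, rfl⟩ := Nat.exists_eq_add_of_le hij
    rw [arm_char h, arm_char h', e]
  apply SetLike.ext
  rintro ⟨i, j⟩
  rcases Nat.le_total i j with hij | hij
  · exact key i j hij
  · rw [sc_mem h, sc_mem h']
    exact key j i hij

/-- the self-conjugate diagram with given principal arms -/
def ofArm (A : Finset ℕ) : YoungDiagram where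
  cells := ((Finset.range (A.sup id + A.card + 1)) ×ˢ (Finset.range (A.sup id + A.card + 1))).filter
    fun c => min c.1 c.2 < NN A (max c.1 c.2 - min c.1 c.2)
  isLowerSet := by
    rintro ⟨i, j⟩ ⟨i', j'⟩ ⟨h1, h2⟩ h
    simp only [Finset.coe_filter, Finset.mem_product, Finset.mem_range, Set.mem_ofPred_eq] at h h1 h2 ⊢
    refine ⟨⟨by omega, by omega⟩, ?_⟩
    have h3 := h.2
    rcases Nat.le_total (max i j - min i j) (max i' j' - min i' j') with h4 | h4
    · obtain ⟨e, he⟩ := Nat.exists_eq_add_of_le h4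
      have := NN_add A (max i j - min i j) e
      rw [he]
      omega
    · obtain ⟨e, he⟩ := Nat.exists_eq_add_of_le h4
      have := NN_add A (max i' j' - min i' j') e
      rw [he] at h3
      omega

theorem mem_ofArm (A : Finset ℕ) (i j : ℕ) : (i, j) ∈ ofArm A ↔ min i j < NN A (max i j - min i j) := by
  rw [← YoungDiagram.mem_cells, ofArm]
  simp only [Finset.mem_filter, Finset.mem_product, Finset.mem_range, and_iff_right_iff_imp]
  intro h
  have h1 : NN A (max i j - min i j) ≤ A.card := Finset.card_filter_le _ _
  have h2 : max i j - min i j ≤ A.sup id := by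
    have : 0 < NN A (max i j - min i j) := by omega
    obtain ⟨a, ha⟩ := Finset.card_pos.1 this
    rw [Finset.mem_filter] at ha
    exact ha.2.trans (Finset.le_sup (f := id) ha.1)
  omega

theorem ofArm_sc (A : Finset ℕ) : (ofArm A).transpose = ofArm A := by
  apply SetLike.ext
  rintro ⟨i, j⟩
  rw [YoungDiagram.mem_transpose, Prod.swap, mem_ofArm, mem_ofArm, min_comm, max_comm]

theorem Arm_ofArm (A : Finset ℕ) : Arm (ofArm A) = A := by
  apply NN_inj
  intro d
  have key : ∀ i, i < NN (Arm (ofArm A)) d ↔ i < NN A d := by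
    intro i
    rw [← arm_char (ofArm_sc A), mem_ofArm, min_eq_left (by omega), max_eq_right (by omega), Nat.add_sub_cancel_left]
  have h1 := key (NN A d)
  have h2 := key (NN (Arm (ofArm A)) d)
  omega

/-- self-conjugate diagrams and finite sets of arms -/
def armEquiv : {μ : YoungDiagram // μ.transpose = μ} ≃ Finset ℕ where
  toFun μ := Arm μ.1
  invFun A := ⟨ofArm A, ofArm_sc A⟩
  left_inv μ := Subtype.ext (arm_inj (ofArm_sc _) μ.2 (Arm_ofArm _))
  right_inv A := Arm_ofArm A

end Diagrams

end NOC




namespace NOC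

section Final

theorem t2_ps : T2Space (PowerSeries ℚ) := inferInstanceAs (T2Space ((Unit →₀ ℕ) → ℚ))

theorem tendsto_ps {ι : Type*} {l : Filter ι} {F : ι → PowerSeries ℚ} {P : PowerSeries ℚ}
    (h : ∀ n, ∀ᶠ i in l, coeff n (F i) = coeff n P) : Filter.Tendsto F l (nhds P) := by
  have : @Filter.Tendsto ι ((Unit →₀ ℕ) → ℚ) F l (nhds P) := by
    refine tendsto_pi_nhds.2 ?_
    intro x
    have hx : x = Finsupp.single () (x ()) := by ext; simp
    refine tendsto_const_nhds.congr' ?_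
    filter_upwards [h (x ())] with i hi
    rw [hx]
    exact hi.symm
  exact this

theorem hasProd_ps {f : ℕ → PowerSeries ℚ} {P : PowerSeries ℚ} (hf : ∀ i, Cg (i + 1) (f i) 1) (hP : HasIProd f P) : HasProd f P := by
  refine tendsto_ps fun n => ?_
  obtain ⟨N0, hN0⟩ := hP (n + 1)
  rw [SummationFilter.unconditional_filter]
  filter_upwards [Filter.eventually_ge_atTop (Finset.range (max N0 (n + 1)))] with s hs
  have h1 := hN0 (max N0 (n + 1)) (le_max_left _ _)
  refine (Cg.trans ?_ h1).coeff_eq (Nat.lt_succ_self n)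
  rw [← Finset.prod_sdiff hs]
  have h2 : Cg (n + 1) (∏ i ∈ s \ Finset.range (max N0 (n + 1)), f i) (∏ i ∈ s \ Finset.range (max N0 (n + 1)), 1) := by
    refine Cg.prod _ fun i hi => ?_
    rw [Finset.mem_sdiff, Finset.mem_range] at hi
    exact (hf i).mono (by omega)
  rw [Finset.prod_const_one] at h2
  simpa using h2.mul (Cg.refl (n + 1) (∏ i ∈ Finset.range (max N0 (n + 1)), f i))

theorem prod_side (t : ℕ) : ∃ P : PowerSeries ℚ, HasProd (fun i : ℕ => (1 - X ^ (2 * (i + 1))) ^ (t + 1) *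
          (1 - X ^ (i + 1) : PowerSeries ℚ)⁻¹) P ∧ P * Eu ℚ 1 = Eu ℚ 2 ^ (t + 1) := by
  have hinv : ∀ i : ℕ, (1 - X ^ (i + 1) : PowerSeries ℚ)⁻¹ * (1 - X ^ (i + 1)) = 1 := by
    intro i
    exact PowerSeries.inv_mul_cancel _ (by simp)
  have hf : ∀ i : ℕ, Cg (i + 1) ((1 - X ^ (2 * (i + 1))) ^ (t + 1) * (1 - X ^ (i + 1) : PowerSeries ℚ)⁻¹) 1 := by
    intro i
    have h1 : Cg (i + 1) (1 - X ^ (2 * (i + 1)) : PowerSeries ℚ) 1 := by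
      refine ⟨-X ^ (i + 1), ?_⟩
      rw [two_mul, pow_add]; ring
    have h2 : Cg (i + 1) ((1 - X ^ (i + 1) : PowerSeries ℚ)⁻¹) 1 := by
      refine ⟨(1 - X ^ (i + 1) : PowerSeries ℚ)⁻¹, ?_⟩
      linear_combination hinv i
    simpa using (h1.pow (t + 1)).mul h2
  obtain ⟨P, hP⟩ := exists_hasIProd _ hf
  refine ⟨P, hasProd_ps hf hP, ?_⟩
  have h1 := hP.mul (hasIProd_Eu (K := ℚ) one_pos)
  have h2 := (hasIProd_Eu (K := ℚ) two_pos).pow (t + 1)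
  refine HasIProd.unique h1 ?_
  have e : (fun n : ℕ => (1 - X ^ (2 * (n + 1))) ^ (t + 1) * (1 - X ^ (n + 1) : PowerSeries ℚ)⁻¹ * (1 - X ^ (1 * (n + 1)))) =
      fun n : ℕ => (1 - X ^ (2 * (n + 1)) : PowerSeries ℚ) ^ (t + 1) := by
    funext n
    rw [one_mul, mul_assoc, hinv, mul_one]
  rw [e]
  exact h2

/-- sets of arms of size `n` -/
def fin_size (n : ℕ) : Finset (Finset ℕ) := (Finset.range (n + 1)).powerset.filter fun A => ∑ a ∈ A, (2 * a + 1) = n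

theorem mem_fin_size (n : ℕ) (A : Finset ℕ) : A ∈ fin_size n ↔ ∑ a ∈ A, (2 * a + 1) = n := by
  rw [fin_size, Finset.mem_filter, Finset.mem_powerset, and_iff_right_iff_imp]
  intro h a ha
  have := Finset.single_le_sum (f := fun a : ℕ => 2 * a + 1) (fun _ _ => Nat.zero_le _) ha
  rw [Finset.mem_range]
  omega

/-- the generating series -/
def GS (t : ℕ) : PowerSeries ℚ := PowerSeries.mk fun n => ∑ A ∈ fin_size n, (-1) ^ A.card * FF t A

theorem GS_SS (t : ℕ) (ht : 0 < t) : PowerSeries.C (Wt t 0) * PowerSeries.map (algebraMap ℚ ℂ) (GS t) = SS t (Wt t) := by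
  classical
  ext n
  rw [coeff_SS t _ n (n + 1) le_rfl, ← Finset.sum_filter, coeff_C_mul, coeff_map, GS, coeff_mk, map_sum, Finset.mul_sum]
  symm
  choose Ak hAk using fun k : Fin t → ℤ => RA_exists k
  refine Finset.sum_of_injOn Ak ?_ ?_ ?_ ?_
  · intro k _ k' _ e
    have h' := hAk k'
    rw [← e] at h'
    exact RA_inj ht (hAk k) h'
  · intro k hk
    rw [Finset.mem_coe, Finset.mem_filter] at hk
    rw [Finset.mem_coe, mem_fin_size, RA_size ht k (hAk k)]
    exact hk.2
  · intro A hA hn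
    by_cases hF : FF t A = 0
    · simp [hF]
    · exfalso
      obtain ⟨k, hk⟩ := RA_of_FF ht hF
      apply hn
      refine ⟨k, ?_, RA_unique (hAk k) hk⟩
      rw [mem_fin_size, RA_size ht k hk] at hA
      rw [Finset.mem_coe, Finset.mem_filter]
      exact ⟨mem_box le_rfl k hA, hA⟩
  · intro k _
    rw [← WQ_cast, ← WQ_cast, ← FF_WQ ht k (hAk k), eq_ratCast, ← Rat.cast_mul]
    congr 1
    ring

theorem GS_eq (t : ℕ) (ht : 0 < t) : Eu ℚ 1 ^ (2 * t - 1) * GS t = Eu ℚ 2 ^ ((t + 1) * (2 * t - 1)) := by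
  apply PowerSeries.map_injective (algebraMap ℚ ℂ) (algebraMap ℚ ℂ).injective
  rw [map_mul, map_pow, map_pow, map_Eu _ one_pos, map_Eu _ two_pos]
  have h0 : Wt t 0 ≠ 0 := by
    rw [← WQ_cast]
    exact_mod_cast WQ_ne_zero (0 : Fin t → ℤ)
  have h1 := main_series t ht
  rw [← GS_SS t ht] at h1
  have hC : PowerSeries.C ((Wt t 0)⁻¹) * PowerSeries.C (Wt t 0) = 1 := by
    rw [← map_mul, inv_mul_cancel₀ h0, map_one]
  have h2 := congrArg (fun z => PowerSeries.C ((Wt t 0)⁻¹) * z) h1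
  rw [← mul_assoc (C (Wt t 0)⁻¹) (C (Wt t 0)), hC, one_mul] at h2
  rw [← h2]
  linear_combination (-(Eu ℂ 1 ^ (2 * t - 1) * PowerSeries.map (algebraMap ℚ ℂ) (GS t))) * hC

theorem hasSum_SC (t : ℕ) : HasSum (fun μ : {μ : YoungDiagram // μ.transpose = μ} =>
          PowerSeries.C (R := ℚ) ((-1) ^ durfee μ.1 *
            ∏ c ∈ μ.1.cells, (1 - 2 * t / ((hookLen μ.1 c : ℚ) * epsQ c))) *
            X ^ μ.1.card) (GS t) := by
  classical
  have e : (fun μ : {μ : YoungDiagram // μ.transpose = μ} =>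
          PowerSeries.C (R := ℚ) ((-1) ^ durfee μ.1 *
            ∏ c ∈ μ.1.cells, (1 - 2 * t / ((hookLen μ.1 c : ℚ) * epsQ c))) *
            X ^ μ.1.card) = (fun A : Finset ℕ => PowerSeries.C (R := ℚ) ((-1) ^ A.card * FF t A) * X ^ (∑ a ∈ A, (2 * a + 1))) ∘ armEquiv := by
    funext μ
    simp only [Function.comp, armEquiv, Equiv.coe_fn_mk]
    rw [durfee_Arm, weight_Arm t μ.2, card_Arm μ.2]
  rw [e, armEquiv.hasSum_iff]
  refine tendsto_ps fun n => ?_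
  rw [SummationFilter.unconditional_filter]
  filter_upwards [Filter.eventually_ge_atTop (fin_size n)] with s hs
  rw [map_sum, GS, coeff_mk]
  symm
  have hc : ∀ A : Finset ℕ, coeff n (PowerSeries.C (R := ℚ) ((-1) ^ A.card * FF t A) * X ^ (∑ a ∈ A, (2 * a + 1))) =
      if A ∈ fin_size n then (-1) ^ A.card * FF t A else 0 := by
    intro A
    rw [coeff_C_mul, coeff_X_pow]
    simp [mem_fin_size, eq_comm]
  rw [Finset.sum_congr rfl fun A _ => hc A, ← Finset.sum_filter]
  refine Finset.sum_congr ?_ fun _ _ => rfl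
  ext A
  rw [Finset.mem_filter]
  exact ⟨fun h => ⟨hs h, h⟩, fun h => h.2⟩

end Final

end NOC

theorem NO_type_C_check_integer (t : ℕ) (ht : 2 ≤ t) :
    ((∏' i : ℕ, (1 - X ^ (2 * (i + 1))) ^ (t + 1) *
          (1 - X ^ (i + 1) : PowerSeries ℚ)⁻¹) ^ (2 * t - 1)
      = ∑' μ : {μ : YoungDiagram // μ.transpose = μ ∧
            ∀ c ∈ μ.cells, ¬ (2 * t) ∣ hookLen μ c},
          PowerSeries.C (R := ℚ) ((-1) ^ durfee μ.1 *
            ∏ c ∈ μ.1.cells, (1 - 2 * t / ((hookLen μ.1 c : ℚ) * epsQ c))) *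
            X ^ μ.1.card) ∧
    ((∏' i : ℕ, (1 - X ^ (2 * (i + 1))) ^ (t + 1) *
          (1 - X ^ (i + 1) : PowerSeries ℚ)⁻¹) ^ (2 * t - 1)
      = ∑' μ : {μ : YoungDiagram // μ.transpose = μ},
          PowerSeries.C (R := ℚ) ((-1) ^ durfee μ.1 *
            ∏ c ∈ μ.1.cells, (1 - 2 * t / ((hookLen μ.1 c : ℚ) * epsQ c))) *
            X ^ μ.1.card) ∧
    (∀ μ : YoungDiagram, μ.transpose = μ → (∃ c ∈ μ.cells, (2 * t) ∣ hookLen μ c) →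
      ∏ c ∈ μ.cells, (1 - 2 * t / ((hookLen μ c : ℚ) * epsQ c)) = 0) := by
  have ht0 : 0 < t := by omega
  haveI := NOC.t2_ps
  have h3 : ∀ μ : YoungDiagram, μ.transpose = μ → (∃ c ∈ μ.cells, (2 * t) ∣ hookLen μ c) →
      ∏ c ∈ μ.cells, (1 - 2 * t / ((hookLen μ c : ℚ) * epsQ c)) = 0 := by
    intro μ hμ hc
    rw [NOC.weight_Arm t hμ]
    exact NOC.noncore_zero t ht0 hμ hc
  obtain ⟨P, hP, hPE⟩ := NOC.prod_side t
  have hP2 : P ^ (2 * t - 1) = NOC.GS t := by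
    apply mul_left_cancel₀ (pow_ne_zero (2 * t - 1) (NOC.Eu_ne_zero (K := ℚ) one_pos))
    rw [NOC.GS_eq t ht0, ← mul_pow, mul_comm, hPE, ← pow_mul]
  rw [hP.tprod_eq, hP2]
  have hs := NOC.hasSum_SC t
  refine ⟨?_, hs.tsum_eq.symm, h3⟩
  symm
  apply HasSum.tsum_eq
  let g : {μ : YoungDiagram // μ.transpose = μ ∧ ∀ c ∈ μ.cells, ¬ (2 * t) ∣ hookLen μ c} →
      {μ : YoungDiagram // μ.transpose = μ} := fun μ => ⟨μ.1, μ.2.1⟩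
  have hg : Function.Injective g := by
    intro μ ν h
    exact Subtype.ext (congrArg (fun z => z.1) h)
  refine (hg.hasSum_iff ?_).2 hs
  intro μ hμ
  have : ∃ c ∈ μ.1.cells, (2 * t) ∣ hookLen μ.1 c := by
    by_contra hcon
    push Not at hcon
    exact hμ ⟨⟨μ.1, μ.2, hcon⟩, rfl⟩
  rw [h3 μ.1 μ.2 this, mul_zero, map_zero, zero_mul]
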